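/- For every real ε > 0 there exists Δ_ε such that the following holds for every integer Δ ≥ Δ_ε. Let G be a finite simple graph with vertex set V and maximum degree at most Δ, with each vertex v assigned a finite list L(v) ⊆ ℤ with |L(v)| ≥ ⌊(3/2 + ε)Δ⌋. Let R ⊆ V and suppose there are maps a, b : R → V ∖ R such that for every r ∈ R: a(r) ≠ b(r); both a(r) and b(r) are neighbours of r and have degree at least Δ^{1/4} in G; r has at most Δ^{1/4} neighbours in G; and every neighbour of r other than a(r) and b(r) has degree less than Δ^{1/4} in G. (Thus R is the core of a removable copy of H*, where H is the multigraph on W = a(R) ∪ b(R) having one edge joining a(r) and b(r) for each r ∈ R.) Suppose further that for every X ⊆ W, ∑_{v∈X} d_{G−R}(v) − |{r ∈ R : exactly one of a(r), b(r) lies in X}| ≤ εΔ|X|/10, where d_{G−R}(v) denotes the number of neighbours of v lying in V ∖ R. Then every map c : V ∖ R → ℤ such that c(v) ∈ L(v) for all v ∈ V ∖ R, such that c(u) ≠ c(v) whenever u ≠ v are at distance at most 2 in G, and such that |c(u) − c(v)| ≥ Δ^{1/4} whenever u and v are adjacent in G, extends to a map c' : V → ℤ with the same three properties on all of V. -/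

import Mathlib

noncomputable section

set_option linter.unusedSectionVars false
set_option linter.unusedVariables false

open Finset
open scoped Classical

/-- A loopless multigraph: each edge has two distinct ends. -/
structure Multi (V E : Type*) where
  s : E → V
  t : E → V
  ne : ∀ e, s e ≠ t e

namespace Multi
variable {V E : Type*} [Fintype V] [DecidableEq V] [Fintype E] [DecidableEq E] (H : Multi V E)

/-- The edge `e` is incident with the vertex `v`. -/
def inc (e : E) (v : V) : Prop := H.s e = v ∨ H.t e = v

/-- The edges incident with `v`. -/
def star (v : V) : Finset E := univ.filter fun e => H.inc e v

/-- The end of `e` other than `v`. -/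
def other (e : E) (v : V) : V := if H.s e = v then H.t e else H.s e

/-- `M` is a matching. -/
def IsM (M : Finset E) : Prop := ∀ e ∈ M, ∀ f ∈ M, ∀ v, H.inc e v → H.inc f v → e = f

/-- `M` covers no vertex of `X`. -/
def free (M : Finset E) (X : Finset V) : Prop := ∀ e ∈ M, H.s e ∉ X ∧ H.t e ∉ X

/-- The vertices covered by `M`. -/
def verts (M : Finset E) : Finset V := univ.filter fun v => ∃ e ∈ M, H.inc e v

/-- The weight of a set of edges in the monomer-dimer model with activities `l`. -/
def wt (l : E → ℝ) (M : Finset E) : ℝ := if H.IsM M then ∏ e ∈ M, l e else 0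

/-- The partition function of the monomer-dimer model. -/
def Z (l : E → ℝ) : ℝ := ∑ M : Finset E, H.wt l M

/-- Delete the vertices in `X`, by setting to zero the activities of the edges that meet `X`. -/
def del (X : Finset V) (l : E → ℝ) : E → ℝ := fun e => if H.s e ∈ X ∨ H.t e ∈ X then 0 else l e

variable {H}

theorem mem_star {e : E} {v : V} : e ∈ H.star v ↔ H.inc e v := by simp [star]

theorem inc_s (e : E) : H.inc e (H.s e) := Or.inl rfl
theorem inc_t (e : E) : H.inc e (H.t e) := Or.inr rfl

theorem inc_other {e : E} {v : V} : H.inc e (H.other e v) := by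
  unfold other; split_ifs
  exacts [inc_t e, inc_s e]

theorem other_ne {e : E} {v : V} (h : H.inc e v) : H.other e v ≠ v := by
  unfold other; split_ifs with h1
  · rw [← h1]; exact (H.ne e).symm
  · exact h1

theorem pair_eq {e : E} {v : V} (h : H.inc e v) :
    ({v} ∪ {H.other e v} : Finset V) = {H.s e, H.t e} := by
  unfold other; split_ifs with h1
  · subst h1; ext; simp
  · have := h.resolve_left h1; subst this; ext; simp [or_comm]

theorem inc_iff_of_inc {e : E} {v w : V} (h : H.inc e v) :
    H.inc e w ↔ w = v ∨ w = H.other e v := by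
  unfold other; split_ifs with h1
  · subst h1; simp [inc, eq_comm]
  · have := h.resolve_left h1; subst this; simp [inc, eq_comm, or_comm]

theorem other_mem {e : E} {u w : V} (hu : H.inc e u) (hw : H.inc e w) (h : u ≠ w) :
    H.other e u = w := by
  rcases (inc_iff_of_inc hu).1 hw with h1 | h1
  · exact absurd h1.symm h
  · exact h1.symm

theorem mem_verts {M : Finset E} {v : V} : v ∈ H.verts M ↔ ∃ e ∈ M, H.inc e v := by simp [verts]

theorem free_iff {M : Finset E} {X : Finset V} :
    H.free M X ↔ ∀ e ∈ M, ∀ v ∈ X, ¬ H.inc e v := by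
  constructor
  · rintro h e he v hv (rfl | rfl)
    exacts [(h e he).1 hv, (h e he).2 hv]
  · intro h e he
    exact ⟨fun h1 => h e he _ h1 (inc_s e), fun h1 => h e he _ h1 (inc_t e)⟩

theorem free_singleton {M : Finset E} {v : V} :
    H.free M {v} ↔ ∀ e ∈ M, ¬ H.inc e v := by simp [free_iff]

theorem free_union {M : Finset E} {X Y : Finset V} :
    H.free M (X ∪ Y) ↔ H.free M X ∧ H.free M Y := by
  simp only [free, mem_union, not_or]
  constructor
  · intro h; exact ⟨fun e he => ⟨(h e he).1.1, (h e he).2.1⟩, fun e he => ⟨(h e he).1.2, (h e he).2.2⟩⟩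
  · rintro ⟨h1, h2⟩ e he; exact ⟨⟨(h1 e he).1, (h2 e he).1⟩, (h1 e he).2, (h2 e he).2⟩

theorem isM_empty : H.IsM ∅ := by simp [IsM]

theorem IsM.mono {M N : Finset E} (h : H.IsM M) (hN : N ⊆ M) : H.IsM N :=
  fun e he f hf v => h e (hN he) f (hN hf) v

theorem isM_insert {e : E} {N : Finset E} (he : e ∉ N) :
    H.IsM (insert e N) ↔ H.IsM N ∧ H.free N {H.s e, H.t e} := by
  constructor
  · intro h
    refine ⟨h.mono (subset_insert _ _), free_iff.2 fun f hf v hv hi => ?_⟩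
    have : e = f := h e (mem_insert_self _ _) f (mem_insert_of_mem hf) v
      (by rcases mem_insert.1 hv with rfl | hv
          · exact inc_s e
          · rw [mem_singleton.1 hv]; exact inc_t e) hi
    exact he (this ▸ hf)
  · rintro ⟨h1, h2⟩ f hf g hg v hfv hgv
    have key : ∀ f ∈ N, H.inc f v → H.inc e v → False := by
      intro f hf h3 h4
      refine free_iff.1 h2 f hf v ?_ h3
      rcases h4 with rfl | rfl <;> simp
    rcases mem_insert.1 hf with rfl | hf' <;> rcases mem_insert.1 hg with rfl | hg'
    · rfl
    · exact (key g hg' hgv hfv).elim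
    · exact (key f hf' hfv hgv).elim
    · exact h1 f hf' g hg' v hfv hgv

theorem del_le {l : E → ℝ} (hl : ∀ e, 0 ≤ l e) (X : Finset V) (e : E) : H.del X l e ≤ l e := by
  unfold del; split_ifs
  exacts [hl e, le_rfl]

theorem del_nonneg {l : E → ℝ} (hl : ∀ e, 0 ≤ l e) (X : Finset V) (e : E) : 0 ≤ H.del X l e := by
  unfold del; split_ifs
  exacts [le_rfl, hl e]

theorem del_del (X Y : Finset V) (l : E → ℝ) : H.del X (H.del Y l) = H.del (Y ∪ X) l := by
  funext e; unfold del
  by_cases h1 : H.s e ∈ X <;> by_cases h2 : H.t e ∈ X <;> by_cases h3 : H.s e ∈ Y <;>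
    by_cases h4 : H.t e ∈ Y <;> simp [h1, h2, h3, h4]

theorem del_comm (X Y : Finset V) (l : E → ℝ) : H.del X (H.del Y l) = H.del Y (H.del X l) := by
  rw [del_del, del_del, union_comm]

theorem del_empty (l : E → ℝ) : H.del ∅ l = l := by funext e; simp [del]

theorem del_of_inc {l : E → ℝ} {X : Finset V} {e : E} {v : V} (hv : v ∈ X) (h : H.inc e v) :
    H.del X l e = 0 := by
  unfold del; rcases h with rfl | rfl <;> simp [hv]

theorem wt_del (X : Finset V) (l : E → ℝ) (M : Finset E) :
    H.wt (H.del X l) M = if H.free M X then H.wt l M else 0 := by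
  unfold wt
  by_cases hM : H.IsM M
  · simp only [hM, if_true]
    split_ifs with h
    · refine prod_congr rfl fun e he => ?_
      simp [del, (h e he).1, (h e he).2]
    · unfold free at h; push Not at h
      obtain ⟨e, he, h1⟩ := h
      refine prod_eq_zero he ?_
      unfold del
      by_cases h2 : H.s e ∈ X
      · simp [h2]
      · simp [h1 h2]
  · simp [hM]

theorem wt_nonneg {l : E → ℝ} (hl : ∀ e, 0 ≤ l e) (M : Finset E) : 0 ≤ H.wt l M := by
  unfold wt; split_ifs
  exacts [prod_nonneg fun e _ => hl e, le_rfl]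

theorem isM_of_wt {l : E → ℝ} {M : Finset E} (h : H.wt l M ≠ 0) : H.IsM M := by
  unfold wt at h; by_contra h1; simp [h1] at h

theorem Z_pos {l : E → ℝ} (hl : ∀ e, 0 ≤ l e) : 0 < H.Z l := by
  refine lt_of_lt_of_le one_pos ?_
  calc (1 : ℝ) = H.wt l ∅ := by simp [wt, isM_empty]
    _ ≤ _ := single_le_sum (f := fun M => H.wt l M) (fun M _ => wt_nonneg hl M) (mem_univ _)

theorem wt_mono {l l' : E → ℝ} (hl : ∀ e, 0 ≤ l e) (h : ∀ e, l e ≤ l' e) (M : Finset E) :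
    H.wt l M ≤ H.wt l' M := by
  unfold wt; split_ifs
  exacts [prod_le_prod (fun e _ => hl e) fun e _ => h e, le_rfl]

theorem Z_mono {l l' : E → ℝ} (hl : ∀ e, 0 ≤ l e) (h : ∀ e, l e ≤ l' e) : H.Z l ≤ H.Z l' :=
  sum_le_sum fun M _ => wt_mono hl h M

theorem Z_del_le {l : E → ℝ} (hl : ∀ e, 0 ≤ l e) (X : Finset V) : H.Z (H.del X l) ≤ H.Z l :=
  Z_mono (del_nonneg hl X) (del_le hl X)

theorem Z_del (X : Finset V) (l : E → ℝ) :
    H.Z (H.del X l) = ∑ M : Finset E, if H.free M X then H.wt l M else 0 := by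
  simp only [Z, wt_del]

theorem wt_insert {l : E → ℝ} {e : E} {N : Finset E} (he : e ∉ N) :
    H.wt l (insert e N) = l e * H.wt (H.del {H.s e, H.t e} l) N := by
  rw [wt_del]; unfold wt
  rw [isM_insert he]
  by_cases h1 : H.IsM N <;> by_cases h2 : H.free N {H.s e, H.t e} <;> simp [h1, h2, prod_insert he]

theorem not_mem_of_free {e : E} {N : Finset E} (h : H.free N {H.s e, H.t e}) : e ∉ N :=
  fun he => (h e he).1 (by simp)

theorem sum_wt_mem (l : E → ℝ) (e : E) (g : Finset E → ℝ) :
    ∑ M : Finset E, (if e ∈ M then H.wt l M * g M else 0) =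
      l e * ∑ N : Finset E, H.wt (H.del {H.s e, H.t e} l) N * g (insert e N) := by
  rw [← sum_filter, mul_sum]
  have h2 : ∑ N : Finset E, l e * (H.wt (H.del {H.s e, H.t e} l) N * g (insert e N)) =
      ∑ N ∈ univ.filter (fun N : Finset E => e ∉ N),
        l e * (H.wt (H.del {H.s e, H.t e} l) N * g (insert e N)) := by
    rw [sum_filter]
    refine sum_congr rfl fun N _ => ?_
    split_ifs with h
    · rw [wt_del, if_neg (fun hf => not_mem_of_free hf h)]; ring
    · rfl
  rw [h2]
  refine sum_bij' (fun M _ => M.erase e) (fun N _ => insert e N) ?_ ?_ ?_ ?_ ?_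
  · intro M _; simp
  · intro N _; simp
  · intro M hM; exact insert_erase (by simpa using hM)
  · intro N hN; exact erase_insert (by simpa using hN)
  · intro M hM
    have hM : e ∈ M := by simpa using hM
    have := wt_insert (H := H) (l := l) (notMem_erase e M)
    rw [insert_erase hM] at this
    rw [insert_erase hM, this]; ring

theorem sum_wt_mem_one (l : E → ℝ) (e : E) :
    ∑ M : Finset E, (if e ∈ M then H.wt l M else 0) = l e * H.Z (H.del {H.s e, H.t e} l) := by
  simpa [Z] using sum_wt_mem (H := H) l e (fun _ => 1)

/-- A matching either leaves `v` free or contains exactly one edge at `v`. -/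
theorem IsM.free_add_sum {M : Finset E} (h : H.IsM M) (v : V) :
    (if H.free M {v} then (1 : ℝ) else 0) + ∑ e ∈ H.star v, (if e ∈ M then 1 else 0) = 1 := by
  by_cases hf : H.free M {v}
  · rw [if_pos hf, sum_eq_zero, add_zero]
    intro e he
    rw [if_neg]
    intro h1
    exact free_singleton.1 hf e h1 (mem_star.1 he)
  · rw [if_neg hf, zero_add]
    rw [free_singleton] at hf; push Not at hf
    obtain ⟨e, he, hv⟩ := hf
    rw [sum_eq_single e]
    · simp [he]
    · intro f hf hne
      rw [if_neg]
      intro h1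
      exact hne (h f h1 e he v (mem_star.1 hf) hv)
    · intro h1; exact absurd (mem_star.2 hv) h1

theorem Z_rec (l : E → ℝ) (v : V) :
    H.Z l = H.Z (H.del {v} l) + ∑ e ∈ H.star v, l e * H.Z (H.del {H.s e, H.t e} l) := by
  simp only [← sum_wt_mem_one]
  rw [sum_comm, Z_del, Z, ← sum_add_distrib]
  refine sum_congr rfl fun M _ => ?_
  by_cases hM : H.IsM M
  · have := hM.free_add_sum v
    calc H.wt l M = H.wt l M * 1 := by ring
      _ = _ := by
        rw [← this, mul_add, mul_sum]; simp
  · simp [wt, hM]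

/-- The recursion for the partition function, with the neighbours as a second deleted vertex. -/
theorem Z_rec' (l : E → ℝ) (v : V) :
    H.Z l = H.Z (H.del {v} l) +
      ∑ e ∈ H.star v, l e * H.Z (H.del {H.other e v} (H.del {v} l)) := by
  rw [Z_rec l v]
  congr 1
  refine sum_congr rfl fun e he => ?_
  rw [del_del, pair_eq (mem_star.1 he)]

/-- Conditioning on the part of the matching inside `O`. -/
theorem sum_wt_split (l : E → ℝ) (O : Finset E) (g : Finset E → ℝ) :
    ∑ M : Finset E, H.wt l M * g M =
      ∑ A : Finset E, H.wt (fun e => if e ∈ O then l e else 0) A *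
        ∑ N : Finset E, H.wt (H.del (H.verts A) (fun e => if e ∈ O then 0 else l e)) N * g (A ∪ N) := by
  have hA : ∀ A : Finset E, ¬ A ⊆ O → H.wt (fun e => if e ∈ O then l e else 0) A = 0 := by
    intro A h
    obtain ⟨e, he, h1⟩ := not_subset.1 h
    unfold wt; split_ifs
    · exact prod_eq_zero he (by simp [h1])
    · rfl
  have hN : ∀ A N : Finset E, ¬ Disjoint N O →
      H.wt (H.del (H.verts A) (fun e => if e ∈ O then 0 else l e)) N = 0 := by
    intro A N h
    obtain ⟨e, he, h1⟩ := not_disjoint_iff.1 h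
    rw [wt_del]; unfold wt; split_ifs
    · exact prod_eq_zero he (by simp [h1])
    · rfl
    · rfl
  have hAN : ∀ A N : Finset E, A ⊆ O → Disjoint N O →
      H.wt l (A ∪ N) = H.wt (fun e => if e ∈ O then l e else 0) A *
        H.wt (H.del (H.verts A) (fun e => if e ∈ O then 0 else l e)) N := by
    intro A N h1 h2
    have hd : Disjoint A N := disjoint_of_subset_left h1 h2.symm
    have hI : H.IsM (A ∪ N) ↔ H.IsM A ∧ H.IsM N ∧ H.free N (H.verts A) := by
      constructor
      · intro h
        refine ⟨h.mono subset_union_left, h.mono subset_union_right, free_iff.2 ?_⟩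
        intro e he v hv hi
        obtain ⟨f, hf, hfv⟩ := mem_verts.1 hv
        have := h e (mem_union_right _ he) f (mem_union_left _ hf) v hi hfv
        subst this
        exact disjoint_left.1 hd hf he
      · rintro ⟨ha, hn, hf⟩ e he f hf' v hev hfv
        rcases mem_union.1 he with he | he <;> rcases mem_union.1 hf' with hf' | hf'
        · exact ha e he f hf' v hev hfv
        · exact (free_iff.1 hf f hf' v (mem_verts.2 ⟨e, he, hev⟩) hfv).elim
        · exact (free_iff.1 hf e he v (mem_verts.2 ⟨f, hf', hfv⟩) hev).elim
        · exact hn e he f hf' v hev hfv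
    rw [wt_del]
    unfold wt
    rw [hI]
    by_cases ha : H.IsM A <;> by_cases hn : H.IsM N <;> by_cases hf : H.free N (H.verts A) <;>
      simp only [ha, hn, hf, and_true, and_false, if_true, if_false, mul_zero, zero_mul, true_and,
        false_and]
    rw [prod_union hd]
    congr 1
    · exact prod_congr rfl fun e he => by simp [h1 he]
    · exact prod_congr rfl fun e he => by simp [disjoint_left.1 h2 he]
  simp_rw [mul_sum, ← mul_assoc]
  rw [← sum_product']
  symm
  have h3 : ∑ x ∈ (univ : Finset (Finset E)) ×ˢ (univ : Finset (Finset E)),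
      H.wt (fun e => if e ∈ O then l e else 0) x.1 *
        H.wt (H.del (H.verts x.1) (fun e => if e ∈ O then 0 else l e)) x.2 * g (x.1 ∪ x.2) =
      ∑ x ∈ ((univ : Finset (Finset E)) ×ˢ (univ : Finset (Finset E))).filter
        (fun x => x.1 ⊆ O ∧ Disjoint x.2 O), H.wt l (x.1 ∪ x.2) * g (x.1 ∪ x.2) := by
    rw [sum_filter]
    refine sum_congr rfl fun x _ => ?_
    split_ifs with h
    · rw [hAN _ _ h.1 h.2]
    · rw [not_and_or] at h
      rcases h with h | h
      · rw [hA _ h]; ring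
      · rw [hN _ _ h]; ring
  rw [h3]
  refine sum_bij' (fun x _ => x.1 ∪ x.2) (fun M _ => (M ∩ O, M \ O)) ?_ ?_ ?_ ?_ ?_
  · intro x _; simp
  · intro M _; simp [inter_subset_right, sdiff_disjoint]
  · rintro ⟨A, N⟩ h
    simp only [mem_filter, mem_product, mem_univ, true_and] at h
    ext x
    · simp only [mem_inter, mem_union]
      constructor
      · rintro ⟨h1 | h1, h2⟩
        · exact h1
        · exact (disjoint_left.1 h.2 h1 h2).elim
      · intro h1; exact ⟨Or.inl h1, h.1 h1⟩
    · simp only [mem_sdiff, mem_union]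
      constructor
      · rintro ⟨h1 | h1, h2⟩
        · exact (h2 (h.1 h1)).elim
        · exact h1
      · intro h1; exact ⟨Or.inr h1, disjoint_left.1 h.2 h1⟩
  · intro M _
    simp only [union_comm (M ∩ O), sdiff_union_inter]
  · intro x _; rfl

end Multi

namespace Multi
variable {V E : Type*} [Fintype V] [DecidableEq V] [Fintype E] [DecidableEq E] {H : Multi V E}

theorem Z_del_mono {l : E → ℝ} (hl : ∀ e, 0 ≤ l e) {X Y : Finset V} (h : X ⊆ Y) :
    H.Z (H.del Y l) ≤ H.Z (H.del X l) := by
  have : H.del Y l = H.del Y (H.del X l) := by rw [del_del, union_eq_right.2 h]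
  rw [this]
  exact Z_del_le (del_nonneg hl X) Y

theorem Z_rec_del (l : E → ℝ) (S : Finset V) (v : V) :
    H.Z (H.del S l) = H.Z (H.del S (H.del {v} l)) + ∑ e ∈ H.star v,
      H.del S l e * H.Z (H.del (S ∪ {H.other e v}) (H.del {v} l)) := by
  rw [Z_rec' (H.del S l) v, del_comm {v} S]
  congr 1
  refine sum_congr rfl fun e _ => ?_
  rw [del_del]

/-- The vertices that meet an edge of nonzero activity. -/
def alive (H : Multi V E) (l : E → ℝ) : Finset V :=
  univ.filter fun v => ∃ e ∈ H.star v, l e ≠ 0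

theorem card_alive_del {l : E → ℝ} {v : V} {e : E} (he : e ∈ H.star v) (hl : l e ≠ 0) :
    (H.alive (H.del {v} l)).card < (H.alive l).card := by
  refine card_lt_card ⟨?_, ?_⟩
  · intro w hw
    simp only [alive, mem_filter, mem_univ, true_and] at hw ⊢
    obtain ⟨f, hf, h⟩ := hw
    refine ⟨f, hf, fun h0 => h ?_⟩
    simp [del, h0]
  · intro h
    have h1 : v ∈ H.alive l := by simpa [alive] using ⟨e, he, hl⟩
    have h2 := h h1
    simp only [alive, mem_filter, mem_univ, true_and] at h2
    obtain ⟨f, hf, h3⟩ := h2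
    exact h3 (del_of_inc (mem_singleton_self v) (mem_star.1 hf))

theorem gallai_aux (n : ℕ) : ∀ l : E → ℝ, (∀ e, 0 ≤ l e) → (H.alive l).card ≤ n →
    ∀ u v w : V, u ≠ v → u ≠ w → v ≠ w →
    (H.Z (H.del {u, w} l) * H.Z (H.del {v} l) ≤
      H.Z l * (H.Z (H.del {u, v} l) + H.Z (H.del {w, v} l))) ∧
    (H.Z (H.del {u, w, v} l) * H.Z l ≤
      H.Z (H.del {v} l) * (H.Z (H.del {u} l) + H.Z (H.del {w} l))) := by
  induction n with
  | zero =>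
    intro l hl h u v w _ _ _
    have h0 : ∀ e, l e = 0 := by
      intro e
      by_contra he
      have : H.s e ∈ H.alive l := by
        simp only [alive, mem_filter, mem_univ, true_and]
        exact ⟨e, mem_star.2 (inc_s e), he⟩
      rw [Nat.le_zero, card_eq_zero] at h
      simp [h] at this
    have h1 : ∀ X, H.del X l = l := by intro X; funext e; simp [del, h0]
    have := Z_pos (H := H) hl
    simp only [h1]
    constructor <;> nlinarith
  | succ n ih =>
    intro l hl h u v w huv huw hvw
    set N := H.del {v} l with hN
    have hN0 : ∀ e, 0 ≤ N e := del_nonneg hl _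
    have hd : ∀ S : Finset V, H.del (S ∪ {v}) l = H.del S N := by
      intro S; rw [hN, del_del, union_comm]
    have hpos : ∀ S : Finset V, 0 ≤ H.Z (H.del S N) := fun S => (Z_pos (del_nonneg hN0 S)).le
    have hmono : ∀ {S T : Finset V}, S ⊆ T → H.Z (H.del T N) ≤ H.Z (H.del S N) :=
      fun h => Z_del_mono hN0 h
    have hle : ∀ S, H.Z (H.del S N) ≤ H.Z N := fun S => Z_del_le hN0 S
    have hcard : ∀ e ∈ H.star v, l e ≠ 0 → (H.alive N).card ≤ n := by
      intro e he h0
      have := card_alive_del he h0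
      rw [← hN] at this
      omega
    have e0 : H.Z l = H.Z N + ∑ e ∈ H.star v, l e * H.Z (H.del {H.other e v} N) := Z_rec' l v
    have euw := Z_rec_del (H := H) l {u, w} v
    have eu := Z_rec_del (H := H) l {u} v
    have ew := Z_rec_del (H := H) l {w} v
    have euv : H.Z (H.del {u, v} l) = H.Z (H.del {u} N) := by rw [← hd]; congr 2
    have ewv : H.Z (H.del {w, v} l) = H.Z (H.del {w} N) := by rw [← hd]; congr 2
    have euwv : H.Z (H.del {u, w, v} l) = H.Z (H.del {u, w} N) := by
      rw [← hd]; congr 2; ext; simp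
    have h1 : H.Z (H.del {u, w} N) ≤ H.Z (H.del {u} N) + H.Z (H.del {w} N) := by
      have := hmono (S := {u}) (T := {u, w}) (by simp)
      have := hpos {w}
      linarith
    constructor
    · rw [euv, ewv, euw, e0, add_mul, add_mul, sum_mul, sum_mul]
      refine add_le_add ?_ (sum_le_sum fun e he => ?_)
      · rw [mul_comm]; exact mul_le_mul_of_nonneg_left h1 (by simpa [del_empty] using hpos ∅)
      · by_cases hz : H.del {u, w} l e = 0
        · rw [hz]; simp only [zero_mul]
          exact mul_nonneg (mul_nonneg (hl e) (hpos _)) (add_nonneg (hpos _) (hpos _))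
        · have hs : ¬ (H.s e ∈ ({u, w} : Finset V) ∨ H.t e ∈ ({u, w} : Finset V)) := by
            intro h3; exact hz (if_pos h3)
          have hle' : H.del {u, w} l e = l e := by simp only [del, if_neg hs]
          rw [hle'] at hz ⊢
          have hx : H.other e v ∉ ({u, w} : Finset V) := by
            intro h3
            rcases inc_other (H := H) (e := e) (v := v) with h4 | h4 <;> rw [← h4] at h3 <;> tauto
          simp only [mem_insert, mem_singleton, not_or] at hx
          have := (ih N hN0 (hcard e he hz) u (H.other e v) w (Ne.symm hx.1) huw hx.2).2
          have h5 : ({u, w} ∪ {H.other e v} : Finset V) = {u, w, H.other e v} := by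
            ext; simp
          rw [h5, mul_assoc, mul_assoc]
          exact mul_le_mul_of_nonneg_left this (hl e)
    · rw [euwv, eu, ew, e0]
      rw [show H.Z (H.del {u} N) + ∑ e ∈ H.star v, H.del {u} l e * H.Z (H.del ({u} ∪ {H.other e v}) N) +
        (H.Z (H.del {w} N) + ∑ e ∈ H.star v, H.del {w} l e * H.Z (H.del ({w} ∪ {H.other e v}) N)) =
        (H.Z (H.del {u} N) + H.Z (H.del {w} N)) +
          ∑ e ∈ H.star v, (H.del {u} l e * H.Z (H.del ({u} ∪ {H.other e v}) N) +
            H.del {w} l e * H.Z (H.del ({w} ∪ {H.other e v}) N)) by rw [sum_add_distrib]; ring]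
      rw [mul_add, mul_add, mul_sum, mul_sum]
      refine add_le_add ?_ (sum_le_sum fun e he => ?_)
      · rw [mul_comm]; exact mul_le_mul_of_nonneg_left h1 (by simpa [del_empty] using hpos ∅)
      · by_cases hz : l e = 0
        · simp only [hz, zero_mul, mul_zero]
          have := hpos ∅; rw [del_empty] at this
          exact mul_nonneg this (add_nonneg (mul_nonneg (del_nonneg hl _ _) (hpos _))
            (mul_nonneg (del_nonneg hl _ _) (hpos _)))
        · have hi := mem_star.1 he
          have hval : ∀ z, z ≠ v → z ≠ H.other e v → H.del {z} l e = l e := by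
            intro z hz1 hz2
            have : ¬ H.inc e z := by rw [inc_iff_of_inc hi]; tauto
            simp only [inc, not_or] at this
            simp [del, this.1, this.2]
          have hN1 := hpos ∅; rw [del_empty] at hN1
          by_cases h3 : H.other e v = u
          · have hvw' : H.del {w} l e = l e := hval w (Ne.symm hvw) (by rw [h3]; exact Ne.symm huw)
            have hu : H.del {u} l e = 0 := del_of_inc (mem_singleton_self u) (h3 ▸ inc_other)
            rw [hvw', hu, h3, zero_mul, zero_add]
            have h6 : ({w} ∪ {u} : Finset V) = {u, w} := by ext; simp [or_comm]
            rw [h6]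
            have := mul_le_mul_of_nonneg_left (hle {u}) (mul_nonneg (hl e) (hpos {u, w}))
            linarith
          · by_cases h4 : H.other e v = w
            · have hvu' : H.del {u} l e = l e := hval u huv (by rw [h4]; exact huw)
              have hw : H.del {w} l e = 0 := del_of_inc (mem_singleton_self w) (h4 ▸ inc_other)
              rw [hvu', hw, h4, zero_mul, add_zero]
              have h6 : ({u} ∪ {w} : Finset V) = {u, w} := by ext; simp
              rw [h6]
              have := mul_le_mul_of_nonneg_left (hle {w}) (mul_nonneg (hl e) (hpos {u, w}))
              linarith
            · rw [hval u huv (Ne.symm h3), hval w (Ne.symm hvw) (Ne.symm h4)]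
              have := (ih N hN0 (hcard e he hz) u (H.other e v) w (Ne.symm h3) huw h4).1
              have h5 : ({u} ∪ {H.other e v} : Finset V) = {u, H.other e v} := by ext; simp
              have h6 : ({w} ∪ {H.other e v} : Finset V) = {w, H.other e v} := by ext; simp
              rw [h5, h6]
              have := mul_le_mul_of_nonneg_left this (hl e)
              linarith

/-- The probability that `u` and `w` are both free. -/
def K (H : Multi V E) (l : E → ℝ) (u w : V) : ℝ := H.Z (H.del {u, w} l) / H.Z l

/-- The probability that `v` is free. -/
def Fr (H : Multi V E) (l : E → ℝ) (v : V) : ℝ := H.Z (H.del {v} l) / H.Z l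

/-- The probability that the edge `e` is in the random matching. -/
def marg (H : Multi V E) (l : E → ℝ) (e : E) : ℝ := l e * H.K l (H.s e) (H.t e)

theorem K_comm (l : E → ℝ) (u w : V) : H.K l u w = H.K l w u := by
  unfold K; rw [pair_comm]

theorem K_nonneg {l : E → ℝ} (hl : ∀ e, 0 ≤ l e) (u w : V) : 0 ≤ H.K l u w :=
  div_nonneg (Z_pos (del_nonneg hl _)).le (Z_pos hl).le

theorem K_pos {l : E → ℝ} (hl : ∀ e, 0 ≤ l e) (u w : V) : 0 < H.K l u w :=
  div_pos (Z_pos (del_nonneg hl _)) (Z_pos hl)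

theorem K_le_one {l : E → ℝ} (hl : ∀ e, 0 ≤ l e) (u w : V) : H.K l u w ≤ 1 :=
  div_le_one_of_le₀ (Z_del_le hl _) (Z_pos hl).le

theorem marg_nonneg {l : E → ℝ} (hl : ∀ e, 0 ≤ l e) (e : E) : 0 ≤ H.marg l e :=
  mul_nonneg (hl e) (K_nonneg hl _ _)

theorem marg_le {l : E → ℝ} (hl : ∀ e, 0 ≤ l e) (e : E) : H.marg l e ≤ l e :=
  mul_le_of_le_one_right (hl e) (K_le_one hl _ _)

theorem K_inc {l : E → ℝ} {e : E} {v : V} (h : H.inc e v) :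
    H.K l (H.s e) (H.t e) = H.K l v (H.other e v) := by
  unfold K; rw [← pair_eq h]; rfl

/-- Approximate transitivity of the relation of being rarely free together. -/
theorem gallai {l : E → ℝ} (hl : ∀ e, 0 ≤ l e) {u v w : V} (huv : u ≠ v) (huw : u ≠ w)
    (hvw : v ≠ w) : H.K l u w * H.Fr l v ≤ H.K l u v + H.K l v w := by
  have h := ((gallai_aux (H := H) _ l hl le_rfl u v w huv huw hvw)).1
  have hz := Z_pos (H := H) hl
  rw [K_comm l v w]
  unfold K Fr
  rw [div_mul_div_comm, ← add_div, div_le_div_iff₀ (mul_pos hz hz) hz]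
  nlinarith

theorem Fr_add_sum {l : E → ℝ} (hl : ∀ e, 0 ≤ l e) (v : V) :
    H.Fr l v + ∑ e ∈ H.star v, H.marg l e = 1 := by
  have hz := Z_pos (H := H) hl
  have := Z_rec (H := H) l v
  unfold Fr marg K
  have h2 : ∀ e, l e * (H.Z (H.del {H.s e, H.t e} l) / H.Z l) =
      l e * H.Z (H.del {H.s e, H.t e} l) / H.Z l := fun e => by ring
  simp only [h2]
  rw [← sum_div, ← add_div, ← this, div_self hz.ne']

end Multi

namespace Multi
variable {V E : Type*} [Fintype V] [DecidableEq V] [Fintype E] [DecidableEq E] {H : Multi V E}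

/-- `e` joins `a` to a vertex outside `X`. -/
def exits (H : Multi V E) (X : Finset V) (a : V) : Finset E :=
  (H.star a).filter fun e => H.other e a ∉ X

/-- `a` is free or matched to a vertex outside `X`. -/
def loose (H : Multi V E) (X : Finset V) (M : Finset E) (a : V) : ℝ :=
  (if H.free M {a} then 1 else 0) + ∑ e ∈ H.exits X a, (if e ∈ M then 1 else 0)

theorem loose_nonneg (X : Finset V) (M : Finset E) (a : V) : 0 ≤ H.loose X M a := by
  unfold loose
  refine add_nonneg (by split_ifs <;> norm_num) (sum_nonneg fun e _ => by split_ifs <;> norm_num)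

theorem loose_add_sum (X : Finset V) {M : Finset E} (hM : H.IsM M) (a : V) :
    H.loose X M a + ∑ e ∈ (H.star a).filter (fun e => H.other e a ∈ X),
      (if e ∈ M then (1 : ℝ) else 0) = 1 := by
  refine Eq.trans ?_ (hM.free_add_sum a)
  unfold loose exits
  rw [add_assoc]
  congr 1
  rw [add_comm]
  exact sum_filter_add_sum_filter_not (H.star a) (fun e => H.other e a ∈ X)
    (fun e => if e ∈ M then (1 : ℝ) else 0)

theorem loose_zero_or_one (X : Finset V) {M : Finset E} (hM : H.IsM M) (a : V) :
    H.loose X M a = 0 ∨ H.loose X M a = 1 := by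
  have h := loose_add_sum X hM a
  by_cases h1 : ∃ e ∈ (H.star a).filter (fun e => H.other e a ∈ X), e ∈ M
  · left
    obtain ⟨e, he, heM⟩ := h1
    have := single_le_sum (f := fun e => if e ∈ M then (1 : ℝ) else 0)
      (fun e _ => by split_ifs <;> norm_num) he
    simp only [heM, if_true] at this
    have := loose_nonneg X M a (H := H)
    linarith
  · right
    push Not at h1
    rw [sum_eq_zero (fun e he => by rw [if_neg (h1 e he)])] at h
    linarith

theorem sum_wt_loose {l : E → ℝ} (hl : ∀ e, 0 ≤ l e) (X : Finset V) {a : V}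
    (B : Finset E → ℝ) (hB : ∀ N, 0 ≤ B N)
    (hins : ∀ f ∈ H.exits X a, ∀ N, B (insert f N) ≤ B N) :
    ∑ M : Finset E, H.wt l M * (H.loose X M a * B M) ≤
      (1 + ∑ f ∈ H.exits X a, l f) * ∑ N : Finset E, H.wt (H.del {a} l) N * B N := by
  have h1 : ∑ M : Finset E, H.wt l M * (H.loose X M a * B M) =
      ∑ N : Finset E, H.wt (H.del {a} l) N * B N +
      ∑ f ∈ H.exits X a, ∑ M : Finset E, (if f ∈ M then H.wt l M * B M else 0) := by
    rw [sum_comm, ← sum_add_distrib]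
    refine sum_congr rfl fun M _ => ?_
    rw [wt_del]; unfold loose
    rw [add_mul, sum_mul, mul_add, mul_sum]
    congr 1
    · split_ifs <;> ring
    · exact sum_congr rfl fun f _ => by split_ifs <;> ring
  rw [h1, add_mul, one_mul, sum_mul]
  refine add_le_add le_rfl (sum_le_sum fun f hf => ?_)
  rw [sum_wt_mem]
  refine mul_le_mul_of_nonneg_left (sum_le_sum fun N _ => ?_) (hl f)
  have hfa : H.inc f a := mem_star.1 (mem_filter.1 hf).1
  have h2 : H.wt (H.del {H.s f, H.t f} l) N ≤ H.wt (H.del {a} l) N := by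
    rw [← pair_eq hfa, ← del_del]
    exact wt_mono (del_nonneg (del_nonneg hl _) _) (del_le (del_nonneg hl _) _) N
  exact mul_le_mul h2 (hins f hf N) (hB _) (wt_nonneg (del_nonneg hl _) _)

theorem sum_wt_loose_loose {l : E → ℝ} (hl : ∀ e, 0 ≤ l e) (X : Finset V) {a b : V}
    (ha : a ∈ X) (hb : b ∈ X) (hab : a ≠ b) :
    ∑ M : Finset E, H.wt l M * (H.loose X M a * H.loose X M b) ≤
      (1 + ∑ f ∈ H.exits X a, l f) * ((1 + ∑ f ∈ H.exits X b, l f) * H.Z (H.del {a, b} l)) := by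
  refine (sum_wt_loose hl X (fun M => H.loose X M b) (fun N => loose_nonneg X N b) ?_).trans ?_
  · intro f hf N
    have hf := mem_filter.1 hf
    have hfa : H.inc f a := mem_star.1 hf.1
    unfold loose
    refine add_le_add ?_ (sum_le_sum fun g hg => ?_)
    · split_ifs with h1 h2
      · exact le_rfl
      · exact absurd (fun e he => h1 e (mem_insert_of_mem he)) h2
      · norm_num
      · exact le_rfl
    · have hg := mem_filter.1 hg
      have : g ≠ f := by
        rintro rfl
        exact hf.2 ((other_mem hfa (mem_star.1 hg.1) hab) ▸ hb)
      simp [this]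
  · refine mul_le_mul_of_nonneg_left ?_ (add_nonneg zero_le_one (sum_nonneg fun f _ => hl f))
    have h := sum_wt_loose (H := H) (del_nonneg (H := H) hl {a}) X (a := b) (fun _ => 1) (fun _ => zero_le_one)
      (fun _ _ _ => le_rfl)
    simp only [mul_one] at h
    refine h.trans ?_
    have h2 : ∑ N : Finset E, H.wt (H.del {b} (H.del {a} l)) N = H.Z (H.del {a, b} l) := by
      rw [del_del]; rfl
    rw [h2]
    refine mul_le_mul_of_nonneg_right ?_ (Z_pos (del_nonneg hl _)).le
    exact add_le_add le_rfl (sum_le_sum fun f _ => del_le hl _ f)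

/-- The edges with both ends in `X`. -/
def inside (H : Multi V E) (X : Finset V) : Finset E :=
  univ.filter fun e => H.s e ∈ X ∧ H.t e ∈ X

theorem sum_sum_star_inside (X : Finset V) (g : E → ℝ) :
    ∑ a ∈ X, ∑ e ∈ (H.star a).filter (fun e => H.other e a ∈ X), g e =
      2 * ∑ e ∈ H.inside X, g e := by
  have h1 : ∀ a ∈ X, ∑ e ∈ (H.star a).filter (fun e => H.other e a ∈ X), g e =
      ∑ e ∈ H.inside X, ((if H.s e = a then g e else 0) + (if H.t e = a then g e else 0)) := by
    intro a ha
    rw [sum_add_distrib, ← sum_filter, ← sum_filter, ← sum_union]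
    · refine sum_congr ?_ fun _ _ => rfl
      ext e
      rw [mem_filter, mem_star, mem_union, mem_filter, mem_filter, inside, mem_filter]
      simp only [mem_univ, true_and]
      unfold inc other
      constructor
      · rintro ⟨h1 | h1, h2⟩
        · simp only [h1, if_true] at h2; left; exact ⟨⟨h1 ▸ ha, h2⟩, h1⟩
        · have : H.s e ≠ a := fun h3 => H.ne e (h3.trans h1.symm)
          simp only [this, if_false] at h2
          right; exact ⟨⟨h2, h1 ▸ ha⟩, h1⟩
      · rintro (⟨h1, h2⟩ | ⟨h1, h2⟩)
        · simp [h2, h1.2]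
        · have : H.s e ≠ a := fun h3 => H.ne e (h3.trans h2.symm)
          simp [this, h2, h1.1]
    · rw [disjoint_left]
      intro e h1 h2
      exact H.ne e ((mem_filter.1 h1).2.trans (mem_filter.1 h2).2.symm)
  rw [sum_congr rfl h1, sum_comm, mul_sum]
  refine sum_congr rfl fun e he => ?_
  have he := (mem_filter.1 he).2
  rw [sum_add_distrib, sum_ite_eq, sum_ite_eq, if_pos he.1, if_pos he.2]; ring

theorem sum_wt_loose_eq {l : E → ℝ} (hl : ∀ e, 0 ≤ l e) (X : Finset V) (a : V) :
    ∑ M : Finset E, H.wt l M * H.loose X M a =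
      H.Z l * (1 - ∑ e ∈ (H.star a).filter (fun e => H.other e a ∈ X), H.marg l e) := by
  have h0 : ∀ M : Finset E, H.wt l M * H.loose X M a = H.wt l M -
      ∑ e ∈ (H.star a).filter (fun e => H.other e a ∈ X), (if e ∈ M then H.wt l M else 0) := by
    intro M
    by_cases hM : H.IsM M
    · have := loose_add_sum X hM a
      rw [eq_sub_of_add_eq this, mul_sub, mul_one, mul_sum]
      congr 1
      exact sum_congr rfl fun e _ => by split_ifs <;> ring
    · simp [wt, hM]
  simp only [h0]
  rw [sum_sub_distrib, sum_comm, mul_sub, mul_one, mul_sum]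
  congr 1
  refine sum_congr rfl fun e _ => ?_
  rw [sum_wt_mem_one]
  have := Z_pos (H := H) hl
  unfold marg K
  field_simp

/-- If the events in a family rarely happen in pairs, the expected number that happens is at most
about one. -/
theorem sum_wt_le_one_add {l : E → ℝ} (hl : ∀ e, 0 ≤ l e) (X : Finset V)
    (g : V → Finset E → ℝ) (hg : ∀ a ∈ X, ∀ M, H.IsM M → g a M = 0 ∨ g a M = 1) {κ : ℝ}
    (hκ : ∀ a ∈ X, ∀ b ∈ X, a ≠ b → ∑ M : Finset E, H.wt l M * (g a M * g b M) ≤ κ * H.Z l)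
    (hκ0 : 0 ≤ κ) :
    ∑ a ∈ X, ∑ M : Finset E, H.wt l M * g a M ≤ H.Z l * (1 + (X.card : ℝ) ^ 2 * κ) := by
  have hz := Z_pos (H := H) hl
  rw [sum_comm]
  have h2 : ∑ M : Finset E, ∑ a ∈ X, H.wt l M * g a M ≤
      ∑ M : Finset E, H.wt l M * (1 + ∑ a ∈ X, ∑ b ∈ X.erase a, g a M * g b M) := by
    refine sum_le_sum fun M _ => ?_
    rw [← mul_sum]
    by_cases hM : H.IsM M
    · refine mul_le_mul_of_nonneg_left ?_ (wt_nonneg hl M)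
      have h3 : ∀ a ∈ X, ∑ b ∈ X.erase a, g a M * g b M =
          g a M * (∑ b ∈ X, g b M - g a M) := by
        intro a ha
        rw [← mul_sum, ← add_sum_erase X _ ha]; ring
      rw [sum_congr rfl h3]
      set n := ∑ b ∈ X, g b M with hn
      have h4 : ∀ a ∈ X, g a M * (n - g a M) = g a M * (n - 1) := by
        intro a ha
        rcases hg a ha M hM with h | h <;> rw [h] <;> ring
      rw [sum_congr rfl h4, ← sum_mul, ← hn]
      nlinarith [sq_nonneg (n - 1)]
    · simp [wt, hM]
  refine h2.trans ?_
  simp only [mul_add, mul_one]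
  rw [sum_add_distrib]
  refine add_le_add le_rfl ?_
  simp only [mul_sum X, mul_sum (X.erase _)]
  rw [sum_comm]
  calc ∑ a ∈ X, ∑ M : Finset E, ∑ b ∈ X.erase a, H.wt l M * (g a M * g b M)
      ≤ ∑ a ∈ X, (X.card : ℝ) * (κ * H.Z l) := by
        refine sum_le_sum fun a ha => ?_
        rw [sum_comm]
        calc _ ≤ ∑ b ∈ X.erase a, κ * H.Z l := sum_le_sum fun b hb =>
              hκ a ha b (mem_of_mem_erase hb) (ne_of_mem_erase hb).symm
          _ ≤ _ := by
            rw [sum_const, nsmul_eq_mul]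
            refine mul_le_mul_of_nonneg_right ?_ (by positivity)
            exact_mod_cast card_le_card (erase_subset _ _)
    _ = _ := by rw [sum_const, nsmul_eq_mul]; ring

theorem card_sub_le {l : E → ℝ} (hl : ∀ e, 0 ≤ l e) (X : Finset V) {κ : ℝ}
    (hκ : ∀ a ∈ X, ∀ b ∈ X, a ≠ b →
      ∑ M : Finset E, H.wt l M * (H.loose X M a * H.loose X M b) ≤ κ * H.Z l) (hκ0 : 0 ≤ κ) :
    (X.card : ℝ) - 2 * ∑ e ∈ H.inside X, H.marg l e ≤ 1 + (X.card : ℝ) ^ 2 * κ := by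
  have h := sum_wt_le_one_add hl X (fun a M => H.loose X M a)
    (fun a _ M hM => loose_zero_or_one X hM a) hκ hκ0
  rw [sum_congr rfl (fun a _ => sum_wt_loose_eq hl X a), ← mul_sum, sum_sub_distrib,
      sum_sum_star_inside] at h
  simpa using le_of_mul_le_mul_left h (Z_pos hl)

theorem sum_wt_free_eq {l : E → ℝ} (hl : ∀ e, 0 ≤ l e) (X : Finset V) :
    ∑ M : Finset E, H.wt l M * (if H.free M X then 1 else 0) = H.Z (H.del X l) := by
  rw [Z_del]; exact sum_congr rfl fun M _ => by split_ifs <;> simp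

theorem sum_Fr_le {l : E → ℝ} (hl : ∀ e, 0 ≤ l e) (X : Finset V) {κ : ℝ}
    (hκ : ∀ a ∈ X, ∀ b ∈ X, a ≠ b → H.K l a b ≤ κ) (hκ0 : 0 ≤ κ) :
    ∑ a ∈ X, H.Fr l a ≤ 1 + (X.card : ℝ) ^ 2 * κ := by
  have hz := Z_pos (H := H) hl
  have h := sum_wt_le_one_add (H := H) hl X (fun a M => if H.free M {a} then 1 else 0)
    (fun a _ M hM => by split_ifs <;> simp) (κ := κ) ?_ hκ0
  · simp only [sum_wt_free_eq hl] at h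
    have h2 : ∑ a ∈ X, H.Z (H.del {a} l) = H.Z l * ∑ a ∈ X, H.Fr l a := by
      rw [mul_sum]; refine sum_congr rfl fun a _ => ?_
      unfold Fr; field_simp
    rw [h2] at h
    exact le_of_mul_le_mul_left h hz
  · intro a ha b hb hab
    have h1 : ∀ M : Finset E, (if H.free M {a} then (1 : ℝ) else 0) *
        (if H.free M {b} then 1 else 0) = if H.free M {a, b} then 1 else 0 := by
      intro M
      have : H.free M {a, b} ↔ H.free M {a} ∧ H.free M {b} := free_union (X := {a}) (Y := {b})
      rw [this]
      by_cases h3 : H.free M {a} <;> by_cases h4 : H.free M {b} <;> simp [h3, h4]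
    simp only [h1, sum_wt_free_eq hl]
    exact (div_le_iff₀ hz).1 (hκ a ha b hb hab)

/-- A bound for the size of a set of vertices that are rarely free in pairs. -/
def clsSize (δ : ℝ) : ℕ := ⌈2 / δ⌉₊ + 1

/-- A rapidly decreasing sequence of thresholds. -/
def scale (δ : ℝ) : ℕ → ℝ
  | 0 => δ / (4 * (clsSize δ : ℝ) ^ 2) * δ
  | i + 1 => δ ^ 4 * (scale δ i) ^ 2 / (40 * (clsSize δ : ℝ) ^ 2)

theorem clsSize_pos (δ : ℝ) : 0 < (clsSize δ : ℝ) := by unfold clsSize; positivity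

theorem two_lt_clsSize {δ : ℝ} (h : 0 < δ) : 2 < δ * clsSize δ := by
  have : 2 / δ ≤ ⌈2 / δ⌉₊ := Nat.le_ceil _
  have h2 : 2 / δ < clsSize δ := by unfold clsSize; push_cast; linarith
  rwa [div_lt_iff₀' h] at h2

theorem scale_pos {δ : ℝ} (h : 0 < δ) (i : ℕ) : 0 < scale δ i := by
  have := clsSize_pos δ
  induction i with
  | zero => unfold scale; positivity
  | succ i ih => unfold scale; positivity

theorem one_le_clsSize (δ : ℝ) : 1 ≤ (clsSize δ : ℝ) := by unfold clsSize; push_cast; linarith [Nat.cast_nonneg (α := ℝ) ⌈2 / δ⌉₊]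

theorem scale_zero_le {δ : ℝ} (h : 0 < δ) (h1 : δ ≤ 1) : scale δ 0 ≤ 1 / 4 := by
  have hn := one_le_clsSize δ
  unfold scale
  have h2 : δ / (4 * (clsSize δ : ℝ) ^ 2) ≤ 1 / 4 := by
    rw [div_le_div_iff₀ (by positivity) (by norm_num)]
    nlinarith
  nlinarith [div_nonneg h.le (by positivity : 0 ≤ 4 * (clsSize δ : ℝ) ^ 2)]

theorem scale_succ_le {δ : ℝ} (h : 0 < δ) (h1 : δ ≤ 1) (i : ℕ) :
    scale δ (i + 1) ≤ scale δ i ∧ scale δ i ≤ 1 := by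
  have hn := one_le_clsSize δ
  have key : ∀ i, scale δ i ≤ 1 → scale δ (i + 1) ≤ scale δ i := by
    intro i hi
    have hp := scale_pos h i
    have hd : δ ^ 4 ≤ 1 := pow_le_one₀ h.le h1
    conv_lhs => unfold scale
    rw [div_le_iff₀ (by positivity)]
    have h3 : scale δ i ^ 2 ≤ scale δ i := by nlinarith
    have h4 : δ ^ 4 * scale δ i ^ 2 ≤ scale δ i :=
      (mul_le_of_le_one_left (by positivity) hd).trans h3
    have h5 : 1 ≤ 40 * (clsSize δ : ℝ) ^ 2 := by nlinarith
    nlinarith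
  have hle : ∀ i, scale δ i ≤ 1 := by
    intro i
    induction i with
    | zero => have := scale_zero_le h h1; linarith
    | succ i ih => exact (key i ih).trans ih
  exact ⟨key i (hle i), hle i⟩

theorem scale_antitone {δ : ℝ} (h : 0 < δ) (h1 : δ ≤ 1) : Antitone (scale δ) :=
  antitone_nat_of_succ_le fun i => (scale_succ_le h h1 i).1

end Multi

namespace Multi
variable {V E : Type*} [Fintype V] [DecidableEq V] [Fintype E] [DecidableEq E] {H : Multi V E}

theorem exists_of_loose_ne_one {X : Finset V} {M : Finset E} (hM : H.IsM M) {a : V}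
    (h1 : H.loose X M a ≠ 1) : ∃ e ∈ M, H.inc e a ∧ H.other e a ∈ X := by
  by_contra h2
  push Not at h2
  have h := loose_add_sum X hM a
  rw [sum_eq_zero] at h
  · exact h1 (by linarith)
  · intro e he
    have he := mem_filter.1 he
    rw [if_neg]
    intro h3
    exact h2 e h3 (mem_star.1 he.1) he.2

theorem K_lower {δ : ℝ} (hδ : 0 < δ) (hδ1 : δ ≤ 1) {l : E → ℝ} (hl : ∀ e, 0 ≤ l e)
    (hFr : ∀ v, δ ≤ H.Fr l v)
    (hX : ∀ X : Finset V, ∑ e ∈ H.inside X, H.marg l e ≤ (1 - δ) * X.card / 3)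
    {u v : V} (huv : u ≠ v) : scale δ (clsSize δ) ≤ H.K l u v := by
  by_contra hlt
  push Not at hlt
  set n := clsSize δ with hn
  have hn0 := clsSize_pos δ
  have hn1 := one_le_clsSize δ
  have hn2 := two_lt_clsSize hδ
  rw [← hn] at hn0 hn1 hn2
  set X : ℕ → Finset V := fun i => univ.filter fun w => w = u ∨ H.K l u w ≤ scale δ i with hXdef
  have hanti := scale_antitone hδ hδ1
  have hmemX : ∀ i w, w ∈ X i ↔ w = u ∨ H.K l u w ≤ scale δ i := by simp [hXdef]
  have hXanti : ∀ i, X (i + 1) ⊆ X i := by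
    intro i w hw
    rw [hmemX] at hw ⊢
    exact hw.imp_right fun h => h.trans (hanti (Nat.le_succ i))
  have hpair : ∀ i, ∀ a ∈ X i, ∀ b ∈ X i, a ≠ b → H.K l a b ≤ 2 * scale δ i / δ := by
    intro i a ha b hb hab
    have hs := scale_pos hδ i
    rw [hmemX] at ha hb
    rw [le_div_iff₀ hδ]
    by_cases ha' : a = u
    · subst ha'
      have := hb.resolve_left (Ne.symm hab)
      have h0 := K_nonneg (H := H) hl a b
      nlinarith
    · by_cases hb' : b = u
      · subst hb'
        have := ha.resolve_left ha'
        rw [K_comm] at this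
        have h0 := K_nonneg (H := H) hl a b
        nlinarith
      · have h1 := gallai (H := H) hl (u := a) (v := u) (w := b) ha' hab (Ne.symm hb')
        have h2 := ha.resolve_left ha'
        have h3 := hb.resolve_left hb'
        rw [K_comm] at h2
        have h0 := K_nonneg (H := H) hl a b
        have := mul_le_mul_of_nonneg_left (hFr u) h0
        linarith
  have hsize : ∀ i, (X i).card < n := by
    intro i
    by_contra h
    push Not at h
    obtain ⟨Y, hY, hYc⟩ := exists_subset_card_eq h
    have hs := scale_pos hδ i
    have h1 := sum_Fr_le hl Y (fun a ha b hb hab => hpair i a (hY ha) b (hY hb) hab)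
      (by positivity)
    have h2 : (n : ℝ) * δ ≤ ∑ a ∈ Y, H.Fr l a := by
      calc (n : ℝ) * δ = ∑ a ∈ Y, δ := by rw [sum_const, hYc, nsmul_eq_mul]
        _ ≤ _ := sum_le_sum fun a _ => hFr a
    rw [hYc] at h1
    have h3 : (n : ℝ) ^ 2 * (2 * scale δ i / δ) ≤ δ / 2 := by
      have : scale δ i ≤ scale δ 0 := hanti (Nat.zero_le i)
      have h4 : scale δ 0 = δ / (4 * (n : ℝ) ^ 2) * δ := by rw [scale]
      calc (n : ℝ) ^ 2 * (2 * scale δ i / δ) ≤ (n : ℝ) ^ 2 * (2 * (δ / (4 * (n : ℝ) ^ 2) * δ) / δ) := by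
            rw [← h4]; gcongr
        _ = δ / 2 := by field_simp; ring
    nlinarith
  have huX : ∀ i, u ∈ X i := fun i => (hmemX i u).2 (Or.inl rfl)
  obtain ⟨i, hi, hXi⟩ : ∃ i, i < n ∧ X (i + 1) = X i := by
    by_contra h
    push Not at h
    have : ∀ j, j ≤ n → (X j).card + j ≤ (X 0).card := by
      intro j
      induction j with
      | zero => intro _; simp
      | succ j ih =>
        intro hj
        have := card_lt_card ((hXanti j).ssubset_of_ne (h j hj))
        have := ih (by omega)
        omega
    have h1 := this n le_rfl
    have h2 := hsize 0
    omega
  have hvX : v ∈ X i := (hmemX i v).2 (Or.inr (hlt.le.trans (hanti hi.le)))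
  set Y := X i with hY
  set S := scale δ i with hS
  set σ := scale δ (i + 1) with hσ
  have hS0 : 0 < S := scale_pos hδ i
  have hS1 : S ≤ 1 := (scale_succ_le hδ hδ1 i).2
  have hσ0 : 0 < σ := scale_pos hδ _
  have hσeq : σ = δ ^ 4 * S ^ 2 / (40 * (n : ℝ) ^ 2) := by rw [hσ, scale]
  have hin : ∀ a ∈ Y, ∀ b ∈ Y, a ≠ b → H.K l a b ≤ 2 * σ / δ := by
    intro a ha b hb hab
    rw [← hXi] at ha hb
    exact hpair (i + 1) a ha b hb hab
  have hσS : σ ≤ δ * S / 2 := by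
    rw [hσeq, div_le_div_iff₀ (by positivity) (by norm_num)]
    have h1 : δ ^ 4 * S ^ 2 ≤ δ * S := by
      have : δ ^ 3 * S ≤ 1 := mul_le_one₀ (pow_le_one₀ hδ.le hδ1) hS0.le hS1
      calc δ ^ 4 * S ^ 2 = (δ * S) * (δ ^ 3 * S) := by ring
        _ ≤ δ * S * 1 := by gcongr
        _ = _ := by ring
    have h2 : 1 ≤ (n : ℝ) ^ 2 := one_le_pow₀ hn1
    have h3 : 0 < δ * S := by positivity
    nlinarith
  have hout : ∀ a ∈ Y, ∀ b, b ∉ Y → δ * S / 2 ≤ H.K l a b := by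
    intro a ha b hb
    have hb' : b ≠ u ∧ S < H.K l u b := by
      rw [hY, hmemX, not_or, not_le] at hb; exact hb
    by_cases hau : a = u
    · subst hau; nlinarith [hb'.2]
    · have ha' : H.K l u a ≤ σ := by
        rw [← hXi, hmemX] at ha; exact ha.resolve_left hau
      have hab : a ≠ b := fun h => hb (h ▸ ha)
      have h1 := gallai (H := H) hl (u := u) (v := a) (w := b) (Ne.symm hau) (Ne.symm hb'.1) hab
      have h2 : S * δ ≤ H.K l u b * H.Fr l a :=
        mul_le_mul hb'.2.le (hFr a) hδ.le (K_nonneg hl _ _)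
      linarith
  have hexit : ∀ a ∈ Y, ∑ f ∈ H.exits Y a, l f ≤ 2 / (δ * S) := by
    intro a ha
    rw [le_div_iff₀ (by positivity), sum_mul]
    have h1 : ∀ f ∈ H.exits Y a, l f * (δ * S) ≤ 2 * H.marg l f := by
      intro f hf
      have hf := mem_filter.1 hf
      unfold marg
      rw [K_inc (mem_star.1 hf.1)]
      have := mul_le_mul_of_nonneg_left (hout a ha _ hf.2) (hl f)
      linarith
    refine (sum_le_sum h1).trans ?_
    rw [← mul_sum]
    have h2 : ∑ f ∈ H.exits Y a, H.marg l f ≤ ∑ f ∈ H.star a, H.marg l f :=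
      sum_le_sum_of_subset_of_nonneg (filter_subset _ _) fun f _ _ => marg_nonneg hl f
    have h3 := Fr_add_sum (H := H) hl a
    have h4 := hFr a
    linarith
  have hz := Z_pos (H := H) hl
  have hκ : ∀ a ∈ Y, ∀ b ∈ Y, a ≠ b →
      ∑ M : Finset E, H.wt l M * (H.loose Y M a * H.loose Y M b) ≤
        (18 * δ / (40 * (n : ℝ) ^ 2)) * H.Z l := by
    intro a ha b hb hab
    refine (sum_wt_loose_loose hl Y ha hb hab).trans ?_
    have hK : H.Z (H.del {a, b} l) ≤ 2 * σ / δ * H.Z l := (div_le_iff₀ hz).1 (hin a ha b hb hab)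
    have hδS : δ * S ≤ 1 := mul_le_one₀ hδ1 hS0.le hS1
    have h3 : 1 + 2 / (δ * S) ≤ 3 / (δ * S) := by
      rw [← sub_nonneg]
      have : 3 / (δ * S) - (1 + 2 / (δ * S)) = (1 - δ * S) / (δ * S) := by field_simp; ring
      rw [this]; exact div_nonneg (by linarith) (by positivity)
    have ha1 := hexit a ha
    have hb1 := hexit b hb
    calc _ ≤ (3 / (δ * S)) * ((3 / (δ * S)) * (2 * σ / δ * H.Z l)) := by
          have hzz := (Z_pos (H := H) (del_nonneg (H := H) hl {a, b})).le
          have hsb : 0 ≤ ∑ f ∈ H.exits Y b, l f := sum_nonneg fun f _ => hl f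
          have hsa : 0 ≤ ∑ f ∈ H.exits Y a, l f := sum_nonneg fun f _ => hl f
          refine mul_le_mul (by linarith) (mul_le_mul (by linarith) hK hzz (by positivity)) ?_
            (by positivity)
          exact mul_nonneg (by linarith) hzz
      _ = _ := by rw [hσeq]; field_simp; norm_num
  have hκ0 : 0 ≤ 18 * δ / (40 * (n : ℝ) ^ 2) := by positivity
  have hYn : ((Y.card : ℝ)) ≤ n := by exact_mod_cast (hsize i).le
  have hYc2 : 2 ≤ Y.card := by
    have : ({u, v} : Finset V) ⊆ Y := by
      intro w hw
      rcases mem_insert.1 hw with rfl | hw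
      · exact huX i
      · rw [mem_singleton.1 hw]; exact hvX
    have h2 := card_le_card this
    rwa [card_pair huv] at h2
  by_cases h3 : 3 ≤ Y.card
  · have h4 := card_sub_le hl Y hκ hκ0
    have h5 := hX Y
    have h6 : (Y.card : ℝ) ^ 2 * (18 * δ / (40 * (n : ℝ) ^ 2)) ≤ 18 * δ / 40 := by
      calc _ ≤ (n : ℝ) ^ 2 * (18 * δ / (40 * (n : ℝ) ^ 2)) := by gcongr
        _ = _ := by field_simp
    have h7 : (3 : ℝ) ≤ Y.card := by exact_mod_cast h3
    nlinarith
  · have hc : Y.card = 2 := by omega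
    have hYe : Y = {u, v} := by
      symm
      refine eq_of_subset_of_card_le ?_ (by rw [hc, card_pair huv])
      intro w hw
      rcases mem_insert.1 hw with rfl | hw
      · exact huX i
      · rw [mem_singleton.1 hw]; exact hvX
    have h1 := hκ u (huX i) v hvX huv
    have h2 : H.Z (H.del {u} l) ≤
        ∑ M : Finset E, H.wt l M * (H.loose Y M u * H.loose Y M v) := by
      rw [← sum_wt_free_eq hl]
      refine sum_le_sum fun M _ => ?_
      by_cases hM : H.IsM M
      · refine mul_le_mul_of_nonneg_left ?_ (wt_nonneg hl M)
        split_ifs with hf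
        · have hu1 : H.loose Y M u = 1 := by
            by_contra hne
            obtain ⟨e, he, hi, _⟩ := exists_of_loose_ne_one hM hne
            exact free_singleton.1 hf e he hi
          have hv1 : H.loose Y M v = 1 := by
            by_contra hne
            obtain ⟨e, he, hi, ho⟩ := exists_of_loose_ne_one hM hne
            have hou : H.other e v = u := by
              rw [hYe, mem_insert, mem_singleton] at ho
              exact ho.resolve_right (other_ne hi)
            exact free_singleton.1 hf e he (hou ▸ inc_other)
          rw [hu1, hv1]; norm_num
        · exact mul_nonneg (loose_nonneg _ _ _) (loose_nonneg _ _ _)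
      · simp [wt, hM]
    have h4 := hFr u
    unfold Fr at h4
    rw [le_div_iff₀ hz] at h4
    have h5 : δ * H.Z l ≤ 18 * δ / (40 * (n : ℝ) ^ 2) * H.Z l := h4.trans (h2.trans h1)
    have h6 := le_of_mul_le_mul_right h5 hz
    rw [le_div_iff₀ (by positivity)] at h6
    have : 1 ≤ (n : ℝ) ^ 2 := one_le_pow₀ hn1
    nlinarith

theorem one_add_mul_lt_rpow {x p r : ℝ} (hx : 0 ≤ x) (hr : 0 < r) (h : 0 < (r - 1) * (x / r - p)) :
    1 + p * (r - 1) < r ^ x := by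
  have h1 := Real.one_sub_inv_le_log_of_pos hr
  have h2 : p * (r - 1) + 1 ≤ Real.exp (p * (r - 1)) := Real.add_one_le_exp _
  rw [Real.rpow_def_of_pos hr]
  have h3 : p * (r - 1) < Real.log r * x := by
    have h4 : (1 - r⁻¹) * x ≤ Real.log r * x := mul_le_mul_of_nonneg_right h1 hx
    have h5 : (1 - r⁻¹) * x = (r - 1) * (x / r) := by field_simp
    nlinarith
  have := Real.exp_lt_exp.2 h3
  linarith

theorem Z_update (l : E → ℝ) (hl : ∀ e, 0 ≤ l e) (e : E) (r : ℝ) :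
    H.Z (Function.update l e (r * l e)) = H.Z l * (1 + H.marg l e * (r - 1)) := by
  have h1 : ∀ M, H.wt (Function.update l e (r * l e)) M =
      H.wt l M + (r - 1) * (if e ∈ M then H.wt l M else 0) := by
    intro M
    unfold wt
    by_cases hM : H.IsM M
    · simp only [hM, if_true]
      split_ifs with he
      · rw [prod_update_of_mem he, ← mul_prod_erase M l he, sdiff_singleton_eq_erase]; ring
      · rw [prod_update_of_notMem he]; ring
    · simp [hM]
  unfold Z
  simp only [h1]
  rw [sum_add_distrib, ← mul_sum, sum_wt_mem_one]
  have := Z_pos (H := H) hl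
  change H.Z l + _ = H.Z l * _
  unfold marg K
  field_simp

/-- A vector well inside the matching polytope is the vector of marginals of a monomer-dimer model
with comparable activities. -/
theorem exists_activity {δ : ℝ} (hδ : 0 < δ) (hδ1 : δ ≤ 1) (x : E → ℝ) (hx : ∀ e, 0 ≤ x e)
    (hv : ∀ v, ∑ e ∈ H.star v, x e ≤ 1 - δ)
    (hX : ∀ X : Finset V, ∑ e ∈ H.inside X, x e ≤ (1 - δ) * X.card / 3) :
    ∃ l : E → ℝ, (∀ e, 0 ≤ l e) ∧ (∀ e, l e ≤ 2 / scale δ (clsSize δ) * x e) ∧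
      ∀ e, H.marg l e = x e := by
  set c := scale δ (clsSize δ) with hc
  have hc0 : 0 < c := scale_pos hδ _
  set B : Set (E → ℝ) := Set.pi Set.univ fun e => Set.Icc 0 (2 / c * x e) with hB
  have hBc : IsCompact B := isCompact_univ_pi fun e => isCompact_Icc
  set f : (E → ℝ) → ℝ := fun l => (∏ e, l e ^ x e) / H.Z l with hf
  have hmemB : ∀ l, l ∈ B ↔ ∀ e, 0 ≤ l e ∧ l e ≤ 2 / c * x e := by
    intro l; simp only [hB, Set.mem_univ_pi, Set.mem_Icc]
  have hZc : Continuous fun l : E → ℝ => H.Z l := by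
    unfold Z
    refine continuous_finsetSum _ fun M _ => ?_
    unfold wt
    split_ifs
    · exact continuous_finsetProd _ fun e _ => continuous_apply e
    · exact continuous_const
  have hfc : ContinuousOn f B := by
    refine ContinuousOn.div ?_ hZc.continuousOn ?_
    · refine Continuous.continuousOn (continuous_finsetProd _ fun e _ => ?_)
      exact (continuous_apply e).rpow_const fun l => Or.inr (hx e)
    · intro l hl
      exact (Z_pos fun e => ((hmemB l).1 hl e).1).ne'
  have hl0 : (fun e => 2 / c * x e) ∈ B := by
    rw [hmemB]; intro e; exact ⟨mul_nonneg (by positivity) (hx e), le_rfl⟩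
  obtain ⟨l, hlB, hmax⟩ := hBc.exists_isMaxOn ⟨_, hl0⟩ hfc
  have hlB' := (hmemB l).1 hlB
  have hl : ∀ e, 0 ≤ l e := fun e => (hlB' e).1
  have hz := Z_pos (H := H) hl
  have hP : ∏ e, l e ^ x e ≠ 0 := by
    intro h0
    have h1 := hmax hl0
    simp only [hf, h0, zero_div, Set.mem_setOf_eq] at h1
    have h2 : 0 < (∏ e, (2 / c * x e) ^ x e) / H.Z (fun e => 2 / c * x e) := by
      refine div_pos (prod_pos fun e _ => ?_) (Z_pos fun e => mul_nonneg (by positivity) (hx e))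
      rcases (hx e).eq_or_lt with h3 | h3
      · rw [← h3]; simp
      · positivity
    linarith
  have hP0 : 0 < ∏ e, l e ^ x e :=
    lt_of_le_of_ne (prod_nonneg fun e _ => Real.rpow_nonneg (hl e) _) (Ne.symm hP)
  have key : ∀ e, ∀ r : ℝ, 0 < r → r * l e ≤ 2 / c * x e →
      ¬ 0 < (r - 1) * (x e / r - H.marg l e) := by
    intro e r hr hrl h
    have h1 := one_add_mul_lt_rpow (hx e) hr h
    set l' := Function.update l e (r * l e) with hl'
    have hl'0 : ∀ f, 0 ≤ l' f := by
      intro f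
      by_cases hfe : f = e
      · subst hfe; simp only [hl', Function.update_self]; exact mul_nonneg hr.le (hl f)
      · simp only [hl', Function.update_of_ne hfe]; exact hl f
    have hl'B : l' ∈ B := by
      rw [hmemB]; intro f
      refine ⟨hl'0 f, ?_⟩
      by_cases hfe : f = e
      · subst hfe; simpa only [hl', Function.update_self] using hrl
      · simp only [hl', Function.update_of_ne hfe]; exact (hlB' f).2
    have h2 := hmax hl'B
    simp only [hf, Set.mem_setOf_eq] at h2
    have h3 : ∏ f, l' f ^ x f = r ^ x e * ∏ f, l f ^ x f := by
      rw [← mul_prod_erase univ (fun f => l' f ^ x f) (mem_univ e),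
        ← mul_prod_erase univ (fun f => l f ^ x f) (mem_univ e)]
      rw [show l' e = r * l e by simp [hl'], Real.mul_rpow hr.le (hl e), mul_assoc]
      congr 2
      refine prod_congr rfl fun f hfe => ?_
      rw [hl', Function.update_of_ne (ne_of_mem_erase hfe)]
    have h4 : H.Z l' = H.Z l * (1 + H.marg l e * (r - 1)) := Z_update l hl e r
    have hz' := Z_pos (H := H) hl'0
    rw [div_le_div_iff₀ hz' hz, h3, h4] at h2
    have h5 : 0 < H.Z l * ∏ f, l f ^ x f := mul_pos hz hP0
    nlinarith
  have hle : ∀ e, H.marg l e ≤ x e := by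
    intro e
    by_contra h
    push Not at h
    have hp : 0 < H.marg l e := (hx e).trans_lt h
    have hlt : x e / H.marg l e < 1 := (div_lt_one hp).2 h
    have h0 : 0 ≤ x e / H.marg l e := div_nonneg (hx e) hp.le
    set r := (1 + x e / H.marg l e) / 2 with hr
    have hr0 : 0 < r := by linarith
    refine key e r hr0 ?_ ?_
    · have := (hlB' e).2
      have : r * l e ≤ 1 * l e := mul_le_mul_of_nonneg_right (by linarith) (hl e)
      linarith
    · have : x e / r < H.marg l e := by
        rw [div_lt_iff₀ hr0]
        have : x e = x e / H.marg l e * H.marg l e := by field_simp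
        nlinarith
      exact mul_pos_of_neg_of_neg (by linarith) (by linarith)
  have hFr : ∀ v, δ ≤ H.Fr l v := by
    intro v
    have h1 := Fr_add_sum (H := H) hl v
    have h2 : ∑ e ∈ H.star v, H.marg l e ≤ ∑ e ∈ H.star v, x e := sum_le_sum fun e _ => hle e
    have := hv v
    linarith
  have hK : ∀ e, c ≤ H.K l (H.s e) (H.t e) := fun e =>
    K_lower hδ hδ1 hl hFr (fun X => (sum_le_sum fun e _ => hle e).trans (hX X)) (H.ne e)
  refine ⟨l, hl, fun e => (hlB' e).2, fun e => le_antisymm (hle e) ?_⟩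
  by_contra h
  push Not at h
  have hxe : 0 < x e := (marg_nonneg hl e).trans_lt h
  have hle0 : 0 < l e := by
    refine lt_of_le_of_ne (hl e) fun h0 => hP ?_
    refine prod_eq_zero (mem_univ e) ?_
    rw [← h0, Real.zero_rpow hxe.ne']
  have hp : 0 < H.marg l e := mul_pos hle0 (K_pos hl _ _)
  have hcap : l e < 2 / c * x e := by
    refine lt_of_le_of_ne (hlB' e).2 fun h0 => ?_
    have : H.marg l e = 2 / c * x e * H.K l (H.s e) (H.t e) := by unfold marg; rw [h0]
    have h1 : 2 / c * x e * c ≤ H.marg l e := by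
      rw [this]; exact mul_le_mul_of_nonneg_left (hK e) (by positivity)
    have h2 : 2 / c * x e * c = 2 * x e := by field_simp
    linarith
  have h1 : 1 < x e / H.marg l e := (one_lt_div hp).2 h
  have h2 : 1 < 2 / c * x e / l e := (one_lt_div hle0).2 hcap
  set r := min ((1 + x e / H.marg l e) / 2) (2 / c * x e / l e) with hr
  have hr1 : 1 < r := lt_min (by linarith) h2
  have hr0 : 0 < r := by linarith
  refine key e r hr0 ?_ ?_
  · exact (le_div_iff₀ hle0).1 (min_le_right _ _)
  · refine mul_pos (by linarith) ?_
    rw [sub_pos, lt_div_iff₀ hr0]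
    have h3 : r ≤ (1 + x e / H.marg l e) / 2 := min_le_left _ _
    have : x e = x e / H.marg l e * H.marg l e := by field_simp
    nlinarith

end Multi

namespace Multi
variable {V E : Type*} [Fintype V] [DecidableEq V] [Fintype E] [DecidableEq E] {H : Multi V E}

/-- The computation tree of depth `k` for the probability that `v` is free. -/
def Fk (H : Multi V E) : ℕ → (E → ℝ) → V → ℝ
  | 0, _, _ => 1
  | k + 1, l, v => 1 / (1 + ∑ e ∈ H.star v, l e * Fk H k (H.del {v} l) (H.other e v))

/-- The vertices at distance at most `k` from `v`. -/
def ball (H : Multi V E) : ℕ → V → Finset V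
  | 0, v => {v}
  | k + 1, v => insert v ((H.star v).biUnion fun e => ball H k (H.other e v))

theorem Fk_zero (l : E → ℝ) (v : V) : H.Fk 0 l v = 1 := rfl

theorem Fk_succ (k : ℕ) (l : E → ℝ) (v : V) : H.Fk (k + 1) l v =
    1 / (1 + ∑ e ∈ H.star v, l e * H.Fk k (H.del {v} l) (H.other e v)) := rfl

theorem Fr_rec {l : E → ℝ} (hl : ∀ e, 0 ≤ l e) (v : V) : H.Fr l v =
    1 / (1 + ∑ e ∈ H.star v, l e * H.Fr (H.del {v} l) (H.other e v)) := by
  have hz := Z_pos (H := H) hl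
  have hz' := Z_pos (H := H) (del_nonneg (H := H) hl {v})
  have h := Z_rec' (H := H) l v
  unfold Fr
  rw [div_eq_div_iff hz.ne', mul_add, mul_one, one_mul, mul_sum]
  · conv_rhs => rw [h]
    congr 1
    refine sum_congr rfl fun e _ => ?_
    field_simp
  · have : 0 ≤ ∑ e ∈ H.star v, l e * (H.Z (H.del {H.other e v} (H.del {v} l)) / H.Z (H.del {v} l)) :=
      sum_nonneg fun e _ => mul_nonneg (hl e)
        (div_nonneg (Z_pos (del_nonneg (del_nonneg hl _) _)).le hz'.le)
    positivity

theorem Fr_pos {l : E → ℝ} (hl : ∀ e, 0 ≤ l e) (v : V) : 0 < H.Fr l v :=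
  div_pos (Z_pos (del_nonneg hl _)) (Z_pos hl)

theorem Fr_le_one {l : E → ℝ} (hl : ∀ e, 0 ≤ l e) (v : V) : H.Fr l v ≤ 1 :=
  div_le_one_of_le₀ (Z_del_le hl _) (Z_pos hl).le

theorem Fk_pos_le {l : E → ℝ} (hl : ∀ e, 0 ≤ l e) (k : ℕ) (v : V) :
    0 < H.Fk k l v ∧ H.Fk k l v ≤ 1 := by
  induction k generalizing l v with
  | zero => simp [Fk_zero]
  | succ k ih =>
    rw [Fk_succ]
    have h : 0 ≤ ∑ e ∈ H.star v, l e * H.Fk k (H.del {v} l) (H.other e v) :=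
      sum_nonneg fun e _ => mul_nonneg (hl e) (ih (del_nonneg hl _) _).1.le
    exact ⟨by positivity, div_le_one_of_le₀ (by linarith) (by linarith)⟩

theorem K_eq_Fr_mul {l : E → ℝ} (hl : ∀ e, 0 ≤ l e) (u w : V) :
    H.K l u w = H.Fr l u * H.Fr (H.del {u} l) w := by
  unfold K Fr
  rw [del_del]
  have := (Z_pos (H := H) (del_nonneg (H := H) hl {u})).ne'
  rw [show ({u} ∪ {w} : Finset V) = {u, w} from rfl]
  field_simp

/-- The total activity at every vertex is at most `Λ`. -/
def bdd (H : Multi V E) (Λ : ℝ) (l : E → ℝ) : Prop := ∀ v, ∑ e ∈ H.star v, l e ≤ Λ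

theorem bdd.del {Λ : ℝ} {l : E → ℝ} (hl : ∀ e, 0 ≤ l e) (h : H.bdd Λ l) (X : Finset V) :
    H.bdd Λ (H.del X l) := fun v => (sum_le_sum fun e _ => del_le hl X e).trans (h v)

theorem one_add_le_exp_mul {Λ τ ξ y y' : ℝ} (hΛ : 0 ≤ Λ) (hτ : 0 ≤ τ) (hξ : 0 ≤ ξ) (hy : 0 ≤ y)
    (hy' : 0 ≤ y') (hyΛ : y' ≤ Λ) (h : y' ≤ Real.exp τ * (y + ξ)) :
    1 + y' ≤ Real.exp (Λ / (1 + Λ) * τ + ξ) * (1 + y) := by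
  set ρ := Λ / (1 + Λ) with hρ
  have h1 : Real.exp (-(ρ * τ)) ≤ (1 + y' * Real.exp (-τ)) / (1 + y') := by
    have hc := convexOn_exp.2 (Set.mem_univ 0) (Set.mem_univ (-τ))
      (show 0 ≤ 1 / (1 + y') by positivity) (show 0 ≤ y' / (1 + y') by positivity)
      (by field_simp)
    simp only [smul_eq_mul, mul_zero, zero_add, Real.exp_zero, mul_one] at hc
    have h2 : y' / (1 + y') ≤ ρ := by
      rw [hρ, div_le_div_iff₀ (by linarith) (by linarith)]; nlinarith
    calc Real.exp (-(ρ * τ)) ≤ Real.exp (y' / (1 + y') * -τ) := by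
          apply Real.exp_le_exp.2
          have := mul_le_mul_of_nonneg_right h2 hτ
          linarith
      _ ≤ _ := hc
      _ = _ := by field_simp
  rw [le_div_iff₀ (by linarith)] at h1
  have h3 : y' * Real.exp (-τ) ≤ y + ξ := by
    rw [Real.exp_neg, mul_inv_le_iff₀ (Real.exp_pos τ)]; linarith
  have h4 : 1 + (y + ξ) ≤ Real.exp ξ * (1 + y) := by
    have := Real.add_one_le_exp ξ
    nlinarith
  have h5 : Real.exp (-(ρ * τ)) * (1 + y') ≤ Real.exp ξ * (1 + y) := by linarith
  rw [Real.exp_add, mul_assoc]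
  rw [Real.exp_neg, inv_mul_le_iff₀ (Real.exp_pos _)] at h5
  exact h5

/-- `A` and `B` agree up to a factor `exp τ`. -/
def near (τ A B : ℝ) : Prop := A ≤ Real.exp τ * B ∧ B ≤ Real.exp τ * A

theorem near.symm {τ A B : ℝ} (h : near τ A B) : near τ B A := ⟨h.2, h.1⟩

theorem near.mono {τ τ' A B : ℝ} (h : near τ A B) (hτ : τ ≤ τ') (hA : 0 ≤ A) (hB : 0 ≤ B) :
    near τ' A B :=
  ⟨h.1.trans (by gcongr), h.2.trans (by gcongr)⟩

theorem near.trans {τ τ' A B C : ℝ} (h : near τ A B) (h' : near τ' B C) : near (τ + τ') A C := by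
  constructor
  · calc A ≤ Real.exp τ * B := h.1
      _ ≤ Real.exp τ * (Real.exp τ' * C) := by gcongr; exact h'.1
      _ = _ := by rw [Real.exp_add]; ring
  · calc C ≤ Real.exp τ' * B := h'.2
      _ ≤ Real.exp τ' * (Real.exp τ * A) := by gcongr; exact h.2
      _ = _ := by rw [Real.exp_add]; ring

theorem near.mul {τ τ' A B A' B' : ℝ} (h : near τ A B) (h' : near τ' A' B') (hA : 0 ≤ A)
    (hB : 0 ≤ B) (hA' : 0 ≤ A') (hB' : 0 ≤ B') : near (τ + τ') (A * A') (B * B') := by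
  rw [near, Real.exp_add]
  exact ⟨(mul_le_mul h.1 h'.1 hA' (by positivity)).trans (le_of_eq (by ring)),
    (mul_le_mul h.2 h'.2 hB' (by positivity)).trans (le_of_eq (by ring))⟩

theorem near_inv {τ A B : ℝ} (hA : 0 < A) (hB : 0 < B) (h : near τ A B) :
    near τ (1 / A) (1 / B) := by
  constructor
  · rw [mul_one_div, div_le_div_iff₀ hA hB]; linarith [h.2]
  · rw [mul_one_div, div_le_div_iff₀ hB hA]; linarith [h.1]

theorem Fk_near {Λ : ℝ} (hΛ : 0 ≤ Λ) (k : ℕ) : ∀ (l : E → ℝ), (∀ e, 0 ≤ l e) → H.bdd Λ l →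
    ∀ v, near ((Λ / (1 + Λ)) ^ k * Λ) (H.Fk k l v) (H.Fr l v) := by
  induction k with
  | zero =>
    intro l hl hb v
    rw [Fk_zero, pow_zero, one_mul]
    refine ⟨?_, ?_⟩
    · rw [Fr_rec hl]
      have h0 : 0 ≤ ∑ e ∈ H.star v, l e * H.Fr (H.del {v} l) (H.other e v) :=
        sum_nonneg fun e _ => mul_nonneg (hl e) (Fr_pos (del_nonneg hl _) _).le
      have h1 : ∑ e ∈ H.star v, l e * H.Fr (H.del {v} l) (H.other e v) ≤ Λ :=
        (sum_le_sum fun e _ => mul_le_of_le_one_right (hl e)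
          (Fr_le_one (del_nonneg hl _) _)).trans (hb v)
      rw [mul_one_div, le_div_iff₀ (by linarith)]
      linarith [Real.add_one_le_exp Λ]
    · rw [mul_one]; exact (Fr_le_one hl v).trans (Real.one_le_exp hΛ)
  | succ k ih =>
    intro l hl hb v
    have hd := del_nonneg (H := H) hl {v}
    have hih := fun e => ih _ hd (hb.del hl {v}) (H.other e v)
    set τ := (Λ / (1 + Λ)) ^ k * Λ with hτ
    have hτ0 : 0 ≤ τ := by positivity
    rw [Fk_succ, Fr_rec hl]
    set y := ∑ e ∈ H.star v, l e * H.Fk k (H.del {v} l) (H.other e v) with hy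
    set y' := ∑ e ∈ H.star v, l e * H.Fr (H.del {v} l) (H.other e v) with hy'
    have hy0 : 0 ≤ y := sum_nonneg fun e _ => mul_nonneg (hl e) (Fk_pos_le hd k _).1.le
    have hy'0 : 0 ≤ y' := sum_nonneg fun e _ => mul_nonneg (hl e) (Fr_pos hd _).le
    have hyΛ : y ≤ Λ := (sum_le_sum fun e _ => mul_le_of_le_one_right (hl e)
      (Fk_pos_le hd k _).2).trans (hb v)
    have hy'Λ : y' ≤ Λ := (sum_le_sum fun e _ => mul_le_of_le_one_right (hl e)
      (Fr_le_one hd _)).trans (hb v)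
    have h1 : y ≤ Real.exp τ * (y' + 0) := by
      rw [add_zero, hy, hy', mul_sum]
      refine sum_le_sum fun e _ => ?_
      have := mul_le_mul_of_nonneg_left (hih e).1 (hl e)
      linarith
    have h2 : y' ≤ Real.exp τ * (y + 0) := by
      rw [add_zero, hy, hy', mul_sum]
      refine sum_le_sum fun e _ => ?_
      have := mul_le_mul_of_nonneg_left (hih e).2 (hl e)
      linarith
    have h3 := one_add_le_exp_mul hΛ hτ0 le_rfl hy'0 hy0 hyΛ h1
    have h4 := one_add_le_exp_mul hΛ hτ0 le_rfl hy0 hy'0 hy'Λ h2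
    rw [show (Λ / (1 + Λ)) ^ (k + 1) * Λ = Λ / (1 + Λ) * τ + 0 by rw [hτ]; ring]
    exact near_inv (by linarith) (by linarith) ⟨h3, h4⟩

theorem self_mem_ball (k : ℕ) (v : V) : v ∈ H.ball k v := by
  cases k <;> simp [ball]

theorem ball_other_subset {k : ℕ} {v : V} {e : E} (he : H.inc e v) :
    H.ball k (H.other e v) ⊆ H.ball (k + 1) v := by
  intro w hw
  rw [ball]
  exact mem_insert_of_mem (mem_biUnion.2 ⟨e, mem_star.2 he, hw⟩)

theorem ball_subset_succ (k : ℕ) (v : V) : H.ball k v ⊆ H.ball (k + 1) v := by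
  induction k generalizing v with
  | zero => intro w hw; rw [ball, mem_singleton] at hw; subst hw; exact self_mem_ball _ _
  | succ k ih =>
    intro w hw
    rw [ball, mem_insert, mem_biUnion] at hw
    rcases hw with rfl | ⟨e, he, hw⟩
    · exact self_mem_ball _ _
    · exact ball_other_subset (mem_star.1 he) (ih _ hw)

theorem ball_mono {j k : ℕ} (h : j ≤ k) (v : V) : H.ball j v ⊆ H.ball k v := by
  induction h with
  | refl => exact Subset.rfl
  | step _ ih => exact ih.trans (ball_subset_succ _ _)

theorem ball_trans {i j : ℕ} {u v w : V} (hu : u ∈ H.ball i v) (hw : w ∈ H.ball j u) :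
    w ∈ H.ball (i + j) v := by
  induction i generalizing v with
  | zero => rw [ball, mem_singleton] at hu; subst hu; simpa using hw
  | succ i ih =>
    rw [ball, mem_insert, mem_biUnion] at hu
    rcases hu with rfl | ⟨e, he, hu⟩
    · exact ball_mono (by omega) _ hw
    · rw [show i + 1 + j = i + j + 1 by omega]
      exact ball_other_subset (mem_star.1 he) (ih hu)

theorem other_mem_ball {e : E} {u : V} (he : H.inc e u) : H.other e u ∈ H.ball 1 u :=
  ball_other_subset he (self_mem_ball 0 _)

theorem other_other {e : E} {v : V} (h : H.inc e v) : H.other e (H.other e v) = v :=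
  other_mem inc_other h (other_ne h)

theorem ball_symm {k : ℕ} {u v : V} (h : u ∈ H.ball k v) : v ∈ H.ball k u := by
  induction k generalizing v with
  | zero => rw [ball, mem_singleton] at h; subst h; exact self_mem_ball _ _
  | succ k ih =>
    rw [ball, mem_insert, mem_biUnion] at h
    rcases h with rfl | ⟨e, he, h⟩
    · exact self_mem_ball _ _
    · have h1 := ih h
      have h2 := other_mem_ball (H := H) (e := e) (u := H.other e v) inc_other
      rw [other_other (mem_star.1 he)] at h2
      exact ball_trans h1 h2

theorem card_ball_le {D : ℕ} (hD : ∀ v, (H.star v).card ≤ D) (k : ℕ) (v : V) :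
    (H.ball k v).card ≤ (D + 1) ^ k := by
  induction k generalizing v with
  | zero => simp [ball]
  | succ k ih =>
    rw [ball]
    calc _ ≤ ((H.star v).biUnion fun e => H.ball k (H.other e v)).card + 1 := card_insert_le _ _
      _ ≤ (H.star v).card * (D + 1) ^ k + 1 := by
        gcongr; exact card_biUnion_le_card_mul _ _ _ fun e _ => ih _
      _ ≤ D * (D + 1) ^ k + (D + 1) ^ k := by
        gcongr
        · exact hD v
        · exact Nat.one_le_pow _ _ (by omega)
      _ = _ := by ring

/-- The edges that meet the ball of radius `k` around `v`. -/
def eball (H : Multi V E) (k : ℕ) (v : V) : Finset E := (H.ball k v).biUnion H.star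

theorem mem_eball {k : ℕ} {v : V} {e : E} : e ∈ H.eball k v ↔ ∃ u ∈ H.ball k v, H.inc e u := by
  simp [eball, mem_star]

theorem Fk_congr (k : ℕ) : ∀ {l l' : E → ℝ} {v : V}, (∀ e ∈ H.eball k v, l e = l' e) →
    H.Fk k l v = H.Fk k l' v := by
  induction k with
  | zero => intros; rfl
  | succ k ih =>
    intro l l' v h
    rw [Fk_succ, Fk_succ]
    congr 2
    refine sum_congr rfl fun e he => ?_
    rw [h e (mem_eball.2 ⟨v, self_mem_ball _ _, mem_star.1 he⟩)]
    congr 1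
    refine ih fun f hf => ?_
    obtain ⟨u, hu, hfu⟩ := mem_eball.1 hf
    have := h f (mem_eball.2 ⟨u, ball_other_subset (mem_star.1 he) hu, hfu⟩)
    simp only [del, this]

theorem Fk_perturb {Λ ξ : ℝ} (hΛ : 0 ≤ Λ) (hξ : 0 ≤ ξ) {l l' : E → ℝ} (hl : ∀ e, 0 ≤ l e)
    (hl' : ∀ e, 0 ≤ l' e) (hb : H.bdd Λ l) (hb' : H.bdd Λ l') (k : ℕ) (v₀ : V)
    (hLLN : ∀ v ∈ H.ball k v₀, ∀ X ⊆ H.ball k v₀, X.card ≤ k → ∀ j < k,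
      |∑ e ∈ H.star v, (H.del X l' e - H.del X l e) *
        H.Fk j (H.del (X ∪ {v}) l) (H.other e v)| ≤ ξ) (j : ℕ) :
    ∀ i, i + j ≤ k → ∀ v ∈ H.ball i v₀, ∀ X ⊆ H.ball i v₀, X.card ≤ i →
      near (ξ * (1 + Λ)) (H.Fk j (H.del X l') v) (H.Fk j (H.del X l) v) := by
  have hτ0 : 0 ≤ ξ * (1 + Λ) := by positivity
  induction j with
  | zero =>
    intro i _ v _ X _ _
    rw [Fk_zero, Fk_zero, near, mul_one, and_self]
    exact Real.one_le_exp hτ0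
  | succ j ih =>
    intro i hij v hv X hX hXc
    have hvk := ball_mono (show i ≤ k by omega) v₀ hv
    have hXk := hX.trans (ball_mono (show i ≤ k by omega) v₀)
    have hL := hLLN v hvk X hXk (by omega) j (by omega)
    have hd := del_nonneg (H := H) hl X
    have hd' := del_nonneg (H := H) hl' X
    have hdd := del_nonneg (H := H) hl (X ∪ {v})
    have hdd' := del_nonneg (H := H) hl' (X ∪ {v})
    have hbX := hb.del hl X
    have hbX' := hb'.del hl' X
    have hih : ∀ e ∈ H.star v, near (ξ * (1 + Λ)) (H.Fk j (H.del (X ∪ {v}) l') (H.other e v))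
        (H.Fk j (H.del (X ∪ {v}) l) (H.other e v)) := by
      intro e he
      refine ih (i + 1) (by omega) _ (ball_trans hv (other_mem_ball (mem_star.1 he))) _ ?_ ?_
      · refine union_subset (hX.trans (ball_subset_succ _ _)) ?_
        rw [singleton_subset_iff]; exact ball_subset_succ _ _ hv
      · exact (card_union_le _ _).trans (by simpa using hXc)
    rw [Fk_succ, Fk_succ, del_del, del_del]
    set τ := ξ * (1 + Λ) with hτ
    set φ := fun e => H.Fk j (H.del (X ∪ {v}) l) (H.other e v) with hφ
    set φ' := fun e => H.Fk j (H.del (X ∪ {v}) l') (H.other e v) with hφ'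
    have hφ0 : ∀ e, 0 ≤ φ e := fun e => (Fk_pos_le hdd _ _).1.le
    have hφ'0 : ∀ e, 0 ≤ φ' e := fun e => (Fk_pos_le hdd' _ _).1.le
    set y := ∑ e ∈ H.star v, H.del X l e * φ e with hy
    set y' := ∑ e ∈ H.star v, H.del X l' e * φ' e with hy'
    set m := ∑ e ∈ H.star v, H.del X l' e * φ e with hm
    have hmy : |m - y| ≤ ξ := by
      have : m - y = ∑ e ∈ H.star v, (H.del X l' e - H.del X l e) * φ e := by
        rw [hm, hy, ← sum_sub_distrib]; exact sum_congr rfl fun e _ => by ring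
      rw [this]; exact hL
    have hm1 : m ≤ Real.exp τ * y' := by
      rw [hm, hy', mul_sum]
      refine sum_le_sum fun e he => ?_
      have := mul_le_mul_of_nonneg_left (hih e he).2 (hd' e)
      simp only [hφ, hφ']; linarith
    have hm2 : y' ≤ Real.exp τ * m := by
      rw [hm, hy', mul_sum]
      refine sum_le_sum fun e he => ?_
      have := mul_le_mul_of_nonneg_left (hih e he).1 (hd' e)
      simp only [hφ, hφ']; linarith
    have hy0 : 0 ≤ y := sum_nonneg fun e _ => mul_nonneg (hd e) (hφ0 e)
    have hy'0 : 0 ≤ y' := sum_nonneg fun e _ => mul_nonneg (hd' e) (hφ'0 e)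
    have hyΛ : y ≤ Λ := (sum_le_sum fun e _ => mul_le_of_le_one_right (hd e)
      (Fk_pos_le hdd j _).2).trans (hbX v)
    have hy'Λ : y' ≤ Λ := (sum_le_sum fun e _ => mul_le_of_le_one_right (hd' e)
      (Fk_pos_le hdd' j _).2).trans (hbX' v)
    have he1 : 1 ≤ Real.exp τ := Real.one_le_exp hτ0
    have hab := abs_le.1 hmy
    have h1 : y' ≤ Real.exp τ * (y + ξ) := hm2.trans (by gcongr; linarith)
    have h2 : y ≤ Real.exp τ * (y' + ξ) := by nlinarith
    have h3 := one_add_le_exp_mul hΛ hτ0 hξ hy0 hy'0 hy'Λ h1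
    have h4 := one_add_le_exp_mul hΛ hτ0 hξ hy'0 hy0 hyΛ h2
    have h5 : Λ / (1 + Λ) * τ + ξ = τ := by rw [hτ]; field_simp; ring
    rw [h5] at h3 h4
    exact near_inv (by linarith) (by linarith) ⟨h3, h4⟩

/-- The multigraph in which each edge is doubled. -/
def dbl (H : Multi V E) : Multi V (E × Bool) := ⟨fun x => H.s x.1, fun x => H.t x.1, fun x => H.ne x.1⟩

/-- The total activity of the two copies of an edge. -/
def tot (l : E × Bool → ℝ) (e : E) : ℝ := l (e, false) + l (e, true)

theorem dbl_sum_star (g : E × Bool → ℝ) (v : V) :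
    ∑ x ∈ H.dbl.star v, g x = ∑ e ∈ H.star v, (g (e, false) + g (e, true)) := by
  have : H.dbl.star v = H.star v ×ˢ univ := by
    ext ⟨e, b⟩; simp [mem_star, inc, dbl]
  rw [this, sum_product]
  exact sum_congr rfl fun e _ => by simp [add_comm]

theorem tot_del (X : Finset V) (l : E × Bool → ℝ) : tot (H.dbl.del X l) = H.del X (tot l) := by
  funext e
  by_cases h : H.s e ∈ X ∨ H.t e ∈ X
  · have h1 : ∀ b, H.dbl.del X l (e, b) = 0 := fun b => if_pos h
    have h2 : H.del X (tot l) e = 0 := if_pos h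
    rw [tot, h1, h1, h2, add_zero]
  · have h1 : ∀ b, H.dbl.del X l (e, b) = l (e, b) := fun b => if_neg h
    have h2 : H.del X (tot l) e = tot l e := if_neg h
    rw [tot, h1, h1, h2, tot]

theorem dbl_Fk (k : ℕ) : ∀ (l : E × Bool → ℝ) (v : V), H.dbl.Fk k l v = H.Fk k (tot l) v := by
  induction k with
  | zero => intros; rfl
  | succ k ih =>
    intro l v
    rw [Fk_succ, Fk_succ, dbl_sum_star]
    congr 2
    refine sum_congr rfl fun e _ => ?_
    rw [ih, ih, tot_del, tot]
    change _ * H.Fk k _ (H.other e v) + _ * H.Fk k _ (H.other e v) = _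
    ring

theorem dbl_bdd {Λ : ℝ} {l : E × Bool → ℝ} : H.dbl.bdd Λ l ↔ H.bdd Λ (tot l) := by
  simp only [bdd, dbl_sum_star]; rfl

theorem exists_bdd (l : E → ℝ) (hl : ∀ e, 0 ≤ l e) : H.bdd (∑ e, l e) l := fun v =>
  sum_le_sum_of_subset_of_nonneg (subset_univ _) fun e _ _ => hl e

theorem eq_of_near {A B Λ ρ : ℝ} (hρ0 : 0 ≤ ρ) (hρ : ρ < 1) (h : ∀ k : ℕ, near (ρ ^ k * Λ) A B) :
    A = B := by
  have ht : Filter.Tendsto (fun k : ℕ => Real.exp (ρ ^ k * Λ)) Filter.atTop (nhds 1) := by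
    have := ((tendsto_pow_atTop_nhds_zero_of_lt_one hρ0 hρ).mul_const Λ).rexp
    simpa using this
  refine le_antisymm ?_ ?_
  · have := ge_of_tendsto' (ht.mul_const B) fun k => (h k).1
    simpa using this
  · have := ge_of_tendsto' (ht.mul_const A) fun k => (h k).2
    simpa using this

theorem dbl_Fr {l : E × Bool → ℝ} (hl : ∀ x, 0 ≤ l x) (v : V) :
    H.dbl.Fr l v = H.Fr (tot l) v := by
  have ht : ∀ e, 0 ≤ tot l e := fun e => add_nonneg (hl _) (hl _)
  set Λ := ∑ e, tot l e with hΛ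
  have hΛ0 : 0 ≤ Λ := sum_nonneg fun e _ => ht e
  have hb : H.bdd Λ (tot l) := exists_bdd _ ht
  have hb' : H.dbl.bdd Λ l := dbl_bdd.2 hb
  refine eq_of_near (ρ := Λ / (1 + Λ)) (Λ := 2 * Λ) (by positivity)
    ((div_lt_one (by linarith)).2 (by linarith)) fun k => ?_
  have h1 := (Fk_near hΛ0 k l hl hb' v).symm
  have h2 := Fk_near hΛ0 k (tot l) ht hb v
  rw [dbl_Fk] at h1
  have := h1.trans h2
  rwa [← mul_add, ← two_mul] at this

theorem dbl_K {l : E × Bool → ℝ} (hl : ∀ x, 0 ≤ l x) (u w : V) :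
    H.dbl.K l u w = H.K (tot l) u w := by
  have ht : ∀ e, 0 ≤ tot l e := fun e => add_nonneg (hl _) (hl _)
  rw [K_eq_Fr_mul hl, K_eq_Fr_mul ht, dbl_Fr hl, dbl_Fr (del_nonneg hl _), tot_del]

end Multi

/-- Expectation for a weight function on a finite set. -/
def fex {Ω : Type*} [Fintype Ω] (P : Ω → ℝ) (f : Ω → ℝ) : ℝ := ∑ ω, P ω * f ω

/-- Probability of an event. -/
def fpr {Ω : Type*} [Fintype Ω] (P : Ω → ℝ) (Q : Ω → Prop) : ℝ := fex P fun ω => if Q ω then 1 else 0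

/-- A probability distribution on a finite set. -/
def IsProb {Ω : Type*} [Fintype Ω] (P : Ω → ℝ) : Prop := (∀ ω, 0 ≤ P ω) ∧ ∑ ω, P ω = 1

/-- The product of finite distributions. -/
def prodP {Γ A : Type*} [Fintype Γ] (P : Γ → A → ℝ) (ω : Γ → A) : ℝ := ∏ γ, P γ (ω γ)

section basic
variable {Ω : Type*} [Fintype Ω] {P : Ω → ℝ}

theorem fex_mono (hP : ∀ ω, 0 ≤ P ω) {f g : Ω → ℝ} (h : ∀ ω, P ω ≠ 0 → f ω ≤ g ω) :
    fex P f ≤ fex P g := by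
  refine sum_le_sum fun ω _ => ?_
  by_cases h0 : P ω = 0
  · simp [h0]
  · exact mul_le_mul_of_nonneg_left (h ω h0) (hP ω)

theorem fex_congr {f g : Ω → ℝ} (h : ∀ ω, P ω ≠ 0 → f ω = g ω) : fex P f = fex P g := by
  refine sum_congr rfl fun ω _ => ?_
  by_cases h0 : P ω = 0
  · simp [h0]
  · rw [h ω h0]

theorem fex_const (hP : IsProb P) (c : ℝ) : fex P (fun _ => c) = c := by
  rw [fex, ← sum_mul, hP.2, one_mul]

theorem fex_add (f g : Ω → ℝ) : fex P (fun ω => f ω + g ω) = fex P f + fex P g := by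
  simp only [fex, mul_add, sum_add_distrib]

theorem fex_sub (f g : Ω → ℝ) : fex P (fun ω => f ω - g ω) = fex P f - fex P g := by
  simp only [fex, mul_sub, sum_sub_distrib]

theorem fex_const_mul (c : ℝ) (f : Ω → ℝ) : fex P (fun ω => c * f ω) = c * fex P f := by
  simp only [fex, mul_sum]; exact sum_congr rfl fun ω _ => by ring

theorem fex_sum {ι : Type*} (s : Finset ι) (f : ι → Ω → ℝ) :
    fex P (fun ω => ∑ i ∈ s, f i ω) = ∑ i ∈ s, fex P (f i) := by
  simp only [fex, mul_sum]; rw [sum_comm]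

theorem fpr_nonneg (hP : ∀ ω, 0 ≤ P ω) (Q : Ω → Prop) : 0 ≤ fpr P Q :=
  sum_nonneg fun ω _ => mul_nonneg (hP ω) (by dsimp only; split_ifs <;> norm_num)

theorem fpr_mono (hP : ∀ ω, 0 ≤ P ω) {Q R : Ω → Prop} (h : ∀ ω, P ω ≠ 0 → Q ω → R ω) :
    fpr P Q ≤ fpr P R := by
  refine fex_mono hP fun ω h0 => ?_
  by_cases hQ : Q ω
  · simp [hQ, h ω h0 hQ]
  · simp only [hQ, if_false]; split_ifs <;> norm_num

theorem fpr_or_le (hP : ∀ ω, 0 ≤ P ω) (Q R : Ω → Prop) :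
    fpr P (fun ω => Q ω ∨ R ω) ≤ fpr P Q + fpr P R := by
  rw [fpr, fpr, fpr, ← fex_add]
  refine fex_mono hP fun ω _ => ?_
  by_cases h1 : Q ω <;> by_cases h2 : R ω <;> simp [h1, h2]

theorem fpr_exists_le (hP : ∀ ω, 0 ≤ P ω) {ι : Type*} (s : Finset ι) (Q : ι → Ω → Prop) :
    fpr P (fun ω => ∃ i ∈ s, Q i ω) ≤ ∑ i ∈ s, fpr P (Q i) := by
  simp only [fpr]
  rw [← fex_sum]
  refine fex_mono hP fun ω _ => ?_
  have h0 : ∀ i ∈ s, (0 : ℝ) ≤ if Q i ω then 1 else 0 := fun i _ => by split_ifs <;> norm_num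
  split_ifs with h
  · obtain ⟨i, hi, hQ⟩ := h
    have := single_le_sum h0 hi
    simpa [hQ] using this
  · exact sum_nonneg h0

theorem fpr_exists_le_mul (hP : ∀ ω, 0 ≤ P ω) {ι : Type*} (s : Finset ι) (Q : ι → Ω → Prop)
    {N q : ℝ} (hN : (s.card : ℝ) ≤ N) (hq : ∀ i ∈ s, fpr P (Q i) ≤ q) (hq0 : 0 ≤ q) :
    fpr P (fun ω => ∃ i ∈ s, Q i ω) ≤ N * q := by
  refine (fpr_exists_le hP s Q).trans ((sum_le_sum hq).trans ?_)
  rw [sum_const, nsmul_eq_mul]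
  exact mul_le_mul_of_nonneg_right hN hq0

theorem fpr_true (hP : IsProb P) : fpr P (fun _ => True) = 1 := by
  simp [fpr, fex_const hP]

theorem fpr_add_not (Q R : Ω → Prop) :
    fpr P (fun ω => Q ω ∧ R ω) + fpr P (fun ω => Q ω ∧ ¬ R ω) = fpr P Q := by
  rw [fpr, fpr, fpr, ← fex_add]
  congr 1; funext ω
  by_cases h1 : Q ω <;> by_cases h2 : R ω <;> simp [h1, h2]

end basic

/-- The lopsided Lovász local lemma. -/
theorem lovasz_local {Ω ι : Type*} [Fintype Ω] [Fintype ι] {P : Ω → ℝ} (hP : IsProb P)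
    (B : ι → Ω → Prop) (nb : ι → Finset ι) {p d : ℝ} (hp : 0 ≤ p)
    (hd : ∀ i, ((nb i).card : ℝ) ≤ d) (hpd : 4 * p * d ≤ 1) (hp4 : 4 * p ≤ 1)
    (hB : ∀ i, ∀ S : Finset ι, (∀ j ∈ S, j ∉ nb i) →
      fpr P (fun ω => B i ω ∧ ∀ j ∈ S, ¬ B j ω) ≤ p * fpr P (fun ω => ∀ j ∈ S, ¬ B j ω)) :
    ∃ ω, P ω ≠ 0 ∧ ∀ i, ¬ B i ω := by
  have hP0 := hP.1
  set G : Finset ι → Ω → Prop := fun S ω => ∀ j ∈ S, ¬ B j ω with hG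
  have claim : ∀ n : ℕ, ∀ S : Finset ι, S.card ≤ n → ∀ i,
      fpr P (fun ω => B i ω ∧ G S ω) ≤ 2 * p * fpr P (G S) := by
    intro n
    induction n with
    | zero =>
      intro S hS i
      have hS : S = ∅ := card_eq_zero.1 (Nat.le_zero.1 hS)
      have h1 := hB i S (by simp [hS])
      have h2 := mul_nonneg hp (fpr_nonneg hP0 (G S))
      calc _ ≤ p * fpr P (G S) := h1
        _ ≤ _ := by linarith
    | succ n ih =>
      intro S hS i
      set S1 := S.filter fun j => j ∈ nb i with hS1
      set S2 := S.filter fun j => j ∉ nb i with hS2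
      have h2 : fpr P (fun ω => B i ω ∧ G S2 ω) ≤ p * fpr P (G S2) :=
        hB i S2 fun j hj => (mem_filter.1 hj).2
      have h1 : fpr P (fun ω => B i ω ∧ G S ω) ≤ fpr P (fun ω => B i ω ∧ G S2 ω) :=
        fpr_mono hP0 fun ω _ h => ⟨h.1, fun j hj => h.2 j (mem_filter.1 hj).1⟩
      by_cases he : S1 = ∅
      · have hSS : S2 = S := by
          rw [hS2, filter_eq_self]
          intro j hj hjn
          have : j ∈ S1 := mem_filter.2 ⟨hj, hjn⟩
          simp [he] at this
        rw [hSS] at h2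
        have h3 := mul_nonneg hp (fpr_nonneg hP0 (G S))
        linarith
      · have hc : S2.card ≤ n := by
          have h3 := card_filter_add_card_filter_not (s := S) (fun j => j ∈ nb i)
          have h4 : 0 < S1.card := card_pos.2 (nonempty_iff_ne_empty.2 he)
          rw [← hS1, ← hS2] at h3
          omega
        have h5 : fpr P (fun ω => G S2 ω ∧ ¬ G S ω) ≤ 1 / 2 * fpr P (G S2) := by
          calc fpr P (fun ω => G S2 ω ∧ ¬ G S ω)
              ≤ fpr P (fun ω => ∃ j ∈ S1, B j ω ∧ G S2 ω) := by
                refine fpr_mono hP0 fun ω _ h => ?_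
                have h6 := h.2
                simp only [hG] at h6
                push Not at h6
                obtain ⟨j, hj, hjB⟩ := h6
                refine ⟨j, mem_filter.2 ⟨hj, ?_⟩, hjB, h.1⟩
                by_contra hjn
                exact h.1 j (mem_filter.2 ⟨hj, hjn⟩) hjB
            _ ≤ d * (2 * p * fpr P (G S2)) := by
                refine fpr_exists_le_mul hP0 S1 _ ?_ (fun j _ => ih S2 hc j) ?_
                · refine le_trans ?_ (hd i)
                  exact_mod_cast card_le_card fun j hj => (mem_filter.1 hj).2
                · exact mul_nonneg (by linarith) (fpr_nonneg hP0 _)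
            _ ≤ _ := by
                have := fpr_nonneg hP0 (G S2)
                nlinarith
        have h6 := fpr_add_not (P := P) (G S2) (G S)
        have h7 : fpr P (fun ω => G S2 ω ∧ G S ω) ≤ fpr P (G S) :=
          fpr_mono hP0 fun ω _ h => h.2
        nlinarith
  have hpos : ∀ S : Finset ι, 0 < fpr P (G S) := by
    intro S
    induction S using Finset.induction_on with
    | empty =>
      have : fpr P (G ∅) = 1 := by
        rw [← fpr_true hP]; congr 1; funext ω; simp [hG]
      rw [this]; exact one_pos
    | insert i S _ ih =>
      have h1 := claim S.card S le_rfl i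
      have h2 := fpr_add_not (P := P) (G S) (B i)
      have h3 : fpr P (fun ω => G S ω ∧ B i ω) = fpr P (fun ω => B i ω ∧ G S ω) := by
        congr 1; funext ω; exact propext and_comm
      have h4 : fpr P (fun ω => G S ω ∧ ¬ B i ω) ≤ fpr P (G (insert i S)) := by
        refine fpr_mono hP0 fun ω _ h j hj => ?_
        rcases mem_insert.1 hj with rfl | hj
        · exact h.2
        · exact h.1 j hj
      nlinarith
  by_contra hcon
  push Not at hcon
  have h1 : fpr P (G univ) = 0 := by
    rw [fpr, fex]
    refine sum_eq_zero fun ω _ => ?_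
    by_cases h0 : P ω = 0
    · simp [h0]
    · obtain ⟨i, hi⟩ := hcon ω h0
      have : ¬ G univ ω := fun h => h i (mem_univ i) hi
      simp [this]
  exact (hpos univ).ne' h1

section prod
variable {Γ A : Type*} [Fintype Γ] [DecidableEq Γ] [Fintype A] {P : Γ → A → ℝ}

theorem fex_prod (g : Γ → A → ℝ) :
    fex (prodP P) (fun ω => ∏ γ, g γ (ω γ)) = ∏ γ, fex (P γ) (g γ) := by
  simp only [fex, prodP]
  rw [prod_univ_sum]
  simp [← prod_mul_distrib]

theorem isProb_prodP (hP : ∀ γ, IsProb (P γ)) : IsProb (prodP P) := by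
  refine ⟨fun ω => prod_nonneg fun γ _ => (hP γ).1 _, ?_⟩
  have := fex_prod (P := P) fun _ _ => 1
  simpa [fex, (hP _).2] using this

theorem fex_update (hP : ∀ γ, IsProb (P γ)) (γ : Γ) (f : (Γ → A) → ℝ) :
    fex (prodP P) f = fex (prodP P) fun ω => fex (P γ) fun x => f (Function.update ω γ x) := by
  have h1 : ∀ (ω : Γ → A) (x : A), prodP P ω * P γ x =
      prodP P (Function.update ω γ x) * P γ (ω γ) := by
    intro ω x
    unfold prodP
    rw [← mul_prod_erase univ _ (mem_univ γ), ← mul_prod_erase univ (fun i => P i (Function.update ω γ x i)) (mem_univ γ)]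
    rw [Function.update_self]
    have : ∏ i ∈ univ.erase γ, P i (Function.update ω γ x i) = ∏ i ∈ univ.erase γ, P i (ω i) :=
      prod_congr rfl fun i hi => by rw [Function.update_of_ne (ne_of_mem_erase hi)]
    rw [this]; ring
  have h2 : fex (prodP P) (fun ω => fex (P γ) fun x => f (Function.update ω γ x)) =
      ∑ y : (Γ → A) × A, prodP P (Function.update y.1 γ y.2) * P γ (y.1 γ) *
        f (Function.update y.1 γ y.2) := by
    rw [Fintype.sum_prod_type]
    simp only [fex, mul_sum]
    refine sum_congr rfl fun ω _ => sum_congr rfl fun x _ => ?_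
    rw [← mul_assoc, h1]
  have h3 : fex (prodP P) f = ∑ y : (Γ → A) × A, prodP P y.1 * P γ y.2 * f y.1 := by
    rw [Fintype.sum_prod_type]
    refine sum_congr rfl fun ω _ => ?_
    simp only
    rw [← sum_mul, ← mul_sum, (hP γ).2, mul_one]
  rw [h2, h3]
  let σ : (Γ → A) × A ≃ (Γ → A) × A :=
    ⟨fun y => (Function.update y.1 γ y.2, y.1 γ), fun y => (Function.update y.1 γ y.2, y.1 γ),
      fun y => by simp, fun y => by simp⟩
  exact (Equiv.sum_comp σ fun y => prodP P y.1 * P γ y.2 * f y.1).symm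

theorem exp_quadratic {x : ℝ} (h : |x| ≤ 1) : Real.exp x ≤ 1 + x + x ^ 2 := by
  have := Real.abs_exp_sub_one_sub_id_le h
  linarith [(abs_le.1 this).2]

theorem mgf_single {P : A → ℝ} (hP : IsProb P) (N : A → Prop) {p c t : ℝ} (hc : 0 ≤ c)
    (hp : fpr P (fun x => ¬ N x) ≤ p) (htc : |t| * c ≤ 1) (y : A → ℝ)
    (hy : ∀ a b, |y a - y b| ≤ c) (hN : ∀ a b, N a → N b → y a = y b) :
    fex P (fun a => Real.exp (t * y a)) ≤ Real.exp (t * fex P y + t ^ 2 * c ^ 2 * p) := by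
  obtain ⟨a₀, ha₀⟩ : ∃ a₀, ∀ a, N a → y a = y a₀ := by
    by_cases h : ∃ a, N a
    · obtain ⟨a, ha⟩ := h; exact ⟨a, fun b hb => hN b a hb ha⟩
    · have : Nonempty A := by
        by_contra hne
        rw [not_nonempty_iff] at hne
        have := hP.2
        simp at this
      exact ⟨this.some, fun a ha => absurd ⟨a, ha⟩ h⟩
  set z : A → ℝ := fun a => y a - y a₀ with hz
  have h1 : ∀ a, Real.exp (t * z a) ≤ 1 + t * z a + t ^ 2 * c ^ 2 * (if ¬ N a then 1 else 0) := by
    intro a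
    by_cases ha : N a
    · simp [hz, ha₀ a ha, ha]
    · have hza : |z a| ≤ c := hy a a₀
      have : |t * z a| ≤ 1 := by
        rw [abs_mul]; exact (mul_le_mul_of_nonneg_left hza (abs_nonneg t)).trans htc
      refine (exp_quadratic this).trans ?_
      simp only [ha, not_false_iff, if_true, mul_one]
      have h3 : z a ^ 2 ≤ c ^ 2 := sq_le_sq' (by linarith [(abs_le.1 hza).1]) (abs_le.1 hza).2
      have := mul_le_mul_of_nonneg_left h3 (sq_nonneg t)
      rw [mul_pow]; linarith
  have h2 : fex P (fun a => Real.exp (t * z a)) ≤ 1 + t * fex P z + t ^ 2 * c ^ 2 * p := by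
    refine (fex_mono hP.1 fun a _ => h1 a).trans ?_
    rw [fex_add, fex_add, fex_const hP, fex_const_mul, fex_const_mul]
    have : fex P (fun a => if ¬ N a then (1 : ℝ) else 0) ≤ p := by
      unfold fpr at hp; convert hp
    have := mul_le_mul_of_nonneg_left this (show 0 ≤ t ^ 2 * c ^ 2 by positivity)
    linarith
  have h3 : fex P z = fex P y - y a₀ := by rw [hz, fex_sub, fex_const hP]
  have h4 : fex P (fun a => Real.exp (t * y a)) =
      Real.exp (t * y a₀) * fex P (fun a => Real.exp (t * z a)) := by
    rw [← fex_const_mul]; congr 1; funext a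
    rw [← Real.exp_add]; congr 1; simp only [hz]; ring
  rw [h4]
  calc _ ≤ Real.exp (t * y a₀) * Real.exp (t * fex P z + t ^ 2 * c ^ 2 * p) := by
        gcongr
        refine h2.trans ?_
        have := Real.add_one_le_exp (t * fex P z + t ^ 2 * c ^ 2 * p)
        linarith
    _ = _ := by rw [← Real.exp_add, h3]; congr 1; ring

/-- A bounded-difference inequality that takes into account how rarely each coordinate matters. -/
theorem mgf_prod (hP : ∀ γ, IsProb (P γ)) (N : Γ → A → Prop) (p : Γ → ℝ) {c t : ℝ} (hc : 0 ≤ c)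
    (hp : ∀ γ, fpr (P γ) (fun x => ¬ N γ x) ≤ p γ) (htc : |t| * c ≤ 1) (s : Finset Γ) :
    ∀ f : (Γ → A) → ℝ, (∀ ω ω', (∀ γ ∈ s, ω γ = ω' γ) → f ω = f ω') →
      (∀ γ ω x y, |f (Function.update ω γ x) - f (Function.update ω γ y)| ≤ c) →
      (∀ γ ω x y, N γ x → N γ y → f (Function.update ω γ x) = f (Function.update ω γ y)) →
      fex (prodP P) (fun ω => Real.exp (t * f ω)) ≤
        Real.exp (t * fex (prodP P) f + t ^ 2 * c ^ 2 * ∑ γ ∈ s, p γ) := by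
  have hPP := isProb_prodP hP
  induction s using Finset.induction_on with
  | empty =>
    intro f hf _ _
    have : Nonempty (Γ → A) := by
      by_contra hne
      rw [not_nonempty_iff] at hne
      have := hPP.2
      simp at this
    have h1 : f = fun _ => f this.some := by funext ω; exact hf _ _ (by simp)
    rw [h1, fex_const hPP, fex_const hPP]; simp
  | insert γ s hγ ih =>
    intro f hf hd hN
    set g : (Γ → A) → ℝ := fun ω => fex (P γ) fun x => f (Function.update ω γ x) with hg
    have h1 : ∀ ω, fex (P γ) (fun x => Real.exp (t * f (Function.update ω γ x))) ≤
        Real.exp (t ^ 2 * c ^ 2 * p γ) * Real.exp (t * g ω) := by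
      intro ω
      refine (mgf_single (hP γ) (N γ) hc (hp γ) htc (fun x => f (Function.update ω γ x))
        (fun a b => hd γ ω a b) (fun a b => hN γ ω a b)).trans (le_of_eq ?_)
      rw [← Real.exp_add, add_comm]
    have h2 := ih g ?_ ?_ ?_
    · rw [fex_update hP γ]
      calc _ ≤ fex (prodP P) (fun ω => Real.exp (t ^ 2 * c ^ 2 * p γ) * Real.exp (t * g ω)) :=
            fex_mono hPP.1 fun ω _ => h1 ω
        _ ≤ Real.exp (t ^ 2 * c ^ 2 * p γ) *
            Real.exp (t * fex (prodP P) g + t ^ 2 * c ^ 2 * ∑ γ ∈ s, p γ) := by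
            rw [fex_const_mul]; gcongr
        _ = _ := by
            rw [← Real.exp_add, sum_insert hγ, fex_update hP γ f]; congr 1; ring
    · intro ω ω' h
      simp only [hg]
      congr 1; funext x
      refine hf _ _ fun γ' hγ' => ?_
      by_cases he : γ' = γ
      · subst he; simp
      · rw [Function.update_of_ne he, Function.update_of_ne he]
        exact h γ' ((mem_insert.1 hγ').resolve_left he)
    · intro γ' ω x y
      by_cases he : γ' = γ
      · subst he; simp [hg, hc]
      · simp only [hg]
        rw [← fex_sub]
        have h3 : ∀ z, |f (Function.update (Function.update ω γ' x) γ z) -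
            f (Function.update (Function.update ω γ' y) γ z)| ≤ c := by
          intro z
          rw [Function.update_comm he, Function.update_comm he]; exact hd _ _ _ _
        rw [abs_le]
        constructor
        · rw [← fex_const (hP γ) (-c)]
          exact fex_mono (hP γ).1 fun z _ => (abs_le.1 (h3 z)).1
        · calc _ ≤ fex (P γ) (fun _ => c) := fex_mono (hP γ).1 fun z _ => (abs_le.1 (h3 z)).2
            _ = c := fex_const (hP γ) c
    · intro γ' ω x y hx hy
      by_cases he : γ' = γ
      · subst he; simp [hg]
      · simp only [hg]
        congr 1; funext z
        rw [Function.update_comm he, Function.update_comm he]; exact hN _ _ _ _ hx hy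

theorem fpr_le_exp {Ω : Type*} [Fintype Ω] {P : Ω → ℝ} (hP : ∀ ω, 0 ≤ P ω) (X : Ω → ℝ)
    (a : ℝ) : fpr P (fun ω => a ≤ X ω) ≤ Real.exp (-a) * fex P (fun ω => Real.exp (X ω)) := by
  rw [fpr, ← fex_const_mul]
  refine fex_mono hP fun ω _ => ?_
  rw [← Real.exp_add]
  split_ifs with h
  · exact Real.one_le_exp (by linarith)
  · positivity

theorem concentration (hP : ∀ γ, IsProb (P γ)) (N : Γ → A → Prop) (p : Γ → ℝ) {c t q ξ : ℝ}
    (hc : 0 ≤ c) (hp : ∀ γ, fpr (P γ) (fun x => ¬ N γ x) ≤ p γ) (ht : 0 ≤ t) (htc : t * c ≤ 1)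
    (hq : ∑ γ, p γ ≤ q) (f : (Γ → A) → ℝ)
    (hd : ∀ γ ω x y, |f (Function.update ω γ x) - f (Function.update ω γ y)| ≤ c)
    (hN : ∀ γ ω x y, N γ x → N γ y → f (Function.update ω γ x) = f (Function.update ω γ y)) :
    fpr (prodP P) (fun ω => ξ ≤ |f ω - fex (prodP P) f|) ≤
      2 * Real.exp (-(t * ξ) + t ^ 2 * c ^ 2 * q) := by
  have hPP := isProb_prodP hP
  have side : ∀ t' : ℝ, |t'| = t →
      fpr (prodP P) (fun ω => t * ξ ≤ t' * (f ω - fex (prodP P) f)) ≤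
        Real.exp (-(t * ξ) + t ^ 2 * c ^ 2 * q) := by
    intro t' ht'
    have h1 := mgf_prod hP N p hc hp (by rw [ht']; exact htc) univ f
      (fun ω ω' h => by rw [show ω = ω' from funext fun γ => h γ (mem_univ γ)]) hd hN (t := t')
    refine (fpr_le_exp hPP.1 _ _).trans ?_
    rw [Real.exp_add]
    refine mul_le_mul_of_nonneg_left ?_ (Real.exp_pos _).le
    have h2 : ∀ ω, Real.exp (t' * (f ω - fex (prodP P) f)) =
        Real.exp (-(t' * fex (prodP P) f)) * Real.exp (t' * f ω) := by
      intro ω; rw [← Real.exp_add]; congr 1; ring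
    simp only [h2]
    rw [fex_const_mul]
    calc _ ≤ Real.exp (-(t' * fex (prodP P) f)) *
          Real.exp (t' * fex (prodP P) f + t' ^ 2 * c ^ 2 * ∑ γ, p γ) := by gcongr
      _ = Real.exp (t ^ 2 * c ^ 2 * ∑ γ, p γ) := by
          rw [← Real.exp_add, ← sq_abs t', ht']; congr 1; ring
      _ ≤ _ := by gcongr
  calc _ ≤ fpr (prodP P) (fun ω => t * ξ ≤ t * (f ω - fex (prodP P) f) ∨
        t * ξ ≤ -t * (f ω - fex (prodP P) f)) := by
        refine fpr_mono hPP.1 fun ω _ h => ?_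
        rcases le_abs.1 h with h | h
        · left; exact mul_le_mul_of_nonneg_left h ht
        · right
          have := mul_le_mul_of_nonneg_left h ht
          linarith
    _ ≤ _ := by
        refine (fpr_or_le hPP.1 _ _).trans ?_
        have h1 := side t (abs_of_nonneg ht)
        have h2 := side (-t) (by rw [abs_neg, abs_of_nonneg ht])
        linarith

end prod

namespace Multi
variable {V E : Type*} [Fintype V] [DecidableEq V] [Fintype E] [DecidableEq E] {H : Multi V E}

/-- The monomer-dimer distribution on sets of edges. -/
def hc (H : Multi V E) (l : E → ℝ) (M : Finset E) : ℝ := H.wt l M / H.Z l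

theorem isProb_hc {l : E → ℝ} (hl : ∀ e, 0 ≤ l e) : IsProb (H.hc l) := by
  have hz := Z_pos (H := H) hl
  refine ⟨fun M => div_nonneg (wt_nonneg hl M) hz.le, ?_⟩
  unfold hc
  rw [← sum_div]; exact div_self hz.ne'

theorem fex_hc (l : E → ℝ) (g : Finset E → ℝ) :
    fex (H.hc l) g = (∑ M : Finset E, H.wt l M * g M) / H.Z l := by
  unfold fex hc; rw [sum_div]; exact sum_congr rfl fun M _ => by ring

theorem sum_wt_subset_le (T : Finset E) : ∀ {l : E → ℝ}, (∀ e, 0 ≤ l e) →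
    ∑ M : Finset E, H.wt l M * (if T ⊆ M then 1 else 0) ≤ (∏ e ∈ T, l e) * H.Z l := by
  induction T using Finset.induction_on with
  | empty => intro l _; simp [Z]
  | insert e T he ih =>
    intro l hl
    have h1 : ∑ M : Finset E, H.wt l M * (if insert e T ⊆ M then (1 : ℝ) else 0) =
        ∑ M : Finset E, (if e ∈ M then H.wt l M * (if T ⊆ M then 1 else 0) else 0) := by
      refine sum_congr rfl fun M _ => ?_
      by_cases h1 : e ∈ M <;> by_cases h2 : T ⊆ M <;> simp [insert_subset_iff, h1, h2]
    rw [h1, sum_wt_mem, prod_insert he, mul_assoc]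
    refine mul_le_mul_of_nonneg_left ?_ (hl e)
    have hd := del_nonneg (H := H) hl {H.s e, H.t e}
    calc _ ≤ ∑ N : Finset E, H.wt (H.del {H.s e, H.t e} l) N * (if T ⊆ N then 1 else 0) := by
          refine sum_le_sum fun N _ => mul_le_mul_of_nonneg_left ?_ (wt_nonneg hd N)
          by_cases h2 : T ⊆ N
          · rw [if_pos h2]; split_ifs <;> norm_num
          · rw [if_neg h2, if_neg]
            intro h3
            refine h2 fun f hf => ?_
            rcases mem_insert.1 (h3 hf) with h4 | h4
            · exact absurd (h4 ▸ hf) he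
            · exact h4
      _ ≤ _ := ih hd
      _ ≤ _ := by
          refine mul_le_mul (prod_le_prod (fun f _ => hd f) fun f _ => del_le hl _ f)
            (Z_del_le hl _) (Z_pos hd).le (prod_nonneg fun f _ => hl f)

theorem fpr_subset_le {l : E → ℝ} (hl : ∀ e, 0 ≤ l e) (T : Finset E) :
    fpr (H.hc l) (fun M => T ⊆ M) ≤ ∏ e ∈ T, l e := by
  rw [fpr, fex_hc, div_le_iff₀ (Z_pos hl)]
  refine le_trans (le_of_eq (sum_congr rfl fun M _ => ?_)) (sum_wt_subset_le T hl)
  by_cases h : T ⊆ M <;> simp [h]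

/-- Activities on the doubled edges: an edge is flagged with probability `θ`. -/
def flag (θ : ℝ) (l : E → ℝ) (x : E × Bool) : ℝ := if x.2 then θ * l x.1 else (1 - θ) * l x.1

theorem tot_flag (θ : ℝ) (l : E → ℝ) : tot (flag θ l) = l := by
  funext e; simp [tot, flag]; ring

theorem flag_nonneg {θ : ℝ} (h0 : 0 ≤ θ) (h1 : θ ≤ 1) {l : E → ℝ} (hl : ∀ e, 0 ≤ l e)
    (x : E × Bool) : 0 ≤ flag θ l x := by
  unfold flag; split_ifs
  exacts [mul_nonneg h0 (hl _), mul_nonneg (by linarith) (hl _)]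

/-- The flagged edges. -/
def hits (M : Finset (E × Bool)) : Finset E := univ.filter fun e => (e, true) ∈ M

theorem mem_hits {M : Finset (E × Bool)} {e : E} : e ∈ hits M ↔ (e, true) ∈ M := by simp [hits]

/-- The distribution of a random matching with flags. -/
def fl (H : Multi V E) (θ : ℝ) (l : E → ℝ) : Finset (E × Bool) → ℝ := H.dbl.hc (flag θ l)

theorem isProb_fl {θ : ℝ} (h0 : 0 ≤ θ) (h1 : θ ≤ 1) {l : E → ℝ} (hl : ∀ e, 0 ≤ l e) :
    IsProb (H.fl θ l) := isProb_hc (flag_nonneg h0 h1 hl)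

theorem isM_hits {M : Finset (E × Bool)} (h : H.dbl.IsM M) : H.IsM (hits M) := by
  intro e he f hf v hev hfv
  have := h (e, true) (mem_hits.1 he) (f, true) (mem_hits.1 hf) v hev hfv
  exact congrArg Prod.fst this

theorem isM_of_fl {θ : ℝ} {l : E → ℝ} {M : Finset (E × Bool)} (h : H.fl θ l M ≠ 0) :
    H.IsM (hits M) := by
  refine isM_hits (isM_of_wt (l := flag θ l) fun h0 => h ?_)
  simp [fl, hc, h0]

theorem ne_zero_of_mem_hits {θ : ℝ} {l : E → ℝ} {M : Finset (E × Bool)} (h : H.fl θ l M ≠ 0)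
    {e : E} (he : e ∈ hits M) : l e ≠ 0 := by
  intro h0
  apply h
  have : H.dbl.wt (flag θ l) M = 0 := by
    unfold wt; split_ifs
    · exact prod_eq_zero (mem_hits.1 he) (by simp [flag, h0])
    · rfl
  simp [fl, hc, this]

theorem fpr_mem_hits {θ : ℝ} (h0 : 0 ≤ θ) (h1 : θ ≤ 1) {l : E → ℝ} (hl : ∀ e, 0 ≤ l e) (e : E) :
    fpr (H.fl θ l) (fun M => e ∈ hits M) = θ * H.marg l e := by
  have hf := flag_nonneg h0 h1 hl
  have h2 : fpr (H.fl θ l) (fun M => e ∈ hits M) = H.dbl.marg (flag θ l) (e, true) := by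
    unfold fpr fl
    rw [fex_hc]
    have h3 : H.dbl.marg (flag θ l) (e, true) =
        (∑ M : Finset (E × Bool), (if (e, true) ∈ M then H.dbl.wt (flag θ l) M else 0)) /
          H.dbl.Z (flag θ l) := by
      rw [sum_wt_mem_one]; unfold marg K; ring
    rw [h3]
    congr 1
    refine sum_congr rfl fun M _ => ?_
    by_cases h : (e, true) ∈ M <;> simp [mem_hits, h]
  rw [h2, marg, dbl_K hf, tot_flag, marg]
  simp only [flag, if_true, dbl]; ring

theorem fpr_subset_hits_le {θ : ℝ} (h0 : 0 ≤ θ) (h1 : θ ≤ 1) {l : E → ℝ} (hl : ∀ e, 0 ≤ l e)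
    (T : Finset E) : fpr (H.fl θ l) (fun M => T ⊆ hits M) ≤ ∏ e ∈ T, l e := by
  have hf := flag_nonneg h0 h1 hl
  set T' : Finset (E × Bool) := T.image fun e => (e, true) with hT'
  have h2 : fpr (H.fl θ l) (fun M => T ⊆ hits M) ≤ fpr (H.fl θ l) (fun M => T' ⊆ M) := by
    refine fpr_mono (isProb_fl h0 h1 hl).1 fun M _ h x hx => ?_
    obtain ⟨e, he, rfl⟩ := mem_image.1 hx
    exact mem_hits.1 (h he)
  refine h2.trans ((fpr_subset_le hf T').trans ?_)
  rw [hT', prod_image (by intro a _ b _ h; exact congrArg Prod.fst h)]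
  refine prod_le_prod (fun e _ => hf _) fun e _ => ?_
  simp only [flag, if_true]
  exact mul_le_of_le_one_left (hl e) h1

/-- The activities seen by the unflagged edges once the set `F` of flagged edges is known. -/
def thin (H : Multi V E) (θ : ℝ) (F : Finset E) (l : E → ℝ) : E → ℝ :=
  H.del (H.verts F) fun e => (1 - θ) * l e

theorem thin_nonneg {θ : ℝ} (h1 : θ ≤ 1) {l : E → ℝ} (hl : ∀ e, 0 ≤ l e) (F : Finset E) (e : E) :
    0 ≤ H.thin θ F l e := del_nonneg (fun e => mul_nonneg (by linarith) (hl e)) _ e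

theorem thin_le {θ : ℝ} (h0 : 0 ≤ θ) (h1 : θ ≤ 1) {l : E → ℝ} (hl : ∀ e, 0 ≤ l e) (F : Finset E)
    (e : E) : H.thin θ F l e ≤ l e :=
  (del_le (fun e => mul_nonneg (by linarith) (hl e)) _ e).trans
    (mul_le_of_le_one_left (hl e) (by linarith))

theorem fex_K_thin {θ : ℝ} (h0 : 0 ≤ θ) (h1 : θ ≤ 1) {l : E → ℝ} (hl : ∀ e, 0 ≤ l e) (u w : V) :
    fex (H.fl θ l) (fun M => if H.free (hits M) {u, w} then H.K (H.thin θ (hits M) l) u w else 0) =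
      H.K l u w := by
  have hf := flag_nonneg h0 h1 hl
  have hz := Z_pos (H := H.dbl) hf
  set O : Finset (E × Bool) := univ.filter fun x => x.2 = true with hO
  set lf := flag θ l with hlf
  set l1 : E × Bool → ℝ := fun x => if x ∈ O then lf x else 0 with hl1
  set l0 : E × Bool → ℝ := fun x => if x ∈ O then 0 else lf x with hl0
  have hl0n : ∀ x, 0 ≤ l0 x := by intro x; simp only [hl0]; split_ifs; exacts [le_rfl, hf x]
  have htot0 : tot l0 = fun e => (1 - θ) * l e := by
    funext e; simp [tot, hl0, hO, hlf, flag]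
  have hA : ∀ A, H.dbl.wt l1 A ≠ 0 → A ⊆ O := by
    intro A h x hx
    by_contra hxO
    apply h; unfold wt; split_ifs
    · exact prod_eq_zero hx (by simp [hl1, hxO])
    · rfl
  have hN : ∀ A N, H.dbl.wt (H.dbl.del (H.dbl.verts A) l0) N ≠ 0 → ∀ x ∈ N, x ∉ O := by
    intro A N h x hx hxO
    apply h; rw [wt_del]; unfold wt; split_ifs
    · exact prod_eq_zero hx (by simp [hl0, hxO])
    · rfl
    · rfl
  have hverts : ∀ A ⊆ O, H.dbl.verts A = H.verts (hits A) := by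
    intro A hA
    ext v; simp only [mem_verts]
    constructor
    · rintro ⟨⟨e, b⟩, hx, hi⟩
      have : b = true := (mem_filter.1 (hA hx)).2
      subst this
      exact ⟨e, mem_hits.2 hx, hi⟩
    · rintro ⟨e, he, hi⟩; exact ⟨(e, true), mem_hits.1 he, hi⟩
  have hfree : ∀ A ⊆ O, (H.dbl.free A {u, w} ↔ H.free (hits A) {u, w}) := by
    intro A hA
    constructor
    · intro h e he; exact h (e, true) (mem_hits.1 he)
    · rintro h ⟨e, b⟩ hx
      have : b = true := (mem_filter.1 (hA hx)).2
      subst this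
      exact h e (mem_hits.2 hx)
  have hKA : ∀ A ⊆ O, H.dbl.K (H.dbl.del (H.dbl.verts A) l0) u w =
      H.K (H.thin θ (hits A) l) u w := by
    intro A hA
    rw [dbl_K (del_nonneg hl0n _), tot_del, htot0, hverts A hA]; rfl
  have hKl : H.K l u w = H.dbl.K lf u w := by rw [dbl_K hf, tot_flag]
  rw [hKl, fl, fex_hc, K]
  congr 1
  rw [← sum_wt_free_eq hf, sum_wt_split lf O, sum_wt_split lf O]
  refine sum_congr rfl fun A _ => ?_
  by_cases hwA : H.dbl.wt l1 A = 0
  · change H.dbl.wt l1 A * _ = H.dbl.wt l1 A * _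
    rw [hwA, zero_mul, zero_mul]
  congr 1
  have hAO := hA A hwA
  have e1 : ∑ N : Finset (E × Bool), H.dbl.wt (H.dbl.del (H.dbl.verts A) l0) N *
      (if H.free (hits (A ∪ N)) {u, w} then H.K (H.thin θ (hits (A ∪ N)) l) u w else 0) =
      H.dbl.Z (H.dbl.del (H.dbl.verts A) l0) *
        (if H.free (hits A) {u, w} then H.K (H.thin θ (hits A) l) u w else 0) := by
    rw [Z, sum_mul]
    refine sum_congr rfl fun N _ => ?_
    by_cases hwN : H.dbl.wt (H.dbl.del (H.dbl.verts A) l0) N = 0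
    · rw [hwN, zero_mul, zero_mul]
    · have : hits (A ∪ N) = hits A := by
        ext e; simp only [mem_hits, mem_union]
        refine ⟨fun h => h.resolve_right fun h2 => ?_, Or.inl⟩
        exact hN A N hwN _ h2 (by simp [hO])
      rw [this]
  have e2 : ∑ N : Finset (E × Bool), H.dbl.wt (H.dbl.del (H.dbl.verts A) l0) N *
      (if H.dbl.free (A ∪ N) {u, w} then 1 else 0) =
      (if H.free (hits A) {u, w} then 1 else 0) *
        H.dbl.Z (H.dbl.del {u, w} (H.dbl.del (H.dbl.verts A) l0)) := by
    rw [← sum_wt_free_eq (del_nonneg hl0n _), mul_sum]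
    refine sum_congr rfl fun N _ => ?_
    have : H.dbl.free (A ∪ N) {u, w} ↔ H.free (hits A) {u, w} ∧ H.dbl.free N {u, w} := by
      rw [← hfree A hAO]
      constructor
      · intro h
        exact ⟨fun x hx => h x (mem_union_left _ hx), fun x hx => h x (mem_union_right _ hx)⟩
      · rintro ⟨h2, h3⟩ x hx
        exact (mem_union.1 hx).elim (h2 x) (h3 x)
    by_cases h2 : H.free (hits A) {u, w} <;> by_cases h3 : H.dbl.free N {u, w} <;>
      simp [this, h2, h3]
  change ∑ N : Finset (E × Bool), H.dbl.wt (H.dbl.del (H.dbl.verts A) l0) N * _ =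
    ∑ N : Finset (E × Bool), H.dbl.wt (H.dbl.del (H.dbl.verts A) l0) N * _
  rw [e1, e2, ← hKA A hAO, K]
  have hz2 := (Z_pos (H := H.dbl) (del_nonneg (H := H.dbl) hl0n (H.dbl.verts A))).ne'
  split_ifs
  · field_simp
  · simp

section conditioning
variable {Γ : Type*} [Fintype Γ] [DecidableEq Γ]

theorem sum_prod_split (w a : Γ → Finset E → ℝ) (b : Γ → Finset E → Finset E → ℝ)
    (h : ∀ γ, ∀ g : Finset E → ℝ, ∑ M, w γ M * g M = ∑ A, a γ A * ∑ N, b γ A N * g (A ∪ N))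
    (g : (Γ → Finset E) → ℝ) :
    ∑ ω : Γ → Finset E, (∏ γ, w γ (ω γ)) * g ω =
      ∑ A : Γ → Finset E, (∏ γ, a γ (A γ)) *
        ∑ N : Γ → Finset E, (∏ γ, b γ (A γ) (N γ)) * g (fun γ => A γ ∪ N γ) := by
  have h1 : ∀ γ M, w γ M = ∑ y : Finset E × Finset E,
      a γ y.1 * b γ y.1 y.2 * (if y.1 ∪ y.2 = M then 1 else 0) := by
    intro γ M
    have := h γ (fun M' => if M' = M then 1 else 0)
    simp only [mul_ite, mul_one, mul_zero, sum_ite_eq', mem_univ, if_true] at this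
    rw [this, Fintype.sum_prod_type]
    refine sum_congr rfl fun A _ => ?_
    rw [mul_sum]
    exact sum_congr rfl fun N _ => by split_ifs <;> simp
  have h2 : ∀ ω : Γ → Finset E, ∏ γ, w γ (ω γ) = ∑ y : Γ → Finset E × Finset E,
      (∏ γ, a γ (y γ).1 * b γ (y γ).1 (y γ).2) *
        (if (fun γ => (y γ).1 ∪ (y γ).2) = ω then 1 else 0) := by
    intro ω
    simp only [h1]
    rw [prod_univ_sum, Fintype.piFinset_univ]
    refine sum_congr rfl fun y _ => ?_
    rw [prod_mul_distrib]
    congr 1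
    rw [prod_ite_zero]
    simp [funext_iff]
  simp only [h2, sum_mul]
  rw [sum_comm]
  simp only [mul_assoc, ite_mul, one_mul, zero_mul, mul_ite, mul_zero, sum_ite_eq, mem_univ, if_true]
  rw [← Equiv.sum_comp (Equiv.arrowProdEquivProdArrow Γ (fun _ => Finset E) (fun _ => Finset E)).symm]
  rw [Fintype.sum_prod_type]
  refine sum_congr rfl fun A _ => ?_
  rw [mul_sum]
  refine sum_congr rfl fun N _ => ?_
  simp [Equiv.arrowProdEquivProdArrow, prod_mul_distrib, mul_assoc]

/-- The conditional probability of a local event, given what happens outside `I`. -/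
theorem fpr_and_le {θ : ℝ} (h0 : 0 ≤ θ) (h1 : θ ≤ 1) {l : Γ → E → ℝ} (hl : ∀ γ e, 0 ≤ l γ e)
    (I : Finset E) (B S : (Γ → Finset (E × Bool)) → Prop)
    (hB : ∀ ω ω', (∀ γ, ∀ x : E × Bool, x.1 ∈ I → (x ∈ ω γ ↔ x ∈ ω' γ)) → (B ω ↔ B ω'))
    (hS : ∀ ω ω', (∀ γ, ∀ x : E × Bool, x.1 ∉ I → (x ∈ ω γ ↔ x ∈ ω' γ)) → (S ω ↔ S ω'))
    {p : ℝ} (hp : ∀ m : Γ → E → ℝ, (∀ γ e, 0 ≤ m γ e) → (∀ γ e, m γ e ≤ l γ e) →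
      (∀ γ e, (∀ f v, H.inc e v → H.inc f v → f ∈ I) → m γ e = l γ e) →
      fpr (prodP fun γ => H.fl θ (m γ)) B ≤ p) :
    fpr (prodP fun γ => H.fl θ (l γ)) (fun ω => B ω ∧ S ω) ≤
      p * fpr (prodP fun γ => H.fl θ (l γ)) S := by
  have hf := fun γ => flag_nonneg h0 h1 (hl γ)
  set O : Finset (E × Bool) := univ.filter fun x => x.1 ∉ I with hO
  set lf := fun γ => flag θ (l γ) with hlf
  set l1 : Γ → E × Bool → ℝ := fun γ x => if x ∈ O then lf γ x else 0 with hl1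
  set l0 : Γ → E × Bool → ℝ := fun γ x => if x ∈ O then 0 else lf γ x with hl0
  have hl0n : ∀ γ x, 0 ≤ l0 γ x := by
    intro γ x; simp only [hl0]; split_ifs; exacts [le_rfl, hf γ x]
  have hl1n : ∀ γ x, 0 ≤ l1 γ x := by
    intro γ x; simp only [hl1]; split_ifs; exacts [hf γ x, le_rfl]
  set C : ℝ := ∏ γ, H.dbl.Z (lf γ) with hC
  have hC0 : 0 < C := prod_pos fun γ _ => Z_pos (hf γ)
  have hpr : ∀ Q : (Γ → Finset (E × Bool)) → Prop, fpr (prodP fun γ => H.fl θ (l γ)) Q * C =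
      ∑ ω : Γ → Finset (E × Bool), (∏ γ, H.dbl.wt (lf γ) (ω γ)) * (if Q ω then 1 else 0) := by
    intro Q
    unfold fpr fex prodP fl hc
    rw [sum_mul]
    refine sum_congr rfl fun ω _ => ?_
    rw [prod_div_distrib, ← hC, mul_right_comm, div_mul_cancel₀ _ hC0.ne']
  have hsplit := sum_prod_split (fun γ => H.dbl.wt (lf γ)) (fun γ => H.dbl.wt (l1 γ))
    (fun γ A => H.dbl.wt (H.dbl.del (H.dbl.verts A) (l0 γ)))
    (fun γ g => sum_wt_split (H := H.dbl) (lf γ) O g)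
  refine le_of_mul_le_mul_right ?_ hC0
  rw [mul_assoc, hpr, hpr, hsplit, hsplit, mul_sum]
  refine sum_le_sum fun A _ => ?_
  by_cases hwA : ∏ γ, H.dbl.wt (l1 γ) (A γ) = 0
  · rw [hwA]; simp
  have hAO : ∀ γ, A γ ⊆ O := by
    intro γ x hx
    by_contra hxO
    refine hwA (prod_eq_zero (mem_univ γ) ?_)
    unfold wt; split_ifs
    · exact prod_eq_zero hx (by simp [hl1, hxO])
    · rfl
  have hA0 : 0 ≤ ∏ γ, H.dbl.wt (l1 γ) (A γ) := prod_nonneg fun γ _ => wt_nonneg (hl1n γ) _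
  rw [mul_left_comm]
  refine mul_le_mul_of_nonneg_left ?_ hA0
  set m : Γ → E → ℝ := fun γ => H.del (H.dbl.verts (A γ)) fun e => if e ∈ I then l γ e else 0 with hm
  have hmf : ∀ γ, H.dbl.del (H.dbl.verts (A γ)) (l0 γ) = flag θ (m γ) := by
    intro γ; funext ⟨e, b⟩
    by_cases h2 : H.s e ∈ H.dbl.verts (A γ) ∨ H.t e ∈ H.dbl.verts (A γ)
    · have h3 : H.dbl.del (H.dbl.verts (A γ)) (l0 γ) (e, b) = 0 := if_pos h2
      have h4 : m γ e = 0 := if_pos h2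
      rw [h3]; simp [flag, h4]
    · have h3 : H.dbl.del (H.dbl.verts (A γ)) (l0 γ) (e, b) = l0 γ (e, b) := if_neg h2
      have h4 : m γ e = if e ∈ I then l γ e else 0 := if_neg h2
      rw [h3]
      by_cases h5 : e ∈ I <;> simp [flag, h4, hl0, hO, h5, hlf]
  have hm0 : ∀ γ e, 0 ≤ m γ e := fun γ e =>
    del_nonneg (fun e => by split_ifs; exacts [hl γ e, le_rfl]) _ _
  have hml : ∀ γ e, m γ e ≤ l γ e := fun γ e =>
    (del_le (fun e => by split_ifs; exacts [hl γ e, le_rfl]) _ _).trans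
      (by split_ifs; exacts [le_rfl, hl γ e])
  have hmeq : ∀ γ e, (∀ f v, H.inc e v → H.inc f v → f ∈ I) → m γ e = l γ e := by
    intro γ e h
    have hv : ∀ v, H.inc e v → v ∉ H.dbl.verts (A γ) := by
      intro v hev hv
      obtain ⟨x, hx, hxv⟩ := mem_verts.1 hv
      exact (mem_filter.1 (hAO γ hx)).2 (h x.1 v hev hxv)
    have h2 : ¬ (H.s e ∈ H.dbl.verts (A γ) ∨ H.t e ∈ H.dbl.verts (A γ)) := by
      rintro (h2 | h2)
      · exact hv _ (inc_s e) h2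
      · exact hv _ (inc_t e) h2
    have h4 : m γ e = if e ∈ I then l γ e else 0 := if_neg h2
    rw [h4, if_pos (h e _ (inc_s e) (inc_s e))]
  have hbound := hp m hm0 hml hmeq
  set C' : ℝ := ∏ γ, H.dbl.Z (flag θ (m γ)) with hC'
  have hC'0 : 0 < C' := prod_pos fun γ _ => Z_pos (flag_nonneg h0 h1 (hm0 γ))
  have hprm : fpr (prodP fun γ => H.fl θ (m γ)) B * C' =
      ∑ ω : Γ → Finset (E × Bool), (∏ γ, H.dbl.wt (flag θ (m γ)) (ω γ)) * (if B ω then 1 else 0) := by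
    unfold fpr fex prodP fl hc
    rw [sum_mul]
    refine sum_congr rfl fun ω _ => ?_
    rw [prod_div_distrib, ← hC', mul_right_comm, div_mul_cancel₀ _ hC'0.ne']
  have hZm : ∑ ω : Γ → Finset (E × Bool), ∏ γ, H.dbl.wt (flag θ (m γ)) (ω γ) = C' := by
    rw [hC']; unfold Z
    rw [prod_univ_sum, Fintype.piFinset_univ]
  simp only [hmf]
  have hNI : ∀ N : Γ → Finset (E × Bool), ∏ γ, H.dbl.wt (flag θ (m γ)) (N γ) ≠ 0 →
      ∀ γ, ∀ x ∈ N γ, x.1 ∈ I := by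
    intro N h γ x hx
    by_contra hxI
    refine h (prod_eq_zero (mem_univ γ) ?_)
    unfold wt; split_ifs
    · refine prod_eq_zero hx ?_
      have : m γ x.1 = 0 := by
        simp only [hm, del, hxI, if_false, ite_self]
      simp [flag, this]
    · rfl
  have hSA : ∀ N : Γ → Finset (E × Bool), ∏ γ, H.dbl.wt (flag θ (m γ)) (N γ) ≠ 0 →
      (S (fun γ => A γ ∪ N γ) ↔ S A) := by
    intro N h
    refine hS _ _ fun γ x hx => ?_
    simp only [mem_union, or_iff_left_iff_imp]
    intro hxN; exact absurd (hNI N h γ x hxN) hx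
  have hBN : ∀ N : Γ → Finset (E × Bool), (B (fun γ => A γ ∪ N γ) ↔ B N) := by
    intro N
    refine hB _ _ fun γ x hx => ?_
    simp only [mem_union, or_iff_right_iff_imp]
    intro hxA; exact absurd hx (mem_filter.1 (hAO γ hxA)).2
  calc _ = (fpr (prodP fun γ => H.fl θ (m γ)) B * C') * (if S A then 1 else 0) := by
        rw [hprm, sum_mul]
        refine sum_congr rfl fun N _ => ?_
        by_cases hN : ∏ γ, H.dbl.wt (flag θ (m γ)) (N γ) = 0
        · rw [hN]; simp
        · rw [mul_assoc]
          congr 1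
          have e1 := hSA N hN
          have e2 := hBN N
          by_cases h2 : S A <;> by_cases h3 : B N <;> simp [e1, e2, h2, h3]
    _ ≤ (p * C') * (if S A then 1 else 0) := by
        refine mul_le_mul_of_nonneg_right (mul_le_mul_of_nonneg_right hbound hC'0.le) ?_
        split_ifs <;> norm_num
    _ = _ := by
        rw [← hZm, mul_assoc, sum_mul]
        congr 1
        refine sum_congr rfl fun N _ => ?_
        by_cases hN : ∏ γ, H.dbl.wt (flag θ (m γ)) (N γ) = 0
        · rw [hN]; simp
        · have e1 := hSA N hN
          by_cases h2 : S A <;> simp [e1, h2]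

end conditioning
end Multi

namespace Multi
variable {V E : Type*} [Fintype V] [DecidableEq V] [Fintype E] [DecidableEq E] {H : Multi V E}

theorem marg_le_one {l : E → ℝ} (hl : ∀ e, 0 ≤ l e) (e : E) : H.marg l e ≤ 1 := by
  have h1 := Fr_add_sum (H := H) hl (H.s e)
  have h2 := single_le_sum (f := fun f => H.marg l f) (fun f _ => marg_nonneg hl f) (mem_star.2 (inc_s e) : e ∈ H.star (H.s e))
  have h3 := Fr_pos (H := H) hl (H.s e)
  linarith

/-- The error of the computation tree of depth `k`. -/
def err (C : ℝ) (k : ℕ) : ℝ := (C / (1 + C)) ^ k * C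

theorem err_nonneg {C : ℝ} (hC : 0 ≤ C) (k : ℕ) : 0 ≤ err C k := by unfold err; positivity

theorem eball_mono {i k : ℕ} {u v : V} (h : u ∈ H.ball i v) {j : ℕ} (hj : i + j ≤ k) :
    H.eball j u ⊆ H.eball k v := by
  intro e he
  obtain ⟨w, hw, hi⟩ := mem_eball.1 he
  exact mem_eball.2 ⟨w, ball_mono hj _ (ball_trans h hw), hi⟩

/-- The approximation of the probability that `u` and `w` are both free. -/
def Kk (H : Multi V E) (k : ℕ) (l : E → ℝ) (u w : V) : ℝ :=
  H.Fk k l u * H.Fk k (H.del {u} l) w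

theorem Kk_nonneg {l : E → ℝ} (hl : ∀ e, 0 ≤ l e) (k : ℕ) (u w : V) : 0 ≤ H.Kk k l u w :=
  mul_nonneg (Fk_pos_le hl k u).1.le (Fk_pos_le (del_nonneg hl _) k w).1.le

theorem Kk_le_one {l : E → ℝ} (hl : ∀ e, 0 ≤ l e) (k : ℕ) (u w : V) : H.Kk k l u w ≤ 1 :=
  mul_le_one₀ (Fk_pos_le hl k u).2 (Fk_pos_le (del_nonneg hl _) k w).1.le
    (Fk_pos_le (del_nonneg hl _) k w).2

theorem Kk_near {C : ℝ} (hC : 0 ≤ C) {l : E → ℝ} (hl : ∀ e, 0 ≤ l e) (hb : H.bdd C l) (k : ℕ)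
    (u w : V) : near (2 * err C k) (H.Kk k l u w) (H.K l u w) := by
  rw [K_eq_Fr_mul hl, two_mul]
  exact (Fk_near hC k l hl hb u).mul (Fk_near hC k _ (del_nonneg hl _) (hb.del hl _) w)
    (Fk_pos_le hl k u).1.le (Fr_pos hl u).le (Fk_pos_le (del_nonneg hl _) k w).1.le
    (Fr_pos (del_nonneg hl _) w).le

theorem Kk_congr {k : ℕ} {l l' : E → ℝ} {u w : V} (hw : w ∈ H.ball 1 u)
    (h : ∀ e ∈ H.eball (k + 1) u, l e = l' e) : H.Kk k l u w = H.Kk k l' u w := by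
  unfold Kk
  rw [Fk_congr k fun e he => h e (eball_mono (self_mem_ball 0 u) (by omega) he)]
  congr 1
  refine Fk_congr k fun e he => ?_
  have := h e (eball_mono hw (by omega) he)
  simp only [del, this]

theorem t_mem_ball (e : E) : H.t e ∈ H.ball 1 (H.s e) := by
  have := other_mem_ball (H := H) (inc_s e)
  rwa [other_mem (inc_s e) (inc_t e) (H.ne e)] at this

theorem near.const_mul {τ A B c : ℝ} (h : near τ A B) (hc : 0 ≤ c) : near τ (c * A) (c * B) := by
  constructor
  · have := mul_le_mul_of_nonneg_left h.1 hc; linarith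
  · have := mul_le_mul_of_nonneg_left h.2 hc; linarith

theorem near.sum {ι : Type*} {s : Finset ι} {τ : ℝ} {A B : ι → ℝ}
    (h : ∀ i ∈ s, near τ (A i) (B i)) : near τ (∑ i ∈ s, A i) (∑ i ∈ s, B i) := by
  constructor
  · rw [mul_sum]; exact sum_le_sum fun i hi => (h i hi).1
  · rw [mul_sum]; exact sum_le_sum fun i hi => (h i hi).2

theorem near.abs_sub_le {τ A B b : ℝ} (h : near τ A B) (hτ0 : 0 ≤ τ) (hτ : τ ≤ 1) (hA : 0 ≤ A)
    (hB : 0 ≤ B) (hb : B ≤ b) : |A - B| ≤ 6 * τ * b := by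
  have h1 : Real.exp τ ≤ 1 + 2 * τ := by
    have := exp_quadratic (x := τ) (by rw [abs_of_nonneg hτ0]; exact hτ)
    nlinarith
  have h3 : A ≤ 3 * B := h.1.trans (by nlinarith)
  have h2 := h.2
  have h4 := h.1
  have h5 : Real.exp τ * B ≤ (1 + 2 * τ) * B := mul_le_mul_of_nonneg_right h1 hB
  have h6 : Real.exp τ * A ≤ (1 + 2 * τ) * A := mul_le_mul_of_nonneg_right h1 hA
  have h7 : τ * B ≤ τ * b := mul_le_mul_of_nonneg_left hb hτ0
  have h8 : τ * A ≤ τ * (3 * B) := mul_le_mul_of_nonneg_left h3 hτ0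
  have h9 : 0 ≤ τ * B := mul_nonneg hτ0 hB
  rw [abs_le]
  constructor <;> linarith

theorem K_near_of_agree {C : ℝ} (hC : 0 ≤ C) {l m : E → ℝ} (hl : ∀ e, 0 ≤ l e)
    (hm : ∀ e, 0 ≤ m e) (hbl : H.bdd C l) (hbm : H.bdd C m) {k : ℕ} {u w : V}
    (hw : w ∈ H.ball 1 u) (h : ∀ e ∈ H.eball (k + 1) u, m e = l e) :
    near (4 * err C k) (H.K m u w) (H.K l u w) := by
  have h1 := (Kk_near hC hm hbm k u w).symm
  have h2 := Kk_near hC hl hbl k u w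
  rw [Kk_congr hw h] at h1
  have := h1.trans h2
  rwa [← add_mul, show (2 : ℝ) + 2 = 4 by norm_num] at this

theorem marg_near {C : ℝ} (hC : 0 ≤ C) {l m : E → ℝ} (hl : ∀ e, 0 ≤ l e)
    (hm : ∀ e, 0 ≤ m e) (hbl : H.bdd C l) (hbm : H.bdd C m) {k : ℕ} {e : E}
    (h : ∀ f ∈ H.eball (k + 1) (H.s e), m f = l f) :
    near (4 * err C k) (H.marg m e) (H.marg l e) := by
  unfold marg
  rw [h e (mem_eball.2 ⟨_, self_mem_ball _ _, inc_s e⟩)]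
  exact (K_near_of_agree hC hl hm hbl hbm (t_mem_ball e) h).const_mul (hl e)

theorem thin_congr {θ : ℝ} {F : Finset E} {l m : E → ℝ} {e : E} (h : m e = l e) :
    H.thin θ F m e = H.thin θ F l e := by simp only [thin, del, h]

theorem bdd.mono {Λ : ℝ} {l m : E → ℝ} (h : H.bdd Λ l) (hm : ∀ e, m e ≤ l e) : H.bdd Λ m :=
  fun v => (sum_le_sum fun e _ => hm e).trans (h v)

theorem one_sub_sum_le_prod {ι : Type*} (s : Finset ι) (x : ι → ℝ) (h0 : ∀ i ∈ s, 0 ≤ x i)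
    (h1 : ∀ i ∈ s, x i ≤ 1) : 1 - ∑ i ∈ s, x i ≤ ∏ i ∈ s, (1 - x i) := by
  have hb : ∀ i ∈ s, 0 ≤ 1 - x i ∧ 1 - x i ≤ 1 := fun i hi => ⟨by linarith [h1 i hi], by linarith [h0 i hi]⟩
  induction s using Finset.induction_on with
  | empty => simp
  | insert i s hi ih =>
    rw [sum_insert hi, prod_insert hi]
    have h2 := ih (fun j hj => h0 j (mem_insert_of_mem hj)) (fun j hj => h1 j (mem_insert_of_mem hj))
      (fun j hj => hb j (mem_insert_of_mem hj))
    have h3 : ∏ i ∈ s, (1 - x i) ≤ 1 :=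
      prod_le_one (fun j hj => (hb j (mem_insert_of_mem hj)).1) fun j hj => (hb j (mem_insert_of_mem hj)).2
    have h4 := h0 i (mem_insert_self _ _)
    nlinarith

theorem prod_one_sub_near {ι : Type*} (s : Finset ι) (x : ι → ℝ) (h0 : ∀ i ∈ s, 0 ≤ x i)
    (h1 : ∀ i ∈ s, x i ≤ 1) (hs : ∑ i ∈ s, x i ≤ 1) {θ η : ℝ} (hη : |∑ i ∈ s, x i - θ| ≤ η) :
    |∏ i ∈ s, (1 - x i) - (1 - θ)| ≤ η + (∑ i ∈ s, x i) ^ 2 := by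
  have h2 := one_sub_sum_le_prod s x h0 h1
  have h3 : ∏ i ∈ s, (1 - x i) ≤ Real.exp (-∑ i ∈ s, x i) := by
    rw [← sum_neg_distrib, Real.exp_sum]
    refine prod_le_prod (fun i hi => by linarith [h1 i hi]) fun i _ => ?_
    have := Real.add_one_le_exp (-x i)
    linarith
  have h4 : 0 ≤ ∑ i ∈ s, x i := sum_nonneg h0
  have h5 := exp_quadratic (x := -∑ i ∈ s, x i) (by rw [abs_neg, abs_of_nonneg h4]; exact hs)
  have h6 := abs_le.1 hη
  rw [neg_sq] at h5
  rw [abs_le]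
  constructor <;> nlinarith

section
variable {Γ : Type*} [Fintype Γ] [DecidableEq Γ]

/-- The expected number of colours at an edge. -/
def S (H : Multi V E) (l : Γ → E → ℝ) (e : E) : ℝ := ∑ γ, H.marg (l γ) e

/-- The local approximation of the expected number of colours at `e` after the flagged edges
have been removed. -/
def Xval (H : Multi V E) (θ : ℝ) (k : ℕ) (l : Γ → E → ℝ) (e : E) (ω : Γ → Finset (E × Bool)) : ℝ :=
  ∑ γ, if H.free (hits (ω γ)) {H.s e, H.t e} then
    l γ e * H.Kk k (H.thin θ (hits (ω γ)) (l γ)) (H.s e) (H.t e) else 0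

theorem S_nonneg {l : Γ → E → ℝ} (hl : ∀ γ e, 0 ≤ l γ e) (e : E) : 0 ≤ H.S l e :=
  sum_nonneg fun γ _ => marg_nonneg (hl γ) e

theorem S_near {C : ℝ} (hC : 0 ≤ C) {l m : Γ → E → ℝ} (hl : ∀ γ e, 0 ≤ l γ e)
    (hm : ∀ γ e, 0 ≤ m γ e) (hbl : ∀ γ, H.bdd C (l γ)) (hbm : ∀ γ, H.bdd C (m γ)) {k : ℕ} {e : E}
    (h : ∀ γ, ∀ f ∈ H.eball (k + 1) (H.s e), m γ f = l γ f) :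
    near (4 * err C k) (H.S m e) (H.S l e) :=
  near.sum fun γ _ => marg_near hC (hl γ) (hm γ) (hbl γ) (hbm γ) (h γ)

theorem fex_single {A : Type*} [Fintype A] {P : Γ → A → ℝ} (hP : ∀ γ, IsProb (P γ)) (γ : Γ)
    (g : A → ℝ) : fex (prodP P) (fun ω => g (ω γ)) = fex (P γ) g := by
  rw [fex_update hP γ]
  simp only [Function.update_self]
  exact fex_const (isProb_prodP hP) _

theorem fex_Xval_near {θ C : ℝ} (h0 : 0 ≤ θ) (h1 : θ ≤ 1) (hC : 0 ≤ C) {l m : Γ → E → ℝ}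
    (hl : ∀ γ e, 0 ≤ l γ e) (hm : ∀ γ e, 0 ≤ m γ e) (hbl : ∀ γ, H.bdd C (l γ))
    (hml : ∀ γ e, m γ e ≤ l γ e) {k : ℕ} {e : E}
    (h : ∀ γ, ∀ f ∈ H.eball (k + 1) (H.s e), m γ f = l γ f) :
    near (6 * err C k) (fex (prodP fun γ => H.fl θ (m γ)) (H.Xval θ k l e)) (H.S l e) := by
  have hP := fun γ => isProb_fl (H := H) h0 h1 (hm γ)
  have hbm : ∀ γ, H.bdd C (m γ) := fun γ => (hbl γ).mono (hml γ)
  unfold Xval S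
  rw [fex_sum]
  refine near.sum fun γ _ => ?_
  rw [fex_single hP γ (fun M => if H.free (hits M) {H.s e, H.t e} then
    l γ e * H.Kk k (H.thin θ (hits M) (l γ)) (H.s e) (H.t e) else 0)]
  have h2 : near (2 * err C k) (fex (H.fl θ (m γ)) (fun M => if H.free (hits M) {H.s e, H.t e} then
      l γ e * H.Kk k (H.thin θ (hits M) (l γ)) (H.s e) (H.t e) else 0))
      (fex (H.fl θ (m γ)) (fun M => l γ e * if H.free (hits M) {H.s e, H.t e} then
        H.K (H.thin θ (hits M) (m γ)) (H.s e) (H.t e) else 0)) := by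
    refine near.sum fun M _ => near.const_mul ?_ ((hP γ).1 M)
    dsimp only
    split_ifs
    · refine near.const_mul ?_ (hl γ e)
      rw [Kk_congr (t_mem_ball e) (l' := H.thin θ (hits M) (m γ))
        fun f hf => thin_congr (h γ f hf).symm]
      exact Kk_near hC (thin_nonneg h1 (hm γ) _) ((hbm γ).mono (thin_le h0 h1 (hm γ) _)) k _ _
    · simp [near]
  rw [fex_const_mul, fex_K_thin h0 h1 (hm γ)] at h2
  have h3 := (K_near_of_agree hC (hl γ) (hm γ) (hbl γ) (hbm γ) (t_mem_ball e) (h γ)).const_mul (hl γ e)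
  have := h2.trans h3
  rwa [← add_mul, show (2 : ℝ) + 4 = 6 by norm_num] at this

theorem fpr_Xval_le {θ C ζ t : ℝ} {D : ℕ} (h0 : 0 ≤ θ) (h1 : θ ≤ 1) (hC : 1 ≤ C) (hD : 0 < D)
    {l m : Γ → E → ℝ} (hl : ∀ γ e, 0 ≤ l γ e) (hm : ∀ γ e, 0 ≤ m γ e) (hbl : ∀ γ, H.bdd C (l γ))
    (hlC : ∀ γ e, l γ e ≤ C / D) (hcol : ∀ e, ((univ.filter fun γ => l γ e ≠ 0).card : ℝ) ≤ C * D)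
    (hml : ∀ γ e, m γ e ≤ l γ e) {k : ℕ} {e : E}
    (h : ∀ γ, ∀ f ∈ H.eball (k + 1) (H.s e), m γ f = l γ f) (hS : H.S l e ≤ 2)
    (hk : 6 * err C k ≤ 1) (hkζ : 72 * err C k ≤ ζ / 2) (ht : 0 ≤ t) (htC : t * C ≤ 1) :
    fpr (prodP fun γ => H.fl θ (m γ)) (fun ω => ζ ≤ |H.Xval θ k l e ω - H.S l e|) ≤
      2 * Real.exp (-(t * (ζ / 2) - t ^ 2 * C ^ 3) * D) := by
  have hC0 : 0 ≤ C := by linarith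
  have hP := fun γ => isProb_fl (H := H) h0 h1 (hm γ)
  have hPP := isProb_prodP hP
  have hD0 : (0 : ℝ) < D := by exact_mod_cast hD
  have hn := fex_Xval_near h0 h1 hC0 hl hm hbl hml h
  have hE0 : 0 ≤ err C k := err_nonneg hC0 k
  have hX0 : ∀ ω, 0 ≤ H.Xval θ k l e ω := fun ω => sum_nonneg fun γ _ => by
    split_ifs
    · exact mul_nonneg (hl γ e) (Kk_nonneg (thin_nonneg h1 (hl γ) _) _ _ _)
    · exact le_rfl
  have hd := hn.abs_sub_le (by positivity) hk
    (sum_nonneg fun ω _ => mul_nonneg (hPP.1 ω) (hX0 ω)) (S_nonneg hl e) hS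
  have hterm : ∀ γ M, 0 ≤ (if H.free (hits M) {H.s e, H.t e} then
      l γ e * H.Kk k (H.thin θ (hits M) (l γ)) (H.s e) (H.t e) else 0) ∧
      (if H.free (hits M) {H.s e, H.t e} then
      l γ e * H.Kk k (H.thin θ (hits M) (l γ)) (H.s e) (H.t e) else 0) ≤ l γ e := by
    intro γ M
    split_ifs
    · exact ⟨mul_nonneg (hl γ e) (Kk_nonneg (thin_nonneg h1 (hl γ) _) _ _ _),
        mul_le_of_le_one_right (hl γ e) (Kk_le_one (thin_nonneg h1 (hl γ) _) _ _ _)⟩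
    · exact ⟨le_rfl, hl γ e⟩
  have hdiff : ∀ γ (ω : Γ → Finset (E × Bool)) x y,
      |H.Xval θ k l e (Function.update ω γ x) - H.Xval θ k l e (Function.update ω γ y)| ≤ l γ e := by
    intro γ ω x y
    unfold Xval
    rw [← add_sum_erase univ _ (mem_univ γ), ← add_sum_erase univ (fun γ' => if H.free (hits (Function.update ω γ y γ')) {H.s e, H.t e} then
      l γ' e * H.Kk k (H.thin θ (hits (Function.update ω γ y γ')) (l γ')) (H.s e) (H.t e) else 0) (mem_univ γ)]
    have : ∀ z, ∑ γ' ∈ univ.erase γ, (if H.free (hits (Function.update ω γ z γ')) {H.s e, H.t e} then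
        l γ' e * H.Kk k (H.thin θ (hits (Function.update ω γ z γ')) (l γ')) (H.s e) (H.t e) else 0) =
        ∑ γ' ∈ univ.erase γ, (if H.free (hits (ω γ')) {H.s e, H.t e} then
        l γ' e * H.Kk k (H.thin θ (hits (ω γ')) (l γ')) (H.s e) (H.t e) else 0) := by
      intro z
      refine sum_congr rfl fun γ' hγ' => ?_
      rw [Function.update_of_ne (ne_of_mem_erase hγ')]
    rw [this, this, Function.update_self, Function.update_self]
    have hx := hterm γ x
    have hy := hterm γ y
    rw [abs_le]; constructor <;> linarith
  have key := concentration hP (fun γ _ => l γ e = 0) (fun γ => if l γ e ≠ 0 then 1 else 0)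
    (c := C / D) (t := t * D) (q := C * D) (ξ := ζ / 2) (by positivity) ?_ (by positivity) ?_ ?_
    (H.Xval θ k l e) (fun γ ω x y => (hdiff γ ω x y).trans (hlC γ e)) ?_
  · refine le_trans (fpr_mono hPP.1 fun ω _ hω => ?_) (key.trans (le_of_eq ?_))
    · have h5 := abs_sub_abs_le_abs_sub (H.Xval θ k l e ω - H.S l e)
        (fex (prodP fun γ => H.fl θ (m γ)) (H.Xval θ k l e) - H.S l e)
      rw [sub_sub_sub_cancel_right] at h5
      linarith
    · congr 2
      field_simp
      ring
  · intro γ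
    by_cases hz : l γ e = 0
    · simp [fpr, hz, fex]
    · simp only [hz, not_false_iff, ne_eq, if_true, fpr]
      exact le_of_eq (fex_const (hP γ) 1)
  · calc t * D * (C / D) = t * C := by field_simp
      _ ≤ 1 := htC
  · refine le_trans (le_of_eq ?_) (hcol e)
    rw [card_filter]; push_cast; rfl
  · intro γ ω x y hx _
    have := hdiff γ ω x y
    rw [hx] at this
    exact sub_eq_zero.1 (abs_eq_zero.1 (le_antisymm this (abs_nonneg _)))

/-- The edge `f` is flagged in some colour other than `γ₀`. -/
def hitBy (γ₀ : Option Γ) (ω : Γ → Finset (E × Bool)) (f : E) : Prop :=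
  ∃ γ, some γ ≠ γ₀ ∧ f ∈ hits (ω γ)

/-- The total weight of the edges at `v` that are not flagged in a colour other than `γ₀`. -/
def Wval (H : Multi V E) (v : V) (a : E → ℝ) (γ₀ : Option Γ) (ω : Γ → Finset (E × Bool)) : ℝ :=
  ∑ f ∈ H.star v, a f * (if hitBy γ₀ ω f then 0 else 1)

theorem ite_hitBy (γ₀ : Option Γ) (ω : Γ → Finset (E × Bool)) (f : E) :
    (if hitBy γ₀ ω f then (0 : ℝ) else 1) =
      ∏ γ, (if some γ ≠ γ₀ ∧ f ∈ hits (ω γ) then 0 else 1) := by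
  split_ifs with h
  · obtain ⟨γ, hγ⟩ := h
    exact (prod_eq_zero (mem_univ γ) (by simp [hγ])).symm
  · symm; refine prod_eq_one fun γ _ => ?_
    rw [if_neg]; intro h2; exact h ⟨γ, h2⟩

theorem fex_not_hitBy {θ : ℝ} (h0 : 0 ≤ θ) (h1 : θ ≤ 1) {m : Γ → E → ℝ} (hm : ∀ γ e, 0 ≤ m γ e)
    (γ₀ : Option Γ) (f : E) :
    fex (prodP fun γ => H.fl θ (m γ)) (fun ω => if hitBy γ₀ ω f then 0 else 1) =
      ∏ γ ∈ univ.filter (fun γ => some γ ≠ γ₀), (1 - θ * H.marg (m γ) f) := by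
  simp only [ite_hitBy]
  rw [fex_prod (fun γ M => if some γ ≠ γ₀ ∧ f ∈ hits M then (0 : ℝ) else 1), prod_filter]
  refine prod_congr rfl fun γ _ => ?_
  have hP := isProb_fl (H := H) h0 h1 (hm γ)
  split_ifs with h
  · have h3 : (1 : ℝ) - θ * H.marg (m γ) f = fex (H.fl θ (m γ)) (fun _ => 1) -
        fpr (H.fl θ (m γ)) (fun M => f ∈ hits M) := by
      rw [fex_const hP, fpr_mem_hits h0 h1 (hm γ)]
    rw [h3, fpr, ← fex_sub]
    congr 1; funext M
    by_cases h2 : f ∈ hits M <;> simp [h, h2]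
  · have : ∀ M : Finset (E × Bool), (if some γ ≠ γ₀ ∧ f ∈ hits M then (0 : ℝ) else 1) = 1 := by
      intro M; rw [if_neg]; exact fun h2 => h h2.1
    simp only [this]; exact fex_const hP 1

theorem IsM.sum_star_le {M : Finset E} (h : H.IsM M) (v : V) :
    ∑ e ∈ H.star v, (if e ∈ M then (1 : ℝ) else 0) ≤ 1 := by
  have := h.free_add_sum v
  have h2 : (0 : ℝ) ≤ if H.free M {v} then 1 else 0 := by split_ifs <;> norm_num
  linarith

end

end Multi

namespace Multi
variable {V E : Type*} [Fintype V] [DecidableEq V] [Fintype E] [DecidableEq E] {H : Multi V E}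

section
variable {Γ : Type*} [Fintype Γ] [DecidableEq Γ]

/-- Replace a set that is not a matching by the empty set. -/
def rob (H : Multi V E) (M : Finset (E × Bool)) : Finset (E × Bool) := if H.dbl.IsM M then M else ∅

theorem isM_hits_rob (M : Finset (E × Bool)) : H.IsM (hits (H.rob M)) := by
  refine isM_hits ?_
  unfold rob
  split_ifs with h
  · exact h
  · exact isM_empty

theorem rob_of_fl {θ : ℝ} {l : E → ℝ} {M : Finset (E × Bool)} (h : H.fl θ l M ≠ 0) :
    H.rob M = M := by
  unfold rob
  rw [if_pos]
  exact isM_of_wt (fun h2 => h (by unfold fl hc; rw [h2, zero_div]))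

theorem ne_zero_of_prodP {A : Type*} {P : Γ → A → ℝ} {ω : Γ → A} (h : prodP P ω ≠ 0) (γ : Γ) :
    P γ (ω γ) ≠ 0 := fun h2 => h (prod_eq_zero (mem_univ γ) h2)

theorem hitBy_update {γ₀ : Option Γ} {ω : Γ → Finset (E × Bool)} {γ : Γ} {x y : Finset (E × Bool)}
    {f : E} (hx : some γ = γ₀ ∨ f ∉ hits x) (hy : some γ = γ₀ ∨ f ∉ hits y) :
    hitBy γ₀ (Function.update ω γ x) f ↔ hitBy γ₀ (Function.update ω γ y) f := by
  have : ∀ x y : Finset (E × Bool), (some γ = γ₀ ∨ f ∉ hits x) →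
      hitBy γ₀ (Function.update ω γ x) f → hitBy γ₀ (Function.update ω γ y) f := by
    rintro x y hx ⟨γ', h1, h2⟩
    by_cases hg : γ' = γ
    · subst hg
      rw [Function.update_self] at h2
      exact absurd h2 (hx.resolve_left h1)
    · refine ⟨γ', h1, ?_⟩
      rwa [Function.update_of_ne hg] at h2 ⊢
  exact ⟨this x y hx, this y x hy⟩

theorem Wval_update_le {v : V} {a : E → ℝ} {b : ℝ} (h0 : 0 ≤ b) (ha : ∀ f, 0 ≤ a f) (hb : ∀ f, a f ≤ b)
    (γ₀ : Option Γ) (ω : Γ → Finset (E × Bool)) (γ : Γ) {x y : Finset (E × Bool)}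
    (hx : H.IsM (hits x)) (hy : H.IsM (hits y)) :
    |H.Wval v a γ₀ (Function.update ω γ x) - H.Wval v a γ₀ (Function.update ω γ y)| ≤ 2 * b := by
  unfold Wval
  rw [← sum_sub_distrib]
  refine (abs_sum_le_sum_abs _ _).trans ?_
  have : ∀ f ∈ H.star v, |a f * (if hitBy γ₀ (Function.update ω γ x) f then (0 : ℝ) else 1) -
      a f * (if hitBy γ₀ (Function.update ω γ y) f then 0 else 1)| ≤
      b * (if f ∈ hits x then 1 else 0) + b * (if f ∈ hits y then 1 else 0) := by
    intro f _
    have h1 := ha f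
    have h2 := hb f
    by_cases hfx : f ∈ hits x
    · have h3 : (0 : ℝ) ≤ if f ∈ hits y then (1 : ℝ) else 0 := by split_ifs <;> norm_num
      have h4 : 0 ≤ b * if f ∈ hits y then (1 : ℝ) else 0 := mul_nonneg (h1.trans h2) h3
      rw [if_pos hfx, abs_le]
      split_ifs at * <;> constructor <;> linarith
    · by_cases hfy : f ∈ hits y
      · rw [if_pos hfy, abs_le]
        split_ifs at * <;> constructor <;> linarith
      · have := hitBy_update (ω := ω) (γ₀ := γ₀) (γ := γ) (Or.inr hfx) (Or.inr hfy)
        simp only [this, sub_self, abs_zero, hfx, hfy, if_false, mul_zero, add_zero, le_refl]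
  refine (sum_le_sum this).trans ?_
  rw [sum_add_distrib, ← mul_sum, ← mul_sum]
  have h1 := mul_le_mul_of_nonneg_left (hx.sum_star_le v) h0
  have h2 := mul_le_mul_of_nonneg_left (hy.sum_star_le v) h0
  linarith


theorem fex_Wval_near {θ δ : ℝ} (h0 : 0 ≤ θ) (h1 : θ ≤ 1 / 2) (hδ0 : 0 ≤ δ) (hδ1 : δ ≤ 1)
    {m : Γ → E → ℝ} (hm : ∀ γ e, 0 ≤ m γ e) {v : V} {a : E → ℝ} {A : ℝ} (ha : ∀ f, 0 ≤ a f)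
    (hA : ∑ f ∈ H.star v, a f ≤ A) (γ₀ : Option Γ)
    (hS : ∀ f ∈ H.star v, a f ≠ 0 →
      |∑ γ ∈ univ.filter (fun γ => some γ ≠ γ₀), H.marg (m γ) f - 1| ≤ δ) :
    |fex (prodP fun γ => H.fl θ (m γ)) (H.Wval v a γ₀) - (1 - θ) * ∑ f ∈ H.star v, a f| ≤
      A * (θ * δ + 4 * θ ^ 2) := by
  have e1 : fex (prodP fun γ => H.fl θ (m γ)) (H.Wval v a γ₀) = ∑ f ∈ H.star v, a f *
      ∏ γ ∈ univ.filter (fun γ => some γ ≠ γ₀), (1 - θ * H.marg (m γ) f) := by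
    unfold Wval
    rw [fex_sum]
    refine sum_congr rfl fun f _ => ?_
    rw [fex_const_mul, fex_not_hitBy h0 (by linarith) hm]
  rw [e1, mul_sum, ← sum_sub_distrib]
  refine (abs_sum_le_sum_abs _ _).trans ?_
  refine le_trans (sum_le_sum (g := fun f => a f * (θ * δ + 4 * θ ^ 2)) fun f hf => ?_) ?_
  · by_cases haf : a f = 0
    · simp [haf]
    have h2 := hS f hf haf
    have h3 := abs_le.1 h2
    rw [mul_comm (1 - θ), ← mul_sub, abs_mul, abs_of_nonneg (ha f)]
    refine mul_le_mul_of_nonneg_left ?_ (ha f)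
    have hs2 : ∑ γ ∈ univ.filter (fun γ => some γ ≠ γ₀), θ * H.marg (m γ) f ≤ 2 * θ := by
      rw [← mul_sum]; nlinarith
    have hs0 : 0 ≤ ∑ γ ∈ univ.filter (fun γ => some γ ≠ γ₀), θ * H.marg (m γ) f :=
      sum_nonneg fun γ _ => mul_nonneg h0 (marg_nonneg (hm γ) f)
    have := prod_one_sub_near (univ.filter (fun γ => some γ ≠ γ₀)) (fun γ => θ * H.marg (m γ) f)
      (fun γ _ => mul_nonneg h0 (marg_nonneg (hm γ) f))
      (fun γ _ => mul_le_one₀ (by linarith) (marg_nonneg (hm γ) f) (marg_le_one (hm γ) f))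
      (by linarith) (θ := θ) (η := θ * δ) (by
        rw [← mul_sum, show θ * ∑ γ ∈ univ.filter (fun γ => some γ ≠ γ₀), H.marg (m γ) f - θ =
          θ * (∑ γ ∈ univ.filter (fun γ => some γ ≠ γ₀), H.marg (m γ) f - 1) by ring, abs_mul,
          abs_of_nonneg h0]
        exact mul_le_mul_of_nonneg_left h2 h0)
    refine this.trans ?_
    nlinarith
  · rw [← sum_mul]
    exact mul_le_mul_of_nonneg_right hA (by positivity)

theorem fpr_Wval_le {θ δ C ζ t : ℝ} {D : ℕ} (h0 : 0 ≤ θ) (h1 : θ ≤ 1 / 2) (hδ0 : 0 ≤ δ)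
    (hδ1 : δ ≤ 1) (hC : 1 ≤ C) (hD : 0 < D) {m : Γ → E → ℝ} (hm : ∀ γ e, 0 ≤ m γ e) {v : V}
    (hdeg : (H.star v).card ≤ D) {a : E → ℝ} (ha : ∀ f, 0 ≤ a f) (haC : ∀ f, a f ≤ C / D)
    (γ₀ : Option Γ)
    (hS : ∀ f ∈ H.star v, a f ≠ 0 →
      |∑ γ ∈ univ.filter (fun γ => some γ ≠ γ₀), H.marg (m γ) f - 1| ≤ δ)
    (ht : 0 ≤ t) (htC : t * (2 * C) ≤ 1) :
    fpr (prodP fun γ => H.fl θ (m γ)) (fun ω => C * (θ * δ + 4 * θ ^ 2) + ζ ≤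
      |H.Wval v a γ₀ ω - (1 - θ) * ∑ f ∈ H.star v, a f|) ≤
      2 * Real.exp (-(t * ζ - t ^ 2 * (4 * C ^ 2)) * D) := by
  have h1' : θ ≤ 1 := by linarith
  have hP := fun γ => isProb_fl (H := H) h0 h1' (hm γ)
  have hPP := isProb_prodP hP
  have hD0 : (0 : ℝ) < D := by exact_mod_cast hD
  have hsa : ∑ f ∈ H.star v, a f ≤ C := by
    calc ∑ f ∈ H.star v, a f ≤ ∑ f ∈ H.star v, C / D := sum_le_sum fun f _ => haC f
      _ = (H.star v).card * (C / D) := by rw [sum_const, nsmul_eq_mul]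
      _ ≤ D * (C / D) := by
        refine mul_le_mul_of_nonneg_right (by exact_mod_cast hdeg) (by positivity)
      _ = C := by field_simp
  have hmean := fex_Wval_near h0 h1 hδ0 hδ1 hm ha hsa γ₀ hS
  have hrob : ∀ ω, (prodP fun γ => H.fl θ (m γ)) ω ≠ 0 → (fun γ => H.rob (ω γ)) = ω := fun ω hω =>
    funext fun γ => rob_of_fl (ne_zero_of_prodP hω γ)
  have hW : fex (prodP fun γ => H.fl θ (m γ)) (fun ω => H.Wval v a γ₀ fun γ => H.rob (ω γ)) =
      fex (prodP fun γ => H.fl θ (m γ)) (H.Wval v a γ₀) :=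
    fex_congr fun ω hω => by rw [hrob ω hω]
  have hupd : ∀ (ω : Γ → Finset (E × Bool)) γ x, (fun γ' => H.rob (Function.update ω γ x γ')) =
      Function.update (fun γ' => H.rob (ω γ')) γ (H.rob x) := by
    intro ω γ x; funext γ'
    by_cases hg : γ' = γ
    · subst hg; simp
    · rw [Function.update_of_ne hg, Function.update_of_ne hg]
  have key := concentration hP
    (fun γ x => some γ = γ₀ ∨ ∀ f ∈ H.star v, a f ≠ 0 → f ∉ hits (H.rob x))
    (fun γ => if some γ ≠ γ₀ then
      θ * ∑ f ∈ (H.star v).filter (fun f => a f ≠ 0), H.marg (m γ) f else 0)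
    (c := 2 * (C / D)) (t := t * D) (q := D) (ξ := ζ) (by positivity) ?_ (by positivity) ?_ ?_
    (fun ω => H.Wval v a γ₀ fun γ => H.rob (ω γ)) ?_ ?_
  · refine le_trans (fpr_mono hPP.1 fun ω hω hw => ?_) (key.trans (le_of_eq ?_))
    · rw [hW, hrob ω hω]
      have h5 := abs_sub_abs_le_abs_sub (H.Wval v a γ₀ ω - (1 - θ) * ∑ f ∈ H.star v, a f)
        (fex (prodP fun γ => H.fl θ (m γ)) (H.Wval v a γ₀) - (1 - θ) * ∑ f ∈ H.star v, a f)
      rw [sub_sub_sub_cancel_right] at h5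
      linarith
    · congr 2
      field_simp
      ring
  · intro γ
    split_ifs with hg
    · calc fpr (H.fl θ (m γ)) (fun x => ¬ (some γ = γ₀ ∨ ∀ f ∈ H.star v, a f ≠ 0 → f ∉ hits (H.rob x)))
          ≤ fpr (H.fl θ (m γ)) (fun x => ∃ f ∈ (H.star v).filter (fun f => a f ≠ 0), f ∈ hits x) := by
            refine fpr_mono (hP γ).1 fun x hx hn => ?_
            push Not at hn
            obtain ⟨_, f, hf, haf, hfx⟩ := hn
            rw [rob_of_fl hx] at hfx
            exact ⟨f, mem_filter.2 ⟨hf, haf⟩, hfx⟩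
        _ ≤ ∑ f ∈ (H.star v).filter (fun f => a f ≠ 0), fpr (H.fl θ (m γ)) (fun x => f ∈ hits x) :=
            fpr_exists_le (hP γ).1 _ _
        _ = _ := by
            rw [mul_sum]
            exact sum_congr rfl fun f _ => fpr_mem_hits h0 h1' (hm γ) f
    · have hg' : some γ = γ₀ := not_not.1 hg
      simp [fpr, fex, hg']
  · calc t * D * (2 * (C / D)) = t * (2 * C) := by field_simp
      _ ≤ 1 := htC
  · rw [← sum_filter, ← mul_sum, sum_comm]
    calc θ * ∑ f ∈ (H.star v).filter (fun f => a f ≠ 0),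
          ∑ γ ∈ univ.filter (fun γ => some γ ≠ γ₀), H.marg (m γ) f
        ≤ θ * ∑ f ∈ (H.star v).filter (fun f => a f ≠ 0), 2 := by
          refine mul_le_mul_of_nonneg_left (sum_le_sum fun f hf => ?_) h0
          have h3 := abs_le.1 (hS f (mem_filter.1 hf).1 (mem_filter.1 hf).2)
          linarith
      _ = θ * 2 * ((H.star v).filter (fun f => a f ≠ 0)).card := by
          rw [sum_const, nsmul_eq_mul]; ring
      _ ≤ 1 * D := by
          refine mul_le_mul (by linarith) ?_ (by positivity) (by norm_num)
          exact_mod_cast (card_filter_le _ _).trans hdeg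
      _ = D := one_mul _
  · intro γ ω x y
    simp only [hupd]
    exact Wval_update_le (by positivity) ha haC γ₀ _ γ (isM_hits_rob x) (isM_hits_rob y)
  · intro γ ω x y hx hy
    simp only [hupd]
    unfold Wval
    refine sum_congr rfl fun f hf => ?_
    by_cases haf : a f = 0
    · simp [haf]
    · have := hitBy_update (ω := fun γ' => H.rob (ω γ')) (γ₀ := γ₀) (γ := γ) (f := f)
        (x := H.rob x) (y := H.rob y) (hx.imp id fun h => h f hf haf) (hy.imp id fun h => h f hf haf)
      simp only [this]

end
end Multi

namespace Multi
variable {V E : Type*} [Fintype V] [DecidableEq V] [Fintype E] [DecidableEq E] {H : Multi V E}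

section
variable {Γ : Type*} [Fintype Γ] [DecidableEq Γ]

/-- The pairs of an edge and a colour in which it is flagged. -/
def allHits (ω : Γ → Finset (E × Bool)) : Finset (E × Γ) := univ.filter fun p => p.1 ∈ hits (ω p.2)

theorem mem_allHits {ω : Γ → Finset (E × Bool)} {p : E × Γ} :
    p ∈ allHits ω ↔ p.1 ∈ hits (ω p.2) := by simp [allHits]

theorem fpr_subset_allHits_le {θ : ℝ} (h0 : 0 ≤ θ) (h1 : θ ≤ 1) {m : Γ → E → ℝ}
    (hm : ∀ γ e, 0 ≤ m γ e) (T : Finset (E × Γ)) :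
    fpr (prodP fun γ => H.fl θ (m γ)) (fun ω => T ⊆ allHits ω) ≤ ∏ p ∈ T, m p.2 p.1 := by
  have e1 : fpr (prodP fun γ => H.fl θ (m γ)) (fun ω => T ⊆ allHits ω) =
      fex (prodP fun γ => H.fl θ (m γ)) (fun ω => ∏ γ,
        if univ.filter (fun e => (e, γ) ∈ T) ⊆ hits (ω γ) then (1 : ℝ) else 0) := by
    unfold fpr
    congr 1; funext ω
    by_cases h : T ⊆ allHits ω
    · rw [if_pos h, prod_eq_one]
      intro γ _
      rw [if_pos]
      intro e he
      exact mem_allHits.1 (h (mem_filter.1 he).2)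
    · rw [if_neg h]
      symm
      obtain ⟨p, hp, hp2⟩ := not_subset.1 h
      refine prod_eq_zero (mem_univ p.2) (if_neg fun h2 => hp2 (mem_allHits.2 (h2 ?_)))
      simpa using hp
  rw [e1, fex_prod (fun γ M => if univ.filter (fun e => (e, γ) ∈ T) ⊆ hits M then (1 : ℝ) else 0)]
  have e2 : ∏ p ∈ T, m p.2 p.1 = ∏ γ, ∏ e ∈ univ.filter (fun e => (e, γ) ∈ T), m γ e := by
    simp only [prod_filter]
    rw [← Fintype.prod_prod_type_right' (fun e γ => if (e, γ) ∈ T then m γ e else 1),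
      ← prod_filter]
    congr 1
    ext p; simp
  rw [e2]
  refine prod_le_prod (fun γ _ => ?_) fun γ _ => ?_
  · exact sum_nonneg fun M _ => mul_nonneg ((isProb_fl h0 h1 (hm γ)).1 M) (by dsimp only; split_ifs <;> norm_num)
  · have := fpr_subset_hits_le (H := H) h0 h1 (hm γ) (univ.filter fun e => (e, γ) ∈ T)
    unfold fpr at this
    refine le_trans (le_of_eq ?_) this
    congr 1; funext M
    by_cases h : univ.filter (fun e => (e, γ) ∈ T) ⊆ hits M <;> simp only [h, if_true, if_false]

/-- The sets `T i`, for `i` in `A`, are pairwise disjoint. -/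
def DisjFam {ι α : Type*} (T : ι → Finset α) (A : Finset ι) : Prop :=
  ∀ i ∈ A, ∀ j ∈ A, i ≠ j → Disjoint (T i) (T j)

theorem fpr_disjoint_witnesses_le {ι : Type*} [DecidableEq ι] {θ : ℝ} (h0 : 0 ≤ θ) (h1 : θ ≤ 1)
    {m : Γ → E → ℝ} (hm : ∀ γ e, 0 ≤ m γ e) (W : Finset ι) (T : ι → Finset (E × Γ)) {μ : ℝ}
    (hμ : ∑ i ∈ W, ∏ p ∈ T i, m p.2 p.1 ≤ μ) (n : ℕ) :
    fpr (prodP fun γ => H.fl θ (m γ)) (fun ω => ∃ A ⊆ W, A.card = n ∧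
      DisjFam T A ∧ ∀ i ∈ A, T i ⊆ allHits ω) ≤
      (1 / 2) ^ n * Real.exp (2 * μ) := by
  have hPP := isProb_prodP fun γ => isProb_fl (H := H) h0 h1 (hm γ)
  have hpos : ∀ i, 0 ≤ ∏ p ∈ T i, m p.2 p.1 := fun i => prod_nonneg fun p _ => hm _ _
  set 𝒜 := W.powerset.filter fun A => A.card = n ∧ DisjFam T A with h𝒜
  calc _ ≤ fpr (prodP fun γ => H.fl θ (m γ)) (fun ω => ∃ A ∈ 𝒜, A.biUnion T ⊆ allHits ω) := by
        refine fpr_mono hPP.1 fun ω _ => ?_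
        rintro ⟨A, hA, hn, hd, hs⟩
        exact ⟨A, mem_filter.2 ⟨mem_powerset.2 hA, hn, hd⟩, biUnion_subset.2 hs⟩
    _ ≤ ∑ A ∈ 𝒜, fpr (prodP fun γ => H.fl θ (m γ)) (fun ω => A.biUnion T ⊆ allHits ω) :=
        fpr_exists_le hPP.1 _ _
    _ ≤ ∑ A ∈ 𝒜, (1 / 2) ^ n * ∏ i ∈ A, (2 * ∏ p ∈ T i, m p.2 p.1) := by
        refine sum_le_sum fun A hA => (fpr_subset_allHits_le h0 h1 hm _).trans (le_of_eq ?_)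
        obtain ⟨_, hn, hd⟩ := mem_filter.1 hA
        rw [prod_biUnion fun i hi j hj hij => hd i hi j hj hij, prod_mul_distrib, prod_const, hn,
          ← mul_assoc, ← mul_pow]
        norm_num
    _ ≤ ∑ A ∈ W.powerset, (1 / 2) ^ n * ∏ i ∈ A, (2 * ∏ p ∈ T i, m p.2 p.1) :=
        sum_le_sum_of_subset_of_nonneg (filter_subset _ _) fun A _ _ =>
          mul_nonneg (by positivity) (prod_nonneg fun i _ => by have := hpos i; positivity)
    _ = (1 / 2) ^ n * ∏ i ∈ W, (1 + 2 * ∏ p ∈ T i, m p.2 p.1) := by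
        rw [← mul_sum, prod_one_add]
    _ ≤ (1 / 2) ^ n * Real.exp (2 * μ) := by
        refine mul_le_mul_of_nonneg_left ?_ (by positivity)
        refine le_trans (prod_le_prod (fun i _ => by have := hpos i; positivity)
          (g := fun i => Real.exp (2 * ∏ p ∈ T i, m p.2 p.1)) fun i _ => ?_) ?_
        · rw [add_comm]; exact Real.add_one_le_exp _
        · rw [← Real.exp_sum, ← mul_sum]
          exact Real.exp_le_exp.2 (by linarith)

/-- The pair `p` conflicts with an edge that has been coloured. -/
def blocked (conf : E × Γ → E × Γ → Prop) (col : E → Option Γ) (p : E × Γ) : Prop :=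
  ∃ e γ, col e = some γ ∧ conf p (e, γ)

/-- The edge `f` is flagged in a colour that conflicts with an edge that has been coloured,
or with another flagged pair. -/
def conflicted (conf : E × Γ → E × Γ → Prop) (col : E → Option Γ) (ω : Γ → Finset (E × Bool))
    (f : E) : Prop :=
  ∃ γ, f ∈ hits (ω γ) ∧ (blocked conf col (f, γ) ∨ ∃ q ∈ allHits ω, conf (f, γ) q)

/-- The items of a witness of a conflict. -/
def wit (i : (E × Γ) × Option (E × Γ)) : Finset (E × Γ) :=
  match i.2 with
  | none => {i.1}
  | some q => {i.1, q}

/-- The indices of possible witnesses of conflicts at `v`. -/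
def wits (H : Multi V E) (conf : E × Γ → E × Γ → Prop) (col : E → Option Γ) (v : V) :
    Finset ((E × Γ) × Option (E × Γ)) :=
  univ.filter fun i => i.1.1 ∈ H.star v ∧
    match i.2 with
    | none => blocked conf col i.1
    | some q => conf i.1 q

theorem card_wit_le (i : (E × Γ) × Option (E × Γ)) : (wit i).card ≤ 2 := by
  obtain ⟨p, _ | q⟩ := i
  · simp [wit]
  · exact card_le_two

theorem card_star_inter_le {F : Finset E} (h : H.IsM F) (v : V) :
    ((H.star v).filter fun f => f ∈ F).card ≤ 1 := by
  rw [card_le_one]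
  intro e he f hf
  rw [mem_filter, mem_star] at he hf
  exact h e he.2 f hf.2 v he.1 hf.1

theorem card_conflicted_le (conf : E × Γ → E × Γ → Prop) (col : E → Option Γ) (v : V)
    {ω : Γ → Finset (E × Bool)} (hω : ∀ γ, H.IsM (hits (ω γ))) {n w : ℕ}
    (hw : ∀ q, (univ.filter fun γ => ∃ f, conf (f, γ) q).card ≤ w)
    (hn : ¬ ∃ A ⊆ H.wits conf col v, A.card = n ∧
      DisjFam wit A ∧ ∀ i ∈ A, wit i ⊆ allHits ω) :
    ((H.star v).filter (conflicted conf col ω)).card ≤ 2 * n * (1 + w) := by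
  set 𝒜 := (H.wits conf col v).powerset.filter fun A =>
      DisjFam wit A ∧ ∀ i ∈ A, wit i ⊆ allHits ω with h𝒜
  obtain ⟨A, hA, hmax⟩ := exists_max_image 𝒜 card ⟨∅, by simp [h𝒜, DisjFam]⟩
  have hA' := mem_filter.1 hA
  have hAW := mem_powerset.1 hA'.1
  have hAn : A.card < n := by
    by_contra hcon
    obtain ⟨A', hA's, hA'c⟩ := exists_subset_card_eq (not_lt.1 hcon)
    exact hn ⟨A', hA's.trans hAW, hA'c, fun i hi j hj => hA'.2.1 i (hA's hi) j (hA's hj),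
      fun i hi => hA'.2.2 i (hA's hi)⟩
  have hmeet : ∀ i ∈ H.wits conf col v, wit i ⊆ allHits ω → (wit i).Nonempty →
      ∃ p ∈ wit i, p ∈ A.biUnion wit := by
    intro i hi his hne
    by_contra hcon
    push Not at hcon
    have hdis : ∀ j ∈ A, Disjoint (wit i) (wit j) := fun j hj =>
      disjoint_left.2 fun p hp hp2 => hcon p hp (mem_biUnion.2 ⟨j, hj, hp2⟩)
    have hiA : i ∉ A := by
      intro hiA
      obtain ⟨p, hp⟩ := hne
      exact hcon p hp (mem_biUnion.2 ⟨i, hiA, hp⟩)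
    have hins : insert i A ∈ 𝒜 := by
      refine mem_filter.2 ⟨mem_powerset.2 (insert_subset hi hAW), ?_, ?_⟩
      · intro a ha b hb hab
        rcases mem_insert.1 ha with ha | ha <;> rcases mem_insert.1 hb with hb | hb
        · exact absurd (ha.trans hb.symm) hab
        · rw [ha]; exact hdis b hb
        · rw [hb]; exact (hdis a ha).symm
        · exact hA'.2.1 a ha b hb hab
      · intro a ha
        rcases mem_insert.1 ha with rfl | ha
        · exact his
        · exact hA'.2.2 a ha
    have := hmax _ hins
    rw [card_insert_of_notMem hiA] at this
    omega
  set U := A.biUnion wit with hU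
  have hUc : U.card ≤ 2 * n := by
    refine card_biUnion_le.trans ((sum_le_card_nsmul _ _ 2 fun i _ => card_wit_le i).trans ?_)
    rw [smul_eq_mul]; omega
  have hsub : (H.star v).filter (conflicted conf col ω) ⊆ U.biUnion fun q => insert q.1
      ((univ.filter fun γ => ∃ f, conf (f, γ) q).biUnion fun γ =>
        (H.star v).filter fun f => f ∈ hits (ω γ)) := by
    intro f hf
    obtain ⟨hfv, γ, hfγ, hor⟩ := mem_filter.1 hf
    have hfa : (f, γ) ∈ allHits ω := mem_allHits.2 hfγ
    rw [mem_biUnion]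
    rcases hor with hbl | ⟨q, hq, hc⟩
    · obtain ⟨p, hp, hpU⟩ := hmeet ((f, γ), none) (mem_filter.2 ⟨mem_univ _, hfv, hbl⟩)
        (by simpa [wit] using hfa) (by simp [wit])
      have hpe : p = (f, γ) := by simpa [wit] using hp
      subst hpe
      exact ⟨_, hpU, mem_insert_self _ _⟩
    · obtain ⟨p, hp, hpU⟩ := hmeet ((f, γ), some q) (mem_filter.2 ⟨mem_univ _, hfv, hc⟩)
        (by simp only [wit, insert_subset_iff, singleton_subset_iff]; exact ⟨hfa, hq⟩) (by simp [wit])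
      have hpe : p = (f, γ) ∨ p = q := by simpa [wit] using hp
      rcases hpe with rfl | rfl
      · exact ⟨_, hpU, mem_insert_self _ _⟩
      · exact ⟨_, hpU, mem_insert_of_mem (mem_biUnion.2 ⟨γ, mem_filter.2 ⟨mem_univ _, f, hc⟩,
          mem_filter.2 ⟨hfv, hfγ⟩⟩)⟩
  refine (card_le_card hsub).trans (card_biUnion_le.trans
    ((sum_le_card_nsmul _ _ (1 + w) fun q _ => ?_).trans ?_))
  · refine (card_insert_le _ _).trans ?_
    have := (card_biUnion_le (s := univ.filter fun γ => ∃ f, conf (f, γ) q)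
      (t := fun γ => (H.star v).filter fun f => f ∈ hits (ω γ))).trans
      (sum_le_card_nsmul _ _ 1 fun γ _ => card_star_inter_le (hω γ) v)
    rw [smul_eq_mul, mul_one] at this
    have := hw q
    omega
  · rw [smul_eq_mul]; exact Nat.mul_le_mul_right _ hUc

theorem sum_wits_le {C : ℝ} {B D : ℕ} (hC : 1 ≤ C) (hD : 0 < D) {m : Γ → E → ℝ}
    (hm : ∀ γ e, 0 ≤ m γ e) (hmC : ∀ γ e, m γ e ≤ C / D)
    (hcol : ∀ e, ((univ.filter fun γ => m γ e ≠ 0).card : ℝ) ≤ C * D)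
    (conf : E × Γ → E × Γ → Prop) (hirr : ∀ p, ¬ conf p p) (col : E → Option Γ) {v : V}
    (hdeg : (H.star v).card ≤ D)
    (hB1 : ∀ p, (univ.filter fun q => conf p q).card ≤ B)
    (hB2 : ∀ f, (univ.filter fun γ => blocked conf col (f, γ)).card ≤ B) :
    ∑ i ∈ H.wits conf col v, ∏ p ∈ wit i, m p.2 p.1 ≤ 2 * C ^ 3 * B := by
  have hD0 : (0 : ℝ) < D := by exact_mod_cast hD
  have hCD : 0 ≤ C / D := by positivity
  have hsγ : ∀ f, ∑ γ, m γ f ≤ C ^ 2 := by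
    intro f
    calc ∑ γ, m γ f = ∑ γ ∈ univ.filter (fun γ => m γ f ≠ 0), m γ f := (sum_filter_ne_zero _).symm
      _ ≤ (univ.filter fun γ => m γ f ≠ 0).card • (C / D) := sum_le_card_nsmul _ _ _ fun γ _ => hmC γ f
      _ ≤ C * D * (C / D) := by
        rw [nsmul_eq_mul]; exact mul_le_mul_of_nonneg_right (hcol f) hCD
      _ = C ^ 2 := by field_simp
  have hblk : ∀ f, ∑ γ ∈ univ.filter (fun γ => blocked conf col (f, γ)), m γ f ≤ B * (C / D) := by
    intro f
    refine (sum_le_card_nsmul _ _ (C / D) fun γ _ => hmC γ f).trans ?_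
    rw [nsmul_eq_mul]
    exact mul_le_mul_of_nonneg_right (by exact_mod_cast hB2 f) hCD
  have hcf : ∀ p, ∑ q ∈ univ.filter (fun q => conf p q), m q.2 q.1 ≤ B * (C / D) := by
    intro p
    refine (sum_le_card_nsmul _ _ (C / D) fun q _ => hmC _ _).trans ?_
    rw [nsmul_eq_mul]
    exact mul_le_mul_of_nonneg_right (by exact_mod_cast hB1 p) hCD
  have hstar : ∀ {x : ℝ}, 0 ≤ x → ∑ f ∈ H.star v, x ≤ D * x := by
    intro x hx
    rw [sum_const, nsmul_eq_mul]
    exact mul_le_mul_of_nonneg_right (by exact_mod_cast hdeg) hx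
  have e1 : ∑ i ∈ H.wits conf col v, ∏ p ∈ wit i, m p.2 p.1 =
      ∑ f ∈ H.star v, ∑ γ ∈ univ.filter (fun γ => blocked conf col (f, γ)), m γ f +
      ∑ f ∈ H.star v, ∑ γ, m γ f * ∑ q ∈ univ.filter (fun q => conf (f, γ) q), m q.2 q.1 := by
    unfold wits
    rw [sum_filter, Fintype.sum_prod_type, Fintype.sum_prod_type, ← sum_add_distrib, star, sum_filter]
    refine sum_congr rfl fun f _ => ?_
    by_cases hf : f ∈ H.star v
    · have hf' : H.inc f v := mem_star.1 hf
      rw [if_pos hf', sum_filter, ← sum_add_distrib]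
      refine sum_congr rfl fun γ _ => ?_
      rw [Fintype.sum_option, mul_sum, sum_filter]
      congr 1
      · by_cases hb : blocked conf col (f, γ) <;> simp [hf', hb, wit, mem_star]
      · refine sum_congr rfl fun q _ => ?_
        by_cases hb : conf (f, γ) q
        · have hne : (f, γ) ≠ q := by rintro rfl; exact hirr _ hb
          simp [hf', hb, wit, mem_star, prod_pair hne]
        · simp [hf', hb]
    · have hf' : ¬ H.inc f v := fun h => hf (mem_star.2 h)
      rw [if_neg hf']
      refine sum_eq_zero fun γ _ => sum_eq_zero fun o _ => ?_
      simp [mem_star, hf']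
  rw [e1]
  have h1 : ∑ f ∈ H.star v, ∑ γ ∈ univ.filter (fun γ => blocked conf col (f, γ)), m γ f ≤ B * C := by
    refine (sum_le_sum fun f _ => hblk f).trans ((hstar (by positivity)).trans (le_of_eq ?_))
    field_simp
  have h2 : ∑ f ∈ H.star v, ∑ γ, m γ f * ∑ q ∈ univ.filter (fun q => conf (f, γ) q), m q.2 q.1 ≤
      B * C ^ 3 := by
    have : ∀ f ∈ H.star v, ∑ γ, m γ f * ∑ q ∈ univ.filter (fun q => conf (f, γ) q), m q.2 q.1 ≤
        C ^ 2 * (B * (C / D)) := by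
      intro f _
      refine (sum_le_sum fun γ _ => mul_le_mul_of_nonneg_left (hcf (f, γ)) (hm γ f)).trans ?_
      rw [← sum_mul]
      exact mul_le_mul_of_nonneg_right (hsγ f) (by positivity)
    refine (sum_le_sum this).trans ((hstar (by positivity)).trans (le_of_eq ?_))
    field_simp
  have h3 : (B : ℝ) * C ≤ B * C ^ 3 := by
    refine mul_le_mul_of_nonneg_left ?_ (by positivity)
    exact le_self_pow₀ hC (by norm_num)
  linarith

theorem fpr_conflicted_le {θ C : ℝ} {B D w : ℕ} (h0 : 0 ≤ θ) (h1 : θ ≤ 1) (hC : 1 ≤ C) (hD : 0 < D)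
    {m : Γ → E → ℝ} (hm : ∀ γ e, 0 ≤ m γ e) (hmC : ∀ γ e, m γ e ≤ C / D)
    (hcol : ∀ e, ((univ.filter fun γ => m γ e ≠ 0).card : ℝ) ≤ C * D)
    (conf : E × Γ → E × Γ → Prop) (hirr : ∀ p, ¬ conf p p) (col : E → Option Γ) {v : V}
    (hdeg : (H.star v).card ≤ D)
    (hB1 : ∀ p, (univ.filter fun q => conf p q).card ≤ B)
    (hB2 : ∀ f, (univ.filter fun γ => blocked conf col (f, γ)).card ≤ B)
    (hw : ∀ q, (univ.filter fun γ => ∃ f, conf (f, γ) q).card ≤ w) (n : ℕ) :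
    fpr (prodP fun γ => H.fl θ (m γ)) (fun ω =>
      2 * n * (1 + w) < ((H.star v).filter (conflicted conf col ω)).card) ≤
      (1 / 2) ^ n * Real.exp (2 * (2 * C ^ 3 * B)) := by
  have hP := fun γ => isProb_fl (H := H) h0 h1 (hm γ)
  refine le_trans (fpr_mono (isProb_prodP hP).1 fun ω hω hlt => ?_) (fpr_disjoint_witnesses_le h0 h1 hm _ wit
    (sum_wits_le hC hD hm hmC hcol conf hirr col hdeg hB1 hB2) n)
  by_contra hcon
  exact absurd (card_conflicted_le conf col v (fun γ => isM_of_fl (ne_zero_of_prodP hω γ)) hw hcon)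
    (not_le.2 hlt)

end
end Multi

namespace Multi
variable {V E : Type*} [Fintype V] [DecidableEq V] [Fintype E] [DecidableEq E] {H : Multi V E}

theorem mem_verts_congr {F F' : Finset E} {u : V} (h : ∀ e ∈ H.star u, (e ∈ F ↔ e ∈ F')) :
    u ∈ H.verts F ↔ u ∈ H.verts F' := by
  rw [mem_verts, mem_verts]
  constructor
  · rintro ⟨e, he, hi⟩; exact ⟨e, (h e (mem_star.2 hi)).1 he, hi⟩
  · rintro ⟨e, he, hi⟩; exact ⟨e, (h e (mem_star.2 hi)).2 he, hi⟩

theorem ends_mem_ball_succ {k : ℕ} {v : V} {e : E} (he : e ∈ H.eball k v) :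
    H.s e ∈ H.ball (k + 1) v ∧ H.t e ∈ H.ball (k + 1) v := by
  obtain ⟨u, hu, hi⟩ := mem_eball.1 he
  have h1 := ball_subset_succ k v hu
  have h2 := ball_trans hu (other_mem_ball hi)
  rcases hi with rfl | rfl
  · refine ⟨h1, ?_⟩
    rwa [other_mem (inc_s e) (inc_t e) (H.ne e)] at h2
  · refine ⟨?_, h1⟩
    rwa [other_mem (inc_t e) (inc_s e) (H.ne e).symm] at h2

theorem star_subset_eball {k : ℕ} {u v : V} (hu : u ∈ H.ball k v) : H.star u ⊆ H.eball k v :=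
  fun _ he => mem_eball.2 ⟨u, hu, mem_star.1 he⟩

theorem del_verts_congr {F F' : Finset E} {l : E → ℝ} {k : ℕ} {v : V}
    (h : ∀ e ∈ H.eball (k + 1) v, (e ∈ F ↔ e ∈ F')) {f : E} (hf : f ∈ H.eball k v) :
    H.del (H.verts F) l f = H.del (H.verts F') l f := by
  obtain ⟨h1, h2⟩ := ends_mem_ball_succ hf
  simp only [del, mem_verts_congr fun e he => h e (star_subset_eball h1 he),
    mem_verts_congr fun e he => h e (star_subset_eball h2 he)]

theorem thin_congr_hits {θ : ℝ} {F F' : Finset E} {l : E → ℝ} {k : ℕ} {v : V}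
    (h : ∀ e ∈ H.eball (k + 1) v, (e ∈ F ↔ e ∈ F')) {f : E} (hf : f ∈ H.eball k v) :
    H.thin θ F l f = H.thin θ F' l f := del_verts_congr h hf

theorem free_iff_verts {F : Finset E} {u w : V} :
    H.free F {u, w} ↔ u ∉ H.verts F ∧ w ∉ H.verts F := by
  unfold free
  simp only [mem_verts, mem_insert, mem_singleton, inc]
  grind

/-- The weight of the edge `f` in the recursion at `v`, after the flagged edges are removed. -/
def wgt (H : Multi V E) (θ : ℝ) (l : E → ℝ) (v : V) (X : Finset V) (j : ℕ) (F : Finset E) (f : E) : ℝ :=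
  H.del X (H.del (H.verts F) l) f * H.Fk j (H.del (X ∪ {v}) (H.thin θ F l)) (H.other f v)

theorem wgt_nonneg {θ : ℝ} (h1 : θ ≤ 1) {l : E → ℝ} (hl : ∀ e, 0 ≤ l e) (v : V) (X : Finset V)
    (j : ℕ) (F : Finset E) (f : E) : 0 ≤ H.wgt θ l v X j F f :=
  mul_nonneg (del_nonneg (del_nonneg hl _) _ f)
    (Fk_pos_le (del_nonneg (thin_nonneg h1 hl F) _) _ _).1.le

theorem wgt_le {θ : ℝ} (h1 : θ ≤ 1) {l : E → ℝ} (hl : ∀ e, 0 ≤ l e) (v : V) (X : Finset V)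
    (j : ℕ) (F : Finset E) (f : E) : H.wgt θ l v X j F f ≤ l f :=
  (mul_le_of_le_one_right (del_nonneg (del_nonneg hl _) _ f)
    (Fk_pos_le (del_nonneg (thin_nonneg h1 hl F) _) _ _).2).trans
    ((del_le (del_nonneg hl _) _ f).trans (del_le hl _ f))

theorem wgt_congr {θ : ℝ} {l : E → ℝ} {v : V} {X : Finset V} {j k : ℕ} (hj : j ≤ k)
    {F F' : Finset E} (h : ∀ e ∈ H.eball (k + 2) v, (e ∈ F ↔ e ∈ F')) {f : E} (hf : f ∈ H.star v) :
    H.wgt θ l v X j F f = H.wgt θ l v X j F' f := by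
  have hf0 : f ∈ H.eball (k + 1) v := star_subset_eball (self_mem_ball _ v) hf
  unfold wgt
  congr 1
  · have := del_verts_congr (l := l) h hf0
    simp only [del] at this ⊢
    rw [this]
  · refine Fk_congr j fun e he => ?_
    have := thin_congr_hits (θ := θ) (l := l) h
      (eball_mono (other_mem_ball (mem_star.1 hf)) (by omega : 1 + j ≤ k + 1) he)
    simp only [del, this]

section
variable {Γ : Type*} [Fintype Γ] [DecidableEq Γ]

theorem Xval_congr {θ : ℝ} {k : ℕ} {l : Γ → E → ℝ} {e : E} {ω ω' : Γ → Finset (E × Bool)}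
    (h : ∀ γ, ∀ f ∈ H.eball (k + 2) (H.s e), (f ∈ hits (ω γ) ↔ f ∈ hits (ω' γ))) :
    H.Xval θ k l e ω = H.Xval θ k l e ω' := by
  unfold Xval
  refine sum_congr rfl fun γ _ => ?_
  have h1 : H.free (hits (ω γ)) {H.s e, H.t e} ↔ H.free (hits (ω' γ)) {H.s e, H.t e} := by
    rw [free_iff_verts, free_iff_verts,
      mem_verts_congr fun f hf => h γ f (star_subset_eball (self_mem_ball _ _) hf),
      mem_verts_congr fun f hf => h γ f (star_subset_eball (ball_mono (by omega) _ (t_mem_ball e)) hf)]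
  rw [Kk_congr (l' := H.thin θ (hits (ω' γ)) (l γ)) (t_mem_ball e) fun f hf =>
    thin_congr_hits (h γ) hf]
  simp only [h1]

theorem Wval_congr {v : V} {a a' : E → ℝ} {γ₀ : Option Γ} {ω ω' : Γ → Finset (E × Bool)}
    (ha : ∀ f ∈ H.star v, a f = a' f)
    (h : ∀ γ, ∀ f ∈ H.star v, (f ∈ hits (ω γ) ↔ f ∈ hits (ω' γ))) :
    H.Wval v a γ₀ ω = H.Wval v a' γ₀ ω' := by
  unfold Wval
  refine sum_congr rfl fun f hf => ?_
  have : hitBy γ₀ ω f ↔ hitBy γ₀ ω' f := by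
    unfold hitBy
    simp only [h _ f hf]
  rw [ha f hf]
  simp only [this]

theorem fpr_le_of_update {A : Type*} [Fintype A] {P : Γ → A → ℝ} (hP : ∀ γ, IsProb (P γ)) (γ : Γ)
    (B : A → (Γ → A) → Prop) (hB : ∀ x ω, B x (Function.update ω γ x) ↔ B x ω) {p : ℝ}
    (hp : ∀ x, P γ x ≠ 0 → fpr (prodP P) (B x) ≤ p) :
    fpr (prodP P) (fun ω => B (ω γ) ω) ≤ p := by
  unfold fpr
  rw [fex_update hP γ]
  calc fex (prodP P) (fun ω => fex (P γ) fun x =>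
        if B (Function.update ω γ x γ) (Function.update ω γ x) then (1 : ℝ) else 0)
      = fex (P γ) (fun x => fpr (prodP P) (B x)) := by
        unfold fex fpr fex
        simp only [mul_sum, Function.update_self, hB]
        rw [sum_comm]
        refine sum_congr rfl fun x _ => sum_congr rfl fun ω _ => ?_
        ring
    _ ≤ fex (P γ) (fun _ => p) := fex_mono (hP γ).1 hp
    _ = p := fex_const (hP γ) p

theorem Wval_update_self (v : V) (a : E → ℝ) (γ : Γ) (ω : Γ → Finset (E × Bool))
    (x : Finset (E × Bool)) : H.Wval v a (some γ) (Function.update ω γ x) = H.Wval v a (some γ) ω := by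
  unfold Wval
  refine sum_congr rfl fun f _ => ?_
  have := hitBy_update (ω := ω) (γ₀ := some γ) (γ := γ) (x := x) (y := ω γ) (f := f) (Or.inl rfl) (Or.inl rfl)
  rw [Function.update_eq_self] at this
  simp only [this]

theorem fpr_wgt_le {θ δ C ζ t : ℝ} {D : ℕ} (h0 : 0 ≤ θ) (h1 : θ ≤ 1 / 2) (hδ0 : 0 ≤ δ)
    (hδ1 : δ ≤ 1) (hC : 1 ≤ C) (hD : 0 < D) {l m : Γ → E → ℝ} (hl : ∀ γ e, 0 ≤ l γ e)
    (hlC : ∀ γ e, l γ e ≤ C / D) (hm : ∀ γ e, 0 ≤ m γ e) {v : V} (hdeg : (H.star v).card ≤ D) (γ : Γ)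
    (hS : ∀ f ∈ H.star v, l γ f ≠ 0 →
      |∑ γ' ∈ univ.filter (fun γ' => some γ' ≠ some γ), H.marg (m γ') f - 1| ≤ δ)
    (X : Finset V) (j : ℕ) (ht : 0 ≤ t) (htC : t * (2 * C) ≤ 1) :
    fpr (prodP fun γ => H.fl θ (m γ)) (fun ω => C * (θ * δ + 4 * θ ^ 2) + ζ ≤
      |H.Wval v (H.wgt θ (l γ) v X j (hits (ω γ))) (some γ) ω -
        (1 - θ) * ∑ f ∈ H.star v, H.wgt θ (l γ) v X j (hits (ω γ)) f|) ≤
      2 * Real.exp (-(t * ζ - t ^ 2 * (4 * C ^ 2)) * D) := by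
  have h1' : θ ≤ 1 := by linarith
  refine fpr_le_of_update (P := fun γ => H.fl θ (m γ)) (fun γ => isProb_fl h0 h1' (hm γ)) γ
    (fun x ω => C * (θ * δ + 4 * θ ^ 2) + ζ ≤ |H.Wval v (H.wgt θ (l γ) v X j (hits x)) (some γ) ω -
        (1 - θ) * ∑ f ∈ H.star v, H.wgt θ (l γ) v X j (hits x) f|) ?_ ?_
  · intro x ω
    simp only [Wval_update_self]
  · intro x _
    refine fpr_Wval_le h0 h1 hδ0 hδ1 hC hD hm hdeg (wgt_nonneg h1' (hl γ) v X j _)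
      (fun f => (wgt_le h1' (hl γ) v X j _ f).trans (hlC γ f)) _ (fun f hf hne => hS f hf ?_) ht htC
    intro hz
    have h2 := wgt_le (H := H) h1' (hl γ) v X j (hits x) f
    rw [hz] at h2
    exact hne (le_antisymm h2 (wgt_nonneg h1' (hl γ) v X j _ f))

end
end Multi

namespace Multi
variable {V E : Type*} [Fintype V] [DecidableEq V] [Fintype E] [DecidableEq E] {H : Multi V E}
variable {Γ : Type*} [Fintype Γ] [DecidableEq Γ]

/-- A multigraph of maximum degree at most `D`, with a sparse symmetric relation of conflict
between pairs of an edge and a colour. -/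
structure System (H : Multi V E) (D B w : ℕ) (conf : E × Γ → E × Γ → Prop) : Prop where
  deg : ∀ v, (H.star v).card ≤ D
  symm : ∀ p q, conf p q → conf q p
  irr : ∀ e γ γ', ¬ conf (e, γ) (e, γ')
  items : ∀ p, (univ.filter fun q => conf p q).card ≤ B
  nbrs : ∀ f, (univ.filter fun e => ∃ γ γ', conf (f, γ) (e, γ')).card ≤ B
  blk : ∀ (col : E → Option Γ) f, (univ.filter fun γ => blocked conf col (f, γ)).card ≤ B
  win : ∀ q, (univ.filter fun γ => ∃ f, conf (f, γ) q).card ≤ w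

/-- The activities `l` are suitable for colouring the edges left uncoloured by `col`. -/
structure State (H : Multi V E) (D : ℕ) (C δ : ℝ) (col : E → Option Γ) (l : Γ → E → ℝ) : Prop where
  nonneg : ∀ γ e, 0 ≤ l γ e
  le : ∀ γ e, l γ e ≤ C / D
  cols : ∀ e, ((univ.filter fun γ => l γ e ≠ 0).card : ℝ) ≤ C * D
  zero : ∀ γ e, col e ≠ none → l γ e = 0
  S : ∀ e, col e = none → |H.S l e - 1| ≤ δ

theorem State.bdd {D B w : ℕ} {conf : E × Γ → E × Γ → Prop} {C δ : ℝ} {col : E → Option Γ}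
    {l : Γ → E → ℝ} (hD : 0 < D) (hC : 0 ≤ C) (hsys : H.System D B w conf) (h : H.State D C δ col l)
    (γ : Γ) : H.bdd C (l γ) := by
  intro v
  have hD0 : (0 : ℝ) < D := by exact_mod_cast hD
  calc ∑ f ∈ H.star v, l γ f ≤ ∑ f ∈ H.star v, C / D := sum_le_sum fun f _ => h.le γ f
    _ = (H.star v).card * (C / D) := by rw [sum_const, nsmul_eq_mul]
    _ ≤ D * (C / D) :=
      mul_le_mul_of_nonneg_right (by exact_mod_cast hsys.deg v) (by positivity)
    _ = C := by field_simp

/-- The expected number of available colours at an edge at `v` is far from its mean. -/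
def badS (H : Multi V E) (θ ζ : ℝ) (k : ℕ) (col : E → Option Γ) (l : Γ → E → ℝ) (v : V)
    (ω : Γ → Finset (E × Bool)) : Prop :=
  ∃ e ∈ (H.star v).filter (fun e => H.s e = v ∧ col e = none), ζ ≤ |H.Xval θ k l e ω - H.S l e|

/-- The index set of the recursions at `v`. -/
def recs (H : Multi V E) (k : ℕ) (l : Γ → E → ℝ) (v : V) : Finset (Γ × Finset V × ℕ) :=
  (univ.filter fun γ => ∃ f ∈ H.star v, l γ f ≠ 0) ×ˢ
    (((H.ball (2 * (k + 1)) v).powerset.filter fun X => X.card ≤ k + 1) ×ˢ range (k + 1))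

/-- Some recursion at `v` is perturbed too much. -/
def badR (H : Multi V E) (θ ξ : ℝ) (k : ℕ) (l : Γ → E → ℝ) (v : V)
    (ω : Γ → Finset (E × Bool)) : Prop :=
  ∃ i ∈ H.recs k l v, ξ ≤
    |H.Wval v (H.wgt θ (l i.1) v i.2.1 i.2.2 (hits (ω i.1))) (some i.1) ω -
        (1 - θ) * ∑ f ∈ H.star v, H.wgt θ (l i.1) v i.2.1 i.2.2 (hits (ω i.1)) f|

/-- The number of edges at `v` that remain is far from its mean. -/
def badD (H : Multi V E) (θ ξ : ℝ) (D : ℕ) (col : E → Option Γ) (v : V)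
    (ω : Γ → Finset (E × Bool)) : Prop :=
  ξ ≤ |H.Wval v (fun f => if col f = none then 1 / (D : ℝ) else 0) none ω -
        (1 - θ) * ∑ f ∈ H.star v, (if col f = none then 1 / (D : ℝ) else 0)|

/-- There are too many conflicts at `v`. -/
def badC (H : Multi V E) (N : ℕ) (conf : E × Γ → E × Γ → Prop) (col : E → Option Γ) (v : V)
    (ω : Γ → Finset (E × Bool)) : Prop :=
  N < ((H.star v).filter (conflicted conf col ω)).card

/-- The edges that matter for the bad events at `v`. -/
def zone (H : Multi V E) (conf : E × Γ → E × Γ → Prop) (r : ℕ) (v : V) : Finset E :=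
  H.eball r v ∪ (H.star v).biUnion fun f => univ.filter fun e => ∃ γ γ', conf (f, γ) (e, γ')

theorem badS_congr {θ ζ : ℝ} {k : ℕ} {col : E → Option Γ} {l : Γ → E → ℝ} {v : V}
    {ω ω' : Γ → Finset (E × Bool)}
    (h : ∀ γ, ∀ f ∈ H.eball (k + 2) v, (f ∈ hits (ω γ) ↔ f ∈ hits (ω' γ))) :
    H.badS θ ζ k col l v ω ↔ H.badS θ ζ k col l v ω' := by
  unfold badS
  refine exists_congr fun e => and_congr_right fun he => ?_
  have hs : H.s e = v := (mem_filter.1 he).2.1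
  rw [Xval_congr (by rw [hs]; exact h)]

theorem badR_congr {θ ξ : ℝ} {k : ℕ} {l : Γ → E → ℝ} {v : V} {ω ω' : Γ → Finset (E × Bool)}
    (h : ∀ γ, ∀ f ∈ H.eball (k + 2) v, (f ∈ hits (ω γ) ↔ f ∈ hits (ω' γ))) :
    H.badR θ ξ k l v ω ↔ H.badR θ ξ k l v ω' := by
  unfold badR
  refine exists_congr fun i => and_congr_right fun hi => ?_
  have hj : i.2.2 ≤ k := by
    have := (mem_product.1 (mem_product.1 hi).2).2
    rw [mem_range] at this; omega
  have hw := fun f hf => wgt_congr (θ := θ) (l := l i.1) (X := i.2.1) hj (h i.1) (f := f) hf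
  rw [Wval_congr hw fun γ f hf => h γ f (star_subset_eball (self_mem_ball _ v) hf), sum_congr rfl hw]

theorem badD_congr {θ ξ : ℝ} {k D : ℕ} {col : E → Option Γ} {v : V} {ω ω' : Γ → Finset (E × Bool)}
    (h : ∀ γ, ∀ f ∈ H.eball (k + 2) v, (f ∈ hits (ω γ) ↔ f ∈ hits (ω' γ))) :
    H.badD θ ξ D col v ω ↔ H.badD θ ξ D col v ω' := by
  unfold badD
  rw [Wval_congr (fun f _ => rfl) fun γ f hf => h γ f (star_subset_eball (self_mem_ball _ v) hf)]

theorem badC_congr {N r : ℕ} {conf : E × Γ → E × Γ → Prop} {col : E → Option Γ} {v : V}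
    {ω ω' : Γ → Finset (E × Bool)}
    (h : ∀ γ, ∀ f ∈ H.zone conf r v, (f ∈ hits (ω γ) ↔ f ∈ hits (ω' γ))) :
    H.badC N conf col v ω ↔ H.badC N conf col v ω' := by
  unfold badC
  have : ∀ f ∈ H.star v, (conflicted conf col ω f ↔ conflicted conf col ω' f) := by
    intro f hf
    unfold conflicted
    refine exists_congr fun γ => ?_
    rw [h γ f (mem_union_left _ (star_subset_eball (self_mem_ball _ v) hf))]
    refine and_congr_right fun _ => or_congr_right (exists_congr fun q => ?_)
    constructor
    · rintro ⟨hq, hc⟩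
      refine ⟨mem_allHits.2 ((h q.2 q.1 ?_).1 (mem_allHits.1 hq)), hc⟩
      exact mem_union_right _ (mem_biUnion.2 ⟨f, hf, mem_filter.2 ⟨mem_univ _, γ, q.2, hc⟩⟩)
    · rintro ⟨hq, hc⟩
      refine ⟨mem_allHits.2 ((h q.2 q.1 ?_).2 (mem_allHits.1 hq)), hc⟩
      exact mem_union_right _ (mem_biUnion.2 ⟨f, hf, mem_filter.2 ⟨mem_univ _, γ, q.2, hc⟩⟩)
  rw [filter_congr this]

theorem card_small_subsets_le (s : Finset V) (q : ℕ) :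
    (s.powerset.filter fun X => X.card ≤ q).card ≤ (q + 1) * (s.card + 1) ^ q := by
  have hsub : (s.powerset.filter fun X => X.card ≤ q) ⊆ (range (q + 1)).biUnion fun i => powersetCard i s := by
    intro X hX
    obtain ⟨h1, h2⟩ := mem_filter.1 hX
    exact mem_biUnion.2 ⟨X.card, mem_range.2 (by omega), mem_powersetCard.2 ⟨mem_powerset.1 h1, rfl⟩⟩
  refine (card_le_card hsub).trans (card_biUnion_le.trans ((sum_le_card_nsmul _ _ ((s.card + 1) ^ q) ?_).trans ?_))
  · intro i hi
    rw [card_powersetCard]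
    refine (Nat.choose_le_pow _ _).trans ((Nat.pow_le_pow_left (Nat.le_succ _) _).trans ?_)
    exact Nat.pow_le_pow_right (by omega) (by have := mem_range.1 hi; omega)
  · rw [card_range, smul_eq_mul]

theorem card_recs_le {D B w : ℕ} {conf : E × Γ → E × Γ → Prop} {C δ : ℝ} {col : E → Option Γ}
    {l : Γ → E → ℝ} (hsys : H.System D B w conf) (h : H.State D C δ col l) (hC : 0 ≤ C) {k : ℕ}
    (hCD : C ≤ D + 1) (hkD : k + 1 ≤ D) (v : V) :
    ((H.recs k l v).card : ℝ) ≤ (D + 1 : ℝ) ^ (5 + (2 * (k + 1) + 1) * (k + 1)) := by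
  have hy : (2 : ℝ) ≤ D + 1 := by
    have : (1 : ℝ) ≤ D := by exact_mod_cast (by omega : 1 ≤ D)
    linarith
  have h1 : ((univ.filter fun γ => ∃ f ∈ H.star v, l γ f ≠ 0).card : ℝ) ≤ (D + 1 : ℝ) ^ 3 := by
    have hsub : (univ.filter fun γ => ∃ f ∈ H.star v, l γ f ≠ 0) ⊆
        (H.star v).biUnion fun f => univ.filter fun γ => l γ f ≠ 0 := by
      intro γ hγ
      obtain ⟨_, f, hf, hne⟩ := mem_filter.1 hγ
      exact mem_biUnion.2 ⟨f, hf, mem_filter.2 ⟨mem_univ _, hne⟩⟩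
    have h2 : ((univ.filter fun γ => ∃ f ∈ H.star v, l γ f ≠ 0).card : ℝ) ≤
        ∑ f ∈ H.star v, ((univ.filter fun γ => l γ f ≠ 0).card : ℝ) := by
      exact_mod_cast (card_le_card hsub).trans card_biUnion_le
    refine h2.trans ((sum_le_sum fun f _ => h.cols f).trans ?_)
    rw [sum_const, nsmul_eq_mul]
    have h3 : ((H.star v).card : ℝ) ≤ D := by exact_mod_cast hsys.deg v
    calc ((H.star v).card : ℝ) * (C * D) ≤ (D + 1) * ((D + 1) * (D + 1)) := by
          gcongr <;> linarith
      _ = _ := by ring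
  have h4 : (((H.ball (2 * (k + 1)) v).powerset.filter fun X => X.card ≤ k + 1).card : ℝ) ≤
      (D + 1) * (D + 1 : ℝ) ^ ((2 * (k + 1) + 1) * (k + 1)) := by
    have h5 := (card_small_subsets_le (H.ball (2 * (k + 1)) v) (k + 1))
    have h6 := card_ball_le hsys.deg (2 * (k + 1)) v
    have h7 : (H.ball (2 * (k + 1)) v).card + 1 ≤ (D + 1) ^ (2 * (k + 1) + 1) := by
      have : 1 ≤ (D + 1) ^ (2 * (k + 1)) := Nat.one_le_pow _ _ (by omega)
      have hD1 : 1 ≤ D := by omega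
      rw [pow_succ]; nlinarith
    have h8 := h5.trans (Nat.mul_le_mul (by omega : k + 1 + 1 ≤ D + 1) (Nat.pow_le_pow_left h7 (k + 1)))
    rw [← pow_mul] at h8
    exact_mod_cast h8
  unfold recs
  rw [card_product, card_product, card_range]
  push_cast
  have h9 : ((k : ℝ) + 1) ≤ D + 1 := by
    have : ((k + 1 : ℕ) : ℝ) ≤ D := by exact_mod_cast hkD
    push_cast at this; linarith
  calc _ ≤ (D + 1 : ℝ) ^ 3 * ((D + 1) * (D + 1 : ℝ) ^ ((2 * (k + 1) + 1) * (k + 1)) * (D + 1)) := by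
        gcongr
    _ = _ := by rw [pow_add]; ring

theorem card_zone_le {D B w : ℕ} {conf : E × Γ → E × Γ → Prop} (hsys : H.System D B w conf)
    (hBD : B ≤ D) (r : ℕ) (v : V) : (H.zone conf r v).card ≤ 2 * (D + 1) ^ (r + 2) := by
  have h1 : (H.eball r v).card ≤ (D + 1) ^ r * D :=
    card_biUnion_le.trans ((sum_le_card_nsmul _ _ D fun u _ => hsys.deg u).trans
      (by rw [smul_eq_mul]; exact Nat.mul_le_mul_right _ (card_ball_le hsys.deg r v)))
  have h2 : ((H.star v).biUnion fun f => univ.filter fun e => ∃ γ γ', conf (f, γ) (e, γ')).card ≤ D * B :=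
    card_biUnion_le.trans ((sum_le_card_nsmul _ _ B fun f _ => hsys.nbrs f).trans
      (by rw [smul_eq_mul]; exact Nat.mul_le_mul_right _ (hsys.deg v)))
  have h3 : (D + 1) ^ r * D ≤ (D + 1) ^ (r + 2) := by
    rw [pow_add]; exact Nat.mul_le_mul_left _ (by nlinarith)
  have h4 : D * B ≤ (D + 1) ^ (r + 2) := by
    calc D * B ≤ (D + 1) ^ 2 := by nlinarith
      _ ≤ _ := Nat.pow_le_pow_right (by omega) (by omega)
  have := card_union_le (H.eball r v) ((H.star v).biUnion fun f => univ.filter fun e => ∃ γ γ', conf (f, γ) (e, γ'))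
  unfold zone
  omega

theorem card_meeting_zones_le {D B w : ℕ} {conf : E × Γ → E × Γ → Prop} (hsys : H.System D B w conf)
    (hBD : B ≤ D) (r : ℕ) (v : V) :
    (univ.filter fun u => ¬ Disjoint (H.zone conf r v) (H.zone conf r u)).card ≤
      8 * (D + 1) ^ (2 * r + 4) := by
  have hsub : (univ.filter fun u => ¬ Disjoint (H.zone conf r v) (H.zone conf r u)) ⊆
      (H.zone conf r v).biUnion fun e => H.ball r (H.s e) ∪ H.ball r (H.t e) ∪
        (univ.filter fun f => ∃ γ γ', conf (e, γ) (f, γ')).biUnion fun f => {H.s f, H.t f} := by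
    intro u hu
    obtain ⟨e, he, heu⟩ := not_disjoint_iff.1 (mem_filter.1 hu).2
    refine mem_biUnion.2 ⟨e, he, ?_⟩
    rcases mem_union.1 heu with h | h
    · obtain ⟨x, hx, hi⟩ := mem_eball.1 h
      refine mem_union_left _ (mem_union.2 ?_)
      rcases hi with rfl | rfl
      · exact Or.inl (ball_symm hx)
      · exact Or.inr (ball_symm hx)
    · obtain ⟨f, hf, hc⟩ := mem_biUnion.1 h
      obtain ⟨_, γ, γ', hc⟩ := mem_filter.1 hc
      refine mem_union_right _ (mem_biUnion.2 ⟨f, mem_filter.2 ⟨mem_univ _, γ', γ, hsys.symm _ _ hc⟩, ?_⟩)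
      rcases mem_star.1 hf with rfl | rfl <;> simp
  have hone : ∀ e, (H.ball r (H.s e) ∪ H.ball r (H.t e) ∪
      (univ.filter fun f => ∃ γ γ', conf (e, γ) (f, γ')).biUnion fun f => {H.s f, H.t f}).card ≤
      4 * (D + 1) ^ (r + 2) := by
    intro e
    have h1 := card_ball_le hsys.deg r (H.s e)
    have h2 := card_ball_le hsys.deg r (H.t e)
    have h3 : ((univ.filter fun f => ∃ γ γ', conf (e, γ) (f, γ')).biUnion fun f =>
        ({H.s f, H.t f} : Finset V)).card ≤ B * 2 :=
      card_biUnion_le.trans ((sum_le_card_nsmul _ _ 2 fun f _ => card_le_two).trans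
        (by rw [smul_eq_mul]; exact Nat.mul_le_mul_right _ (hsys.nbrs e)))
    have h4 : (D + 1) ^ r ≤ (D + 1) ^ (r + 2) := Nat.pow_le_pow_right (by omega) (by omega)
    have h5 : B ≤ (D + 1) ^ (r + 2) := by
      calc B ≤ (D + 1) ^ 1 := by rw [pow_one]; omega
        _ ≤ _ := Nat.pow_le_pow_right (by omega) (by omega)
    have h6 := card_union_le (H.ball r (H.s e)) (H.ball r (H.t e))
    have h7 := card_union_le (H.ball r (H.s e) ∪ H.ball r (H.t e))
      ((univ.filter fun f => ∃ γ γ', conf (e, γ) (f, γ')).biUnion fun f => ({H.s f, H.t f} : Finset V))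
    omega
  refine (card_le_card hsub).trans (card_biUnion_le.trans ((sum_le_card_nsmul _ _ _ fun e _ => hone e).trans ?_))
  rw [smul_eq_mul]
  calc _ ≤ 2 * (D + 1) ^ (r + 2) * (4 * (D + 1) ^ (r + 2)) :=
        Nat.mul_le_mul_right _ (card_zone_le hsys hBD r v)
    _ = _ := by ring

end Multi

namespace Multi
variable {V E : Type*} [Fintype V] [DecidableEq V] [Fintype E] [DecidableEq E] {H : Multi V E}
variable {Γ : Type*} [Fintype Γ] [DecidableEq Γ]

/-- The allowed deviation in one round. -/
def dev (C θ δ ζ : ℝ) : ℝ := C * (θ * (δ + ζ) + 4 * θ ^ 2) + ζ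

/-- The conditions on the parameters of one round. -/
structure Params (θ δ C ζ x : ℝ) (D B k n : ℕ) : Prop where
  θ0 : 0 ≤ θ
  θ1 : θ ≤ 1 / 2
  δ0 : 0 ≤ δ
  δ1 : δ + ζ ≤ 1
  C1 : 1 ≤ C
  ζ0 : 0 < ζ
  ζ1 : ζ ≤ 1
  BD : B ≤ D
  kD : k + 1 ≤ D
  CD : C / D ≤ ζ / 2
  errk : 144 * err C k ≤ ζ
  x1 : 2 * Real.exp (-(ζ ^ 2 / (32 * C ^ 3)) * D) ≤ x
  x2 : (1 / 2) ^ n * Real.exp (2 * (2 * C ^ 3 * B)) ≤ x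
  x3 : 64 * (D + 1 : ℝ) ^ (5 + (2 * (k + 1) + 1) * (k + 1) + (2 * (k + 3) + 4)) * x ≤ 1

variable {θ δ C ζ x : ℝ} {D B w k n : ℕ} {conf : E × Γ → E × Γ → Prop} {col : E → Option Γ}
  {l m : Γ → E → ℝ}

theorem Params.D0 (hp : Params θ δ C ζ x D B k n) : (0 : ℝ) < D := by
  have := hp.kD
  exact_mod_cast (by omega : 0 < D)

theorem Params.CD' (hp : Params θ δ C ζ x D B k n) : C ≤ D := by
  have h1 := hp.CD
  have h2 := hp.ζ1
  have h3 := hp.D0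
  rw [div_le_iff₀ h3] at h1
  nlinarith

theorem abs_sum_marg_sub_one_le (hp : Params θ δ C ζ x D B k n) (hsys : H.System D B w conf)
    (hst : H.State D C δ col l) (hm : ∀ γ e, 0 ≤ m γ e) (hml : ∀ γ e, m γ e ≤ l γ e) {v : V}
    (hag : ∀ γ, ∀ e ∈ H.eball (k + 2) v, m γ e = l γ e) {f : E} (hf : f ∈ H.star v)
    (hcf : col f = none) (γ₀ : Option Γ) :
    |∑ γ ∈ univ.filter (fun γ => some γ ≠ γ₀), H.marg (m γ) f - 1| ≤ δ + ζ := by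
  have hD := hp.D0
  have hC0 : 0 ≤ C := by linarith [hp.C1]
  have hDn : 0 < D := by exact_mod_cast hD
  have hbl := State.bdd hDn hC0 hsys hst
  have hbm : ∀ γ, H.bdd C (m γ) := fun γ => (hbl γ).mono (hml γ)
  have herr := hp.errk
  have he0 := err_nonneg hC0 k
  have hζ1 := hp.ζ1
  have hsf : H.s f ∈ H.ball 1 v := (ends_mem_ball_succ (k := 0) (star_subset_eball (self_mem_ball 0 v) hf)).1
  have hn := S_near (k := k) (e := f) hC0 hst.nonneg hm hbl hbm
    fun γ e he => hag γ e (eball_mono hsf (by omega) he)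
  have hS := abs_le.1 (hst.S f hcf)
  have hS2 : H.S l f ≤ 2 := by linarith [hp.δ1, hp.ζ0]
  have h1 := hn.abs_sub_le (by linarith) (by linarith) (S_nonneg hm f) (S_nonneg hst.nonneg f) hS2
  have h2 := abs_le.1 h1
  have h3 : ∑ γ ∈ univ.filter (fun γ => some γ ≠ γ₀), H.marg (m γ) f ≤ H.S m f :=
    sum_le_sum_of_subset_of_nonneg (filter_subset _ _) fun γ _ _ => marg_nonneg (hm γ) f
  have h4 : H.S m f - C / D ≤ ∑ γ ∈ univ.filter (fun γ => some γ ≠ γ₀), H.marg (m γ) f := by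
    have h5 := sum_filter_add_sum_filter_not univ (fun γ => some γ ≠ γ₀) fun γ => H.marg (m γ) f
    have h6 : ∑ γ ∈ univ.filter (fun γ => ¬ some γ ≠ γ₀), H.marg (m γ) f ≤ C / D := by
      cases γ₀ with
      | none =>
        have : (univ.filter fun γ : Γ => ¬ some γ ≠ none) = ∅ := by simp
        rw [this, sum_empty]; positivity
      | some γ₁ =>
        have : (univ.filter fun γ : Γ => ¬ some γ ≠ some γ₁) = {γ₁} := by ext; simp
        rw [this, sum_singleton]
        exact (marg_le (hm γ₁) f).trans ((hml γ₁ f).trans (hst.le γ₁ f))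
    unfold S
    linarith
  have h7 := hp.CD
  rw [abs_le]
  constructor <;> linarith

theorem fpr_badS_le (hp : Params θ δ C ζ x D B k n) (hsys : H.System D B w conf)
    (hst : H.State D C δ col l) (hm : ∀ γ e, 0 ≤ m γ e) (hml : ∀ γ e, m γ e ≤ l γ e) {v : V}
    (hag : ∀ γ, ∀ e ∈ H.eball (k + 2) v, m γ e = l γ e) :
    fpr (prodP fun γ => H.fl θ (m γ)) (H.badS θ ζ k col l v) ≤ D * x := by
  have hD := hp.D0
  have hDn : 0 < D := by exact_mod_cast hD
  have hC1 := hp.C1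
  have hC0 : 0 ≤ C := by linarith
  have hζ0 := hp.ζ0
  have hζ1 := hp.ζ1
  have herr := hp.errk
  have he0 := err_nonneg hC0 k
  have hθ1 : θ ≤ 1 := by linarith [hp.θ1]
  have hPP := isProb_prodP fun γ => isProb_fl (H := H) hp.θ0 hθ1 (hm γ)
  have hx0 : 0 ≤ x := le_trans (by positivity) hp.x1
  refine fpr_exists_le_mul hPP.1 _ (fun e ω => ζ ≤ |H.Xval θ k l e ω - H.S l e|) ?_ (fun e he => ?_) hx0
  · exact_mod_cast (card_filter_le _ _).trans (hsys.deg v)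
  obtain ⟨hev, hs, hcn⟩ := mem_filter.1 he
  have hS := abs_le.1 (hst.S e hcn)
  have hC3 : C ≤ C ^ 3 := le_self_pow₀ hC1 (by norm_num)
  refine (fpr_Xval_le (t := ζ / (8 * C ^ 3)) hp.θ0 hθ1 hC1 hDn hst.nonneg hm
    (State.bdd hDn hC0 hsys hst) hst.le hst.cols hml
    (fun γ f hf => hag γ f (eball_mono (by rw [hs]; exact self_mem_ball 0 v) (by omega) hf))
    (by linarith [hp.δ1]) (by linarith) (by linarith) (by positivity) ?_).trans (le_trans ?_ hp.x1)
  · rw [div_mul_eq_mul_div, div_le_one (by positivity)]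
    nlinarith
  · refine mul_le_mul_of_nonneg_left (Real.exp_le_exp.2 ?_) (by norm_num)
    refine mul_le_mul_of_nonneg_right (neg_le_neg ?_) hD.le
    have : ζ / (8 * C ^ 3) * (ζ / 2) - (ζ / (8 * C ^ 3)) ^ 2 * C ^ 3 = 3 / 2 * (ζ ^ 2 / (32 * C ^ 3)) := by
      field_simp; ring
    rw [this]
    have : 0 ≤ ζ ^ 2 / (32 * C ^ 3) := by positivity
    linarith

theorem tail_le (hp : Params θ δ C ζ x D B k n) :
    2 * Real.exp (-(ζ / (8 * C ^ 3) * ζ - (ζ / (8 * C ^ 3)) ^ 2 * (4 * C ^ 2)) * D) ≤ x := by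
  have hC1 := hp.C1
  have hC0 : 0 < C := by linarith
  refine le_trans (mul_le_mul_of_nonneg_left (Real.exp_le_exp.2 ?_) (by norm_num)) hp.x1
  refine mul_le_mul_of_nonneg_right (neg_le_neg ?_) hp.D0.le
  have e1 : ζ / (8 * C ^ 3) * ζ - (ζ / (8 * C ^ 3)) ^ 2 * (4 * C ^ 2) =
      ζ ^ 2 / (32 * C ^ 3) * (4 - 2 / C) := by
    field_simp; ring
  rw [e1]
  have h2 : 2 / C ≤ 2 := by rw [div_le_iff₀ hC0]; linarith
  have : 0 ≤ ζ ^ 2 / (32 * C ^ 3) := by positivity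
  nlinarith

theorem rate_le (hp : Params θ δ C ζ x D B k n) : ζ / (8 * C ^ 3) * (2 * C) ≤ 1 := by
  have hC1 := hp.C1
  have hC3 : C ≤ C ^ 3 := le_self_pow₀ hC1 (by norm_num)
  rw [div_mul_eq_mul_div, div_le_one (by positivity)]
  nlinarith [hp.ζ1, hp.ζ0]

theorem fpr_badR_le (hp : Params θ δ C ζ x D B k n) (hsys : H.System D B w conf)
    (hst : H.State D C δ col l) (hm : ∀ γ e, 0 ≤ m γ e) (hml : ∀ γ e, m γ e ≤ l γ e) {v : V}
    (hag : ∀ γ, ∀ e ∈ H.eball (k + 2) v, m γ e = l γ e) :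
    fpr (prodP fun γ => H.fl θ (m γ)) (H.badR θ (dev C θ δ ζ) k l v) ≤
      (D + 1 : ℝ) ^ (5 + (2 * (k + 1) + 1) * (k + 1)) * x := by
  have hD := hp.D0
  have hDn : 0 < D := by exact_mod_cast hD
  have hC1 := hp.C1
  have hθ1 : θ ≤ 1 := by linarith [hp.θ1]
  have hζ0 := hp.ζ0
  have hδ0 := hp.δ0
  have hPP := isProb_prodP fun γ => isProb_fl (H := H) hp.θ0 hθ1 (hm γ)
  have hx0 : 0 ≤ x := le_trans (by positivity) hp.x1
  have hone : ∀ i ∈ H.recs k l v, fpr (prodP fun γ => H.fl θ (m γ)) (fun ω => dev C θ δ ζ ≤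
      |H.Wval v (H.wgt θ (l i.1) v i.2.1 i.2.2 (hits (ω i.1))) (some i.1) ω -
        (1 - θ) * ∑ f ∈ H.star v, H.wgt θ (l i.1) v i.2.1 i.2.2 (hits (ω i.1)) f|) ≤ x := by
    rintro ⟨γ, X, j⟩ _
    have hS : ∀ f ∈ H.star v, l γ f ≠ 0 →
        |∑ γ' ∈ univ.filter (fun γ' => some γ' ≠ some γ), H.marg (m γ') f - 1| ≤ δ + ζ :=
      fun f hf hne => abs_sum_marg_sub_one_le hp hsys hst hm hml hag hf
        (by by_contra hcon; exact hne (hst.zero _ _ hcon)) _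
    have key := fpr_wgt_le (ζ := ζ) (t := ζ / (8 * C ^ 3)) hp.θ0 hp.θ1 (by linarith) hp.δ1 hC1 hDn
      hst.nonneg hst.le hm (hsys.deg v) γ hS X j (by positivity) (rate_le hp)
    exact key.trans (tail_le hp)
  have hcard := card_recs_le hsys hst (by linarith) (by linarith [hp.CD']) hp.kD v
  exact fpr_exists_le_mul hPP.1 (H.recs k l v) _ hcard hone hx0

theorem fpr_badD_le (hp : Params θ δ C ζ x D B k n) (hsys : H.System D B w conf)
    (hst : H.State D C δ col l) (hm : ∀ γ e, 0 ≤ m γ e) (hml : ∀ γ e, m γ e ≤ l γ e) {v : V}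
    (hag : ∀ γ, ∀ e ∈ H.eball (k + 2) v, m γ e = l γ e) :
    fpr (prodP fun γ => H.fl θ (m γ)) (H.badD θ (dev C θ δ ζ) D col v) ≤ x := by
  have hD := hp.D0
  have hDn : 0 < D := by exact_mod_cast hD
  have hC1 := hp.C1
  have hζ0 := hp.ζ0
  have hδ0 := hp.δ0
  refine (fpr_Wval_le (t := ζ / (8 * C ^ 3)) hp.θ0 hp.θ1 (by linarith) hp.δ1 hC1 hDn hm (hsys.deg v)
    (fun f => ?_) (fun f => ?_) none (fun f hf hne => abs_sum_marg_sub_one_le hp hsys hst hm hml hag hf ?_ _)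
    (by positivity) (rate_le hp)).trans (tail_le hp)
  · split_ifs <;> positivity
  · split_ifs
    · gcongr
    · positivity
  · by_contra hcon
    exact hne (if_neg hcon)

theorem fpr_badC_le (hp : Params θ δ C ζ x D B k n) (hsys : H.System D B w conf)
    (hst : H.State D C δ col l) (hm : ∀ γ e, 0 ≤ m γ e) (hml : ∀ γ e, m γ e ≤ l γ e) {v : V} :
    fpr (prodP fun γ => H.fl θ (m γ)) (H.badC (2 * n * (1 + w)) conf col v) ≤ x := by
  have hD := hp.D0
  have hDn : 0 < D := by exact_mod_cast hD
  refine (fpr_conflicted_le hp.θ0 (by linarith [hp.θ1]) hp.C1 hDn hm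
    (fun γ e => (hml γ e).trans (hst.le γ e)) (fun e => le_trans ?_ (hst.cols e)) conf
    (fun p => hsys.irr p.1 p.2 p.2) col (hsys.deg v) hsys.items (hsys.blk col) hsys.win n).trans hp.x2
  refine Nat.cast_le.2 (card_le_card fun γ hγ => ?_)
  rw [mem_filter] at hγ ⊢
  refine ⟨hγ.1, fun hz => hγ.2 (le_antisymm ?_ (hm γ e))⟩
  rw [← hz]; exact hml γ e

theorem exists_round (hp : Params θ δ C ζ x D B k n) (hsys : H.System D B w conf)
    (hst : H.State D C δ col l) :
    ∃ ω : Γ → Finset (E × Bool), (∀ γ, H.fl θ (l γ) (ω γ) ≠ 0) ∧ ∀ v, ¬ H.badS θ ζ k col l v ω ∧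
      ¬ H.badR θ (dev C θ δ ζ) k l v ω ∧ ¬ H.badD θ (dev C θ δ ζ) D col v ω ∧
      ¬ H.badC (2 * n * (1 + w)) conf col v ω := by
  have hD := hp.D0
  have hθ1 : θ ≤ 1 := by linarith [hp.θ1]
  have hx0 : 0 ≤ x := le_trans (by positivity) hp.x1
  have hPP := isProb_prodP fun γ => isProb_fl (H := H) hp.θ0 hθ1 (hst.nonneg γ)
  set y : ℝ := D + 1 with hy
  have hy2 : 2 ≤ y := by
    have : (1 : ℝ) ≤ D := by exact_mod_cast (by have := hp.kD; omega : 1 ≤ D)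
    linarith
  set a := 5 + (2 * (k + 1) + 1) * (k + 1) with ha
  have hya : y + 2 ≤ y ^ a := by
    calc y + 2 ≤ y ^ 2 := by nlinarith
      _ ≤ y ^ a := pow_le_pow_right₀ (by linarith) (by omega)
  have hya0 : 0 < y ^ a := by positivity
  set bad : V → (Γ → Finset (E × Bool)) → Prop := fun v ω => H.badS θ ζ k col l v ω ∨
    (H.badR θ (dev C θ δ ζ) k l v ω ∨ (H.badD θ (dev C θ δ ζ) D col v ω ∨
      H.badC (2 * n * (1 + w)) conf col v ω)) with hbad
  have hcongr : ∀ v ω ω', (∀ γ, ∀ f ∈ H.zone conf (k + 3) v, (f ∈ hits (ω γ) ↔ f ∈ hits (ω' γ))) →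
      (bad v ω ↔ bad v ω') := by
    intro v ω ω' h
    have h' : ∀ γ, ∀ f ∈ H.eball (k + 2) v, (f ∈ hits (ω γ) ↔ f ∈ hits (ω' γ)) := fun γ f hf =>
      h γ f (mem_union_left _ (eball_mono (self_mem_ball 0 v) (by omega) hf))
    simp only [hbad, badS_congr h', badR_congr h', badD_congr h', badC_congr h]
  suffices hL : ∃ ω, (prodP fun γ => H.fl θ (l γ)) ω ≠ 0 ∧ ∀ v, ¬ bad v ω by
    obtain ⟨ω, hω, hgood⟩ := hL
    refine ⟨ω, ne_zero_of_prodP hω, fun v => ?_⟩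
    have := hgood v
    simp only [hbad, not_or] at this
    exact this
  refine lovasz_local hPP bad
    (fun v => univ.filter fun u => ¬ Disjoint (H.zone conf (k + 3) v) (H.zone conf (k + 3) u))
    (p := 2 * y ^ a * x) (d := 8 * y ^ (2 * (k + 3) + 4)) (by positivity) ?_ ?_ ?_ ?_
  · intro v
    have := card_meeting_zones_le hsys hp.BD (k + 3) v
    rw [hy]
    exact_mod_cast this
  · calc 4 * (2 * y ^ a * x) * (8 * y ^ (2 * (k + 3) + 4)) = 64 * y ^ (a + (2 * (k + 3) + 4)) * x := by
          rw [pow_add]; ring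
      _ ≤ 1 := hp.x3
  · refine le_trans ?_ hp.x3
    have h1 : (1 : ℝ) ≤ y ^ (2 * (k + 3) + 4) := one_le_pow₀ (by linarith)
    have h2 : 0 ≤ y ^ a * x := by positivity
    calc 4 * (2 * y ^ a * x) ≤ 64 * (y ^ a * x) * 1 := by linarith
      _ ≤ 64 * (y ^ a * x) * y ^ (2 * (k + 3) + 4) := by gcongr
      _ = 64 * y ^ (a + (2 * (k + 3) + 4)) * x := by rw [pow_add y a]; ring
  · intro v T hT
    refine fpr_and_le hp.θ0 hθ1 hst.nonneg (H.zone conf (k + 3) v) (bad v) (fun ω => ∀ u ∈ T, ¬ bad u ω)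
      ?_ ?_ ?_
    · intro ω ω' h
      refine hcongr v ω ω' fun γ f hf => ?_
      rw [mem_hits, mem_hits]
      exact h γ (f, true) hf
    · intro ω ω' h
      refine forall₂_congr fun u hu => not_congr (hcongr u ω ω' fun γ f hf => ?_)
      rw [mem_hits, mem_hits]
      refine h γ (f, true) fun hf2 => ?_
      refine hT u hu (mem_filter.2 ⟨mem_univ _, ?_⟩)
      exact not_disjoint_iff.2 ⟨f, hf2, hf⟩
    · intro m hm hml hmI
      have hag : ∀ γ, ∀ e ∈ H.eball (k + 2) v, m γ e = l γ e := by
        intro γ e he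
        refine hmI γ e fun f u hu hfu => mem_union_left _ ?_
        obtain ⟨h1, h2⟩ := ends_mem_ball_succ he
        refine star_subset_eball (u := u) ?_ (mem_star.2 hfu)
        rcases hu with rfl | rfl
        · exact h1
        · exact h2
      have hPm := (isProb_prodP fun γ => isProb_fl (H := H) hp.θ0 hθ1 (hm γ)).1
      have hS := fpr_badS_le hp hsys hst hm hml hag
      have hR := fpr_badR_le hp hsys hst hm hml hag
      have hDD := fpr_badD_le hp hsys hst hm hml hag
      have hCC := fpr_badC_le (v := v) hp hsys hst hm hml
      have o1 := fpr_or_le hPm (H.badS θ ζ k col l v) fun ω => H.badR θ (dev C θ δ ζ) k l v ω ∨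
        (H.badD θ (dev C θ δ ζ) D col v ω ∨ H.badC (2 * n * (1 + w)) conf col v ω)
      have o2 := fpr_or_le hPm (H.badR θ (dev C θ δ ζ) k l v) fun ω =>
        H.badD θ (dev C θ δ ζ) D col v ω ∨ H.badC (2 * n * (1 + w)) conf col v ω
      have o3 := fpr_or_le hPm (H.badD θ (dev C θ δ ζ) D col v) (H.badC (2 * n * (1 + w)) conf col v)
      have e : (D : ℝ) = y - 1 := by rw [hy]; ring
      rw [e] at hS
      have hfin : (y + 2) * x ≤ y ^ a * x := mul_le_mul_of_nonneg_right hya hx0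
      have : fpr (prodP fun γ => H.fl θ (m γ)) (bad v) ≤ (y - 1) * x + (y ^ a * x + (x + x)) := by
        linarith
      nlinarith

end Multi

namespace Multi
variable {V E : Type*} [Fintype V] [DecidableEq V] [Fintype E] [DecidableEq E] {H : Multi V E}
variable {Γ : Type*} [Fintype Γ] [DecidableEq Γ]
variable {θ δ C ζ x : ℝ} {D B w k n : ℕ} {conf : E × Γ → E × Γ → Prop} {col : E → Option Γ}
  {l : Γ → E → ℝ} {ω : Γ → Finset (E × Bool)}

/-- Colour the flagged edges that have no conflict. -/
def newCol (conf : E × Γ → E × Γ → Prop) (col : E → Option Γ) (ω : Γ → Finset (E × Bool)) (f : E) :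
    Option Γ :=
  if col f ≠ none then col f
  else if h : ∃ γ, f ∈ hits (ω γ) then
    if conflicted conf col ω f then none else some h.choose
  else none

/-- Delete the coloured edges, and the vertices at which the colour is used. -/
def newL (H : Multi V E) (conf : E × Γ → E × Γ → Prop) (col : E → Option Γ)
    (l : Γ → E → ℝ) (ω : Γ → Finset (E × Bool)) (γ : Γ) (f : E) : ℝ :=
  if newCol conf col ω f = none then H.del (H.verts (hits (ω γ))) (l γ) f else 0

theorem newCol_eq_none {f : E} : newCol conf col ω f = none ↔
    col f = none ∧ (¬ hitBy none ω f ∨ conflicted conf col ω f) := by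
  have hh : hitBy none ω f ↔ ∃ γ, f ∈ hits (ω γ) := by simp [hitBy]
  rw [hh]
  unfold newCol
  by_cases h1 : col f = none
  · by_cases h2 : ∃ γ, f ∈ hits (ω γ)
    · by_cases h3 : conflicted conf col ω f
      · simp [h1, h2, h3]
      · simp [h1, h2, h3]
    · simp [h1, h2]
  · simp [h1]

theorem newCol_eq_some {f : E} {γ : Γ} (h : newCol conf col ω f = some γ) :
    col f = some γ ∨ (col f = none ∧ f ∈ hits (ω γ) ∧ ¬ conflicted conf col ω f) := by
  unfold newCol at h
  by_cases h1 : col f = none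
  · by_cases h2 : ∃ γ, f ∈ hits (ω γ)
    · by_cases h3 : conflicted conf col ω f
      · simp [h1, h2, h3] at h
      · simp only [h1, h2, h3, ne_eq, not_true_eq_false, if_false, dif_pos, Option.some.injEq] at h
        right
        rw [← h]
        exact ⟨h1, h2.choose_spec, h3⟩
    · simp [h1, h2] at h
  · left; simpa [h1] using h

theorem newL_nonneg (hl : ∀ γ e, 0 ≤ l γ e) (γ : Γ) (f : E) : 0 ≤ H.newL conf col l ω γ f := by
  unfold newL
  split_ifs
  · exact del_nonneg (hl γ) _ f
  · exact le_rfl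

theorem newL_le (hl : ∀ γ e, 0 ≤ l γ e) (γ : Γ) (f : E) : H.newL conf col l ω γ f ≤ l γ f := by
  unfold newL
  split_ifs
  · exact del_le (hl γ) _ f
  · exact hl γ f

theorem newL_ne_zero {γ : Γ} {f : E} (h : H.newL conf col l ω γ f ≠ 0) :
    newCol conf col ω f = none ∧ l γ f ≠ 0 ∧ H.s f ∉ H.verts (hits (ω γ)) ∧ H.t f ∉ H.verts (hits (ω γ)) := by
  unfold newL at h
  split_ifs at h with h1
  · unfold del at h
    split_ifs at h with h2
    · exact absurd rfl h
    · push Not at h2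
      exact ⟨h1, h, h2.1, h2.2⟩
  · exact absurd rfl h

/-- A partial colouring without conflicts, for which all activities are still available. -/
structure Good (H : Multi V E) (Lst : E → Finset Γ) (conf : E × Γ → E × Γ → Prop)
    (col : E → Option Γ) (l : Γ → E → ℝ) : Prop where
  mem : ∀ e γ, col e = some γ → γ ∈ Lst e
  supp : ∀ e γ, l γ e ≠ 0 → γ ∈ Lst e
  proper : ∀ e f v γ, H.inc e v → H.inc f v → col e = some γ → col f = some γ → e = f
  noconf : ∀ e f γ γ', col e = some γ → col f = some γ' → ¬ conf (e, γ) (f, γ')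
  avail : ∀ e f v γ, H.inc e v → H.inc f v → l γ e ≠ 0 → col f ≠ some γ

theorem Good.next {Lst : E → Finset Γ} (hg : H.Good Lst conf col l) (hsys : H.System D B w conf)
    (hω : ∀ γ, H.fl θ (l γ) (ω γ) ≠ 0) :
    H.Good Lst conf (newCol conf col ω) (H.newL conf col l ω) := by
  have hne : ∀ f γ, f ∈ hits (ω γ) → l γ f ≠ 0 := fun f γ hf => ne_zero_of_mem_hits (hω γ) hf
  refine ⟨?_, ?_, ?_, ?_, ?_⟩
  · intro e γ h
    rcases newCol_eq_some h with h | ⟨_, h, _⟩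
    · exact hg.mem e γ h
    · exact hg.supp e γ (hne e γ h)
  · intro e γ h
    exact hg.supp e γ (newL_ne_zero h).2.1
  · intro e f v γ he hf hce hcf
    rcases newCol_eq_some hce with h | ⟨_, h, _⟩ <;> rcases newCol_eq_some hcf with h' | ⟨_, h', _⟩
    · exact hg.proper e f v γ he hf h h'
    · exact absurd h (hg.avail f e v γ hf he (hne f γ h'))
    · exact absurd h' (hg.avail e f v γ he hf (hne e γ h))
    · exact isM_of_fl (hω γ) e h f h' v he hf
  · intro e f γ γ' hce hcf hc
    rcases newCol_eq_some hce with h | ⟨_, h, hn⟩ <;> rcases newCol_eq_some hcf with h' | ⟨_, h', hn'⟩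
    · exact hg.noconf e f γ γ' h h' hc
    · exact hn' ⟨γ', h', Or.inl ⟨e, γ, h, hsys.symm _ _ hc⟩⟩
    · exact hn ⟨γ, h, Or.inl ⟨f, γ', h', hc⟩⟩
    · exact hn ⟨γ, h, Or.inr ⟨(f, γ'), mem_allHits.2 h', hc⟩⟩
  · intro e f v γ he hf h hcf
    obtain ⟨_, h1, h2, h3⟩ := newL_ne_zero h
    rcases newCol_eq_some hcf with h' | ⟨_, h', _⟩
    · exact hg.avail e f v γ he hf h1 h'
    · have : v ∈ H.verts (hits (ω γ)) := mem_verts.2 ⟨f, h', hf⟩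
      rcases he with rfl | rfl
      · exact h2 this
      · exact h3 this

theorem abs_sum_newL_le (hp : Params θ δ C ζ x D B k n) (hst : H.State D C δ col l)
    (hnw : ((2 * n * (1 + w) : ℕ) : ℝ) ≤ ζ * D) {v : V}
    (hR : ¬ H.badR θ (dev C θ δ ζ) k l v ω) (hc : ¬ H.badC (2 * n * (1 + w)) conf col v ω)
    (γ : Γ) {X : Finset V} (hX : X ⊆ H.ball (2 * (k + 1)) v) (hXc : X.card ≤ k + 1) {j : ℕ}
    (hj : j < k + 1) :
    |∑ f ∈ H.star v, (H.del X (H.newL conf col l ω γ) f - H.del X (H.thin θ (hits (ω γ)) (l γ)) f) *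
      H.Fk j (H.del (X ∪ {v}) (H.thin θ (hits (ω γ)) (l γ))) (H.other f v)| ≤ dev C θ δ ζ + C * ζ := by
  have hD := hp.D0
  have hθ1 : θ ≤ 1 := by linarith [hp.θ1]
  have hC0 : 0 ≤ C := by linarith [hp.C1]
  have hdev0 : 0 ≤ dev C θ δ ζ := by
    have := hp.θ0; have := hp.δ0; have := hp.ζ0
    unfold dev; positivity
  set a := H.wgt θ (l γ) v X j (hits (ω γ)) with ha
  have ha0 : ∀ f, 0 ≤ a f := wgt_nonneg hθ1 (hst.nonneg γ) v X j _
  have hal : ∀ f, a f ≤ l γ f := wgt_le hθ1 (hst.nonneg γ) v X j _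
  have hterm : ∀ f ∈ H.star v, (H.del X (H.newL conf col l ω γ) f -
      H.del X (H.thin θ (hits (ω γ)) (l γ)) f) *
      H.Fk j (H.del (X ∪ {v}) (H.thin θ (hits (ω γ)) (l γ))) (H.other f v) =
      (if newCol conf col ω f = none then 1 else 0) * a f - (1 - θ) * a f := by
    intro f _
    rw [ha, wgt]
    have e1 : H.del X (H.newL conf col l ω γ) f = (if newCol conf col ω f = none then 1 else 0) *
        H.del X (H.del (H.verts (hits (ω γ))) (l γ)) f := by
      unfold newL
      by_cases h1 : newCol conf col ω f = none
      · simp only [del, h1, if_true, one_mul]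
      · simp only [del, h1, if_false, zero_mul, ite_self]
    have e2 : H.del X (H.thin θ (hits (ω γ)) (l γ)) f = (1 - θ) *
        H.del X (H.del (H.verts (hits (ω γ))) (l γ)) f := by
      simp only [thin, del]
      split_ifs <;> ring
    rw [e1, e2]; ring
  rw [sum_congr rfl hterm, sum_sub_distrib, ← mul_sum]
  by_cases hex : ∃ f ∈ H.star v, l γ f ≠ 0
  swap
  · push Not at hex
    have hz : ∀ f ∈ H.star v, a f = 0 := fun f hf =>
      le_antisymm ((hal f).trans (hex f hf).le) (ha0 f)
    rw [sum_eq_zero fun f hf => by rw [hz f hf, mul_zero], sum_eq_zero hz]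
    simp only [mul_zero, sub_zero, abs_zero]
    have := hp.ζ0
    positivity
  have hmem : (γ, X, j) ∈ H.recs k l v :=
    mem_product.2 ⟨mem_filter.2 ⟨mem_univ _, hex⟩, mem_product.2
      ⟨mem_filter.2 ⟨mem_powerset.2 hX, hXc⟩, mem_range.2 hj⟩⟩
  have h1 : |H.Wval v a (some γ) ω - (1 - θ) * ∑ f ∈ H.star v, a f| < dev C θ δ ζ := by
    by_contra hcon
    exact hR ⟨_, hmem, not_lt.1 hcon⟩
  have h2 : |∑ f ∈ H.star v, (if newCol conf col ω f = none then 1 else 0) * a f -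
      H.Wval v a (some γ) ω| ≤ C * ζ := by
    unfold Wval
    rw [← sum_sub_distrib]
    refine (abs_sum_le_sum_abs _ _).trans ?_
    have h3 : ∀ f ∈ H.star v, |(if newCol conf col ω f = none then 1 else 0) * a f -
        a f * (if hitBy (some γ) ω f then 0 else 1)| ≤
        if conflicted conf col ω f then C / D else 0 := by
      intro f hf
      by_cases haf : a f = 0
      · rw [haf]; simp only [mul_zero, zero_mul, sub_zero, abs_zero]
        split_ifs <;> positivity
      have hlf : l γ f ≠ 0 := fun hz => haf (le_antisymm ((hal f).trans hz.le) (ha0 f))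
      have hcf : col f = none := by
        by_contra hcon; exact hlf (hst.zero _ _ hcon)
      have hfγ : f ∉ hits (ω γ) := by
        intro hfh
        apply haf
        have : H.s f ∈ H.verts (hits (ω γ)) := mem_verts.2 ⟨f, hfh, inc_s f⟩
        rw [ha, wgt]
        simp only [del, this, true_or, if_true, ite_self, zero_mul]
      have hhit : hitBy (some γ) ω f ↔ hitBy none ω f := by
        constructor
        · rintro ⟨γ', _, h⟩; exact ⟨γ', by simp, h⟩
        · rintro ⟨γ', _, h⟩
          refine ⟨γ', ?_, h⟩
          rintro ⟨⟩
          exact hfγ h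
      have haC := (hal f).trans (hst.le γ f)
      by_cases hcc : conflicted conf col ω f
      · have hn : newCol conf col ω f = none := newCol_eq_none.2 ⟨hcf, Or.inr hcc⟩
        rw [if_pos hcc, if_pos hn, abs_le]
        have := ha0 f
        split_ifs <;> constructor <;> linarith
      · rw [if_neg hcc]
        by_cases hh : hitBy none ω f
        · have hn : ¬ newCol conf col ω f = none := fun h => by
            rcases (newCol_eq_none.1 h).2 with h | h
            · exact h hh
            · exact hcc h
          rw [if_neg hn, if_pos (hhit.2 hh)]; simp
        · have hn : newCol conf col ω f = none := newCol_eq_none.2 ⟨hcf, Or.inl hh⟩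
          rw [if_pos hn, if_neg (fun h => hh (hhit.1 h))]; simp
    refine (sum_le_sum h3).trans ?_
    rw [← sum_filter, sum_const, nsmul_eq_mul]
    have h4 : (((H.star v).filter (conflicted conf col ω)).card : ℝ) ≤ ζ * D :=
      le_trans (by exact_mod_cast not_lt.1 hc) hnw
    calc _ ≤ ζ * D * (C / D) := mul_le_mul_of_nonneg_right h4 (by positivity)
      _ = C * ζ := by field_simp
  have h5 := abs_sub_le (∑ f ∈ H.star v, (if newCol conf col ω f = none then 1 else 0) * a f)
    (H.Wval v a (some γ) ω) ((1 - θ) * ∑ f ∈ H.star v, a f)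
  linarith

/-- The multiplicative error of one round. -/
def roundErr (C θ δ ζ : ℝ) : ℝ := ζ + 2 * (dev C θ δ ζ + C * ζ) * (1 + C)

theorem Kk_newL_near (hp : Params θ δ C ζ x D B k n) (hsys : H.System D B w conf)
    (hst : H.State D C δ col l) (hnw : ((2 * n * (1 + w) : ℕ) : ℝ) ≤ ζ * D)
    (hR : ∀ v, ¬ H.badR θ (dev C θ δ ζ) k l v ω) (hc : ∀ v, ¬ H.badC (2 * n * (1 + w)) conf col v ω)
    (γ : Γ) (e : E) :
    near (2 * (dev C θ δ ζ + C * ζ) * (1 + C)) (H.Kk k (H.newL conf col l ω γ) (H.s e) (H.t e))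
      (H.Kk k (H.thin θ (hits (ω γ)) (l γ)) (H.s e) (H.t e)) := by
  have hD := hp.D0
  have hDn : 0 < D := by exact_mod_cast hD
  have hC0 : 0 ≤ C := by linarith [hp.C1]
  have hθ1 : θ ≤ 1 := by linarith [hp.θ1]
  have hbl := State.bdd hDn hC0 hsys hst γ
  have h1 := newL_nonneg (H := H) (conf := conf) (col := col) (ω := ω) hst.nonneg γ
  have h2 := thin_nonneg (H := H) hθ1 (hst.nonneg γ) (hits (ω γ))
  have hb1 : H.bdd C (H.newL conf col l ω γ) := hbl.mono (newL_le hst.nonneg γ)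
  have hb2 : H.bdd C (H.thin θ (hits (ω γ)) (l γ)) := hbl.mono (thin_le hp.θ0 hθ1 (hst.nonneg γ) _)
  have hξ0 : 0 ≤ dev C θ δ ζ + C * ζ := by
    have := hp.θ0; have := hp.δ0; have := hp.ζ0
    unfold dev; positivity
  have key := Fk_perturb hC0 hξ0 h2 h1 hb2 hb1 (k + 1) (H.s e) (fun v hv X hX hXc j hj =>
    abs_sum_newL_le hp hst hnw (hR v) (hc v) γ (fun u hu => by
      have := ball_trans (ball_symm hv) (hX hu)
      rwa [← two_mul] at this) hXc hj) k
  have k1 := key 0 (by omega) (H.s e) (self_mem_ball _ _) ∅ (empty_subset _) (by simp)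
  have k2 := key 1 (by omega) (H.t e) (t_mem_ball e) {H.s e}
    (singleton_subset_iff.2 (self_mem_ball _ _)) (by simp)
  rw [del_empty, del_empty] at k1
  have k3 := k1.mul k2 (Fk_pos_le h1 k _).1.le (Fk_pos_le h2 k _).1.le
    (Fk_pos_le (del_nonneg h1 _) k _).1.le (Fk_pos_le (del_nonneg h2 _) k _).1.le
  rw [← two_mul, ← mul_assoc] at k3
  exact k3

theorem State.next (hp : Params θ δ C ζ x D B k n) (hsys : H.System D B w conf)
    (hst : H.State D C δ col l) (hnw : ((2 * n * (1 + w) : ℕ) : ℝ) ≤ ζ * D)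
    (hτ : roundErr C θ δ ζ ≤ 1)
    (hS : ∀ v, ¬ H.badS θ ζ k col l v ω) (hR : ∀ v, ¬ H.badR θ (dev C θ δ ζ) k l v ω)
    (hc : ∀ v, ¬ H.badC (2 * n * (1 + w)) conf col v ω) :
    H.State D C (δ + ζ + 12 * roundErr C θ δ ζ) (newCol conf col ω) (H.newL conf col l ω) := by
  have hD := hp.D0
  have hDn : 0 < D := by exact_mod_cast hD
  have hC0 : 0 ≤ C := by linarith [hp.C1]
  have hθ1 : θ ≤ 1 := by linarith [hp.θ1]
  have hnn := newL_nonneg (H := H) (conf := conf) (col := col) (ω := ω) hst.nonneg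
  refine ⟨hnn, fun γ e => (newL_le hst.nonneg γ e).trans (hst.le γ e), fun e => ?_, fun γ e h => if_neg h,
    fun e he => ?_⟩
  · refine le_trans (Nat.cast_le.2 (card_le_card fun γ hγ => ?_)) (hst.cols e)
    rw [mem_filter] at hγ ⊢
    exact ⟨hγ.1, (newL_ne_zero hγ.2).2.1⟩
  have hce : col e = none := (newCol_eq_none.1 he).1
  have herr0 := err_nonneg hC0 k
  have hξ0 : 0 ≤ dev C θ δ ζ + C * ζ := by
    have := hp.θ0; have := hp.δ0; have := hp.ζ0
    unfold dev; positivity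
  have hnear : near (roundErr C θ δ ζ) (H.S (H.newL conf col l ω) e) (H.Xval θ k l e ω) := by
    unfold Multi.S Multi.Xval
    refine near.sum fun γ _ => ?_
    have hbl := State.bdd hDn hC0 hsys hst γ
    have h1 := (Kk_near hC0 (hnn γ) (hbl.mono (newL_le hst.nonneg γ)) k (H.s e) (H.t e)).symm
    have h2 := h1.trans (Kk_newL_near hp hsys hst hnw hR hc γ e)
    have h3 := h2.mono (τ' := roundErr C θ δ ζ) (by
      unfold roundErr; linarith [hp.errk])
      (K_nonneg (hnn γ) _ _) (Kk_nonneg (thin_nonneg hθ1 (hst.nonneg γ) _) _ _ _)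
    unfold marg
    by_cases hf : H.free (hits (ω γ)) {H.s e, H.t e}
    · rw [if_pos hf]
      have h4 := free_iff_verts.1 hf
      have : H.newL conf col l ω γ e = l γ e := by
        simp only [newL, he, if_true, del, h4.1, h4.2, or_self, if_false]
      rw [this]
      exact h3.const_mul (hst.nonneg γ e)
    · rw [if_neg hf]
      have : H.newL conf col l ω γ e = 0 := by
        by_contra hcon
        obtain ⟨_, _, h5, h6⟩ := newL_ne_zero hcon
        exact hf (free_iff_verts.2 ⟨h5, h6⟩)
      rw [this, zero_mul]
      simp [near]
  have hX : |H.Xval θ k l e ω - H.S l e| < ζ := by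
    by_contra hcon
    exact hS (H.s e) ⟨e, mem_filter.2 ⟨mem_star.2 (inc_s e), rfl, hce⟩, not_lt.1 hcon⟩
  have hS1 := abs_le.1 (hst.S e hce)
  have hX1 := abs_lt.1 hX
  have hX0 : 0 ≤ H.Xval θ k l e ω := sum_nonneg fun γ _ => by
    split_ifs
    · exact mul_nonneg (hst.nonneg γ e) (Kk_nonneg (thin_nonneg hθ1 (hst.nonneg γ) _) _ _ _)
    · exact le_rfl
  have hτ0 : 0 ≤ roundErr C θ δ ζ := by
    have := hp.ζ0
    unfold roundErr; positivity
  have h6 := abs_le.1 (hnear.abs_sub_le hτ0 hτ (S_nonneg hnn e) hX0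
    (by linarith [hp.δ1] : H.Xval θ k l e ω ≤ 2))
  rw [abs_le]
  constructor <;> linarith

theorem card_newCol_le (hp : Params θ δ C ζ x D B k n) (hnw : ((2 * n * (1 + w) : ℕ) : ℝ) ≤ ζ * D)
    {v : V} (hDD : ¬ H.badD θ (dev C θ δ ζ) D col v ω) (hc : ¬ H.badC (2 * n * (1 + w)) conf col v ω) :
    (((H.star v).filter fun f => newCol conf col ω f = none).card : ℝ) ≤
      (1 - θ) * ((H.star v).filter fun f => col f = none).card + (dev C θ δ ζ + ζ) * D := by
  have hD := hp.D0
  have h1 := lt_of_not_ge hDD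
  have e1 : ∑ f ∈ H.star v, (if col f = none then 1 / (D : ℝ) else 0) =
      ((H.star v).filter fun f => col f = none).card / D := by
    rw [← sum_filter, sum_const, nsmul_eq_mul]; ring
  have h2 := (abs_lt.1 h1).2
  rw [e1] at h2
  have h4 : (((H.star v).filter (conflicted conf col ω)).card : ℝ) ≤ ζ * D :=
    le_trans (by exact_mod_cast not_lt.1 hc) hnw
  have h5 : (((H.star v).filter fun f => newCol conf col ω f = none).card : ℝ) / D ≤
      H.Wval v (fun f => if col f = none then 1 / (D : ℝ) else 0) none ω +
        ((H.star v).filter (conflicted conf col ω)).card / D := by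
    have e2 : (((H.star v).filter fun f => newCol conf col ω f = none).card : ℝ) / D =
        ∑ f ∈ H.star v, if newCol conf col ω f = none then 1 / (D : ℝ) else 0 := by
      rw [← sum_filter, sum_const, nsmul_eq_mul]; ring
    have e3 : (((H.star v).filter (conflicted conf col ω)).card : ℝ) / D =
        ∑ f ∈ H.star v, if conflicted conf col ω f then 1 / (D : ℝ) else 0 := by
      rw [← sum_filter, sum_const, nsmul_eq_mul]; ring
    rw [e2, e3, Wval, ← sum_add_distrib]
    refine sum_le_sum fun f _ => ?_
    have hpos : 0 ≤ 1 / (D : ℝ) := by positivity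
    by_cases hn : newCol conf col ω f = none
    · obtain ⟨hcf, hor⟩ := newCol_eq_none.1 hn
      rw [if_pos hn, if_pos hcf]
      rcases hor with h | h
      · rw [if_neg h]; split_ifs <;> linarith
      · rw [if_pos h]; split_ifs <;> linarith
    · rw [if_neg hn]
      split_ifs <;> simp <;> linarith
  have h6 : (((H.star v).filter (conflicted conf col ω)).card : ℝ) / D ≤ ζ := by
    rw [div_le_iff₀ hD]; exact h4
  have h7 : (((H.star v).filter fun f => newCol conf col ω f = none).card : ℝ) / D ≤
      ((1 - θ) * ((H.star v).filter fun f => col f = none).card + (dev C θ δ ζ + ζ) * D) / D := by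
    rw [add_div, mul_div_assoc, mul_div_assoc, div_self hD.ne']
    linarith
  exact (div_le_div_iff_of_pos_right hD).1 h7

/-- One round of the random colouring. -/
theorem round {Lst : E → Finset Γ} (hp : Params θ δ C ζ x D B k n) (hsys : H.System D B w conf)
    (hst : H.State D C δ col l) (hg : H.Good Lst conf col l)
    (hnw : ((2 * n * (1 + w) : ℕ) : ℝ) ≤ ζ * D) (hτ : roundErr C θ δ ζ ≤ 1) {d : ℝ}
    (hd : ∀ v, (((H.star v).filter fun f => col f = none).card : ℝ) ≤ d * D) :
    ∃ col' l', H.State D C (δ + ζ + 12 * roundErr C θ δ ζ) col' l' ∧ H.Good Lst conf col' l' ∧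
      ∀ v, (((H.star v).filter fun f => col' f = none).card : ℝ) ≤
        ((1 - θ) * d + dev C θ δ ζ + ζ) * D := by
  obtain ⟨ω, hω, h⟩ := exists_round hp hsys hst
  refine ⟨_, _, hst.next hp hsys hnw hτ (fun v => (h v).1) (fun v => (h v).2.1) (fun v => (h v).2.2.2),
    hg.next hsys hω, fun v => (card_newCol_le hp hnw (h v).2.2.1 (h v).2.2.2).trans ?_⟩
  have := mul_le_mul_of_nonneg_left (hd v) (by linarith [hp.θ1] : 0 ≤ 1 - θ)
  linarith

end Multi

namespace Multi
variable {V E : Type*} [Fintype V] [DecidableEq V] [Fintype E] [DecidableEq E] {H : Multi V E}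
variable {Γ : Type*} [Fintype Γ] [DecidableEq Γ]
variable {θ δ C ζ x : ℝ} {D B w k n : ℕ} {conf : E × Γ → E × Γ → Prop} {col : E → Option Γ}
  {l : Γ → E → ℝ}

theorem greedy_aux {Lst : E → Finset Γ} (hsys : H.System D B w conf) (U : Finset E)
    (A : E → Finset Γ) {d : ℕ} (hd : ∀ v, ((H.star v).filter fun f => f ∈ U).card ≤ d)
    (hA : ∀ e ∈ U, 2 * d + B < (A e).card) (hAL : ∀ e, A e ⊆ Lst e) (N : ℕ) :
    ∀ col : E → Option Γ, (univ.filter fun e => col e = none).card = N →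
    (∀ e, col e = none → e ∈ U) → (∀ e γ, col e = some γ → γ ∈ Lst e) →
    (∀ e f v γ, H.inc e v → H.inc f v → col e = some γ → col f = some γ → e = f) →
    (∀ e f γ γ', col e = some γ → col f = some γ' → ¬ conf (e, γ) (f, γ')) →
    (∀ e f v γ, col e = none → H.inc e v → H.inc f v → γ ∈ A e → col f = some γ → f ∈ U) →
    ∃ c : E → Γ, (∀ e, c e ∈ Lst e) ∧ (∀ e f v, H.inc e v → H.inc f v → c e = c f → e = f) ∧
      ∀ e f, ¬ conf (e, c e) (f, c f) := by
  induction N with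
  | zero =>
    intro col h0 _ h1 h2 h3 _
    rw [card_eq_zero, filter_eq_empty_iff] at h0
    have h4 : ∀ e, ∃ γ, col e = some γ := fun e => Option.ne_none_iff_exists'.1 (h0 (mem_univ e))
    choose c hc using h4
    exact ⟨c, fun e => h1 e _ (hc e), fun e f v he hf h => h2 e f v (c e) he hf (hc e) (h ▸ hc f),
      fun e f => h3 e f _ _ (hc e) (hc f)⟩
  | succ N ih =>
    intro col hN hU h1 h2 h3 h5
    obtain ⟨e, he⟩ : (univ.filter fun e => col e = none).Nonempty := card_pos.1 (by omega)
    have hen := (mem_filter.1 he).2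
    set F : Finset Γ := (((H.star (H.s e)).filter fun f => f ∈ U) ∪
      ((H.star (H.t e)).filter fun f => f ∈ U)).biUnion (fun f => (col f).toFinset) ∪
      univ.filter fun γ => blocked conf col (e, γ) with hF
    have hFc : F.card ≤ 2 * d + B := by
      refine (card_union_le _ _).trans (add_le_add ?_ (hsys.blk col e))
      refine card_biUnion_le.trans ((sum_le_card_nsmul _ _ 1 fun f _ => ?_).trans ?_)
      · cases col f <;> simp
      · rw [smul_eq_mul, mul_one]
        have := card_union_le ((H.star (H.s e)).filter fun f => f ∈ U) ((H.star (H.t e)).filter fun f => f ∈ U)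
        have := hd (H.s e)
        have := hd (H.t e)
        omega
    obtain ⟨γ, hγA, hγF⟩ := exists_mem_notMem_of_card_lt_card (hFc.trans_lt (hA e (hU e hen)))
    rw [hF, mem_union, not_or] at hγF
    have hb : ¬ blocked conf col (e, γ) := fun h => hγF.2 (mem_filter.2 ⟨mem_univ _, h⟩)
    have hadj : ∀ f v, H.inc e v → H.inc f v → col f ≠ some γ := by
      intro f v hev hfv hcf
      have hfU := h5 e f v γ hen hev hfv hγA hcf
      apply hγF.1
      refine mem_biUnion.2 ⟨f, ?_, by simp [hcf]⟩
      rcases hev with rfl | rfl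
      · exact mem_union_left _ (mem_filter.2 ⟨mem_star.2 hfv, hfU⟩)
      · exact mem_union_right _ (mem_filter.2 ⟨mem_star.2 hfv, hfU⟩)
    have hup : ∀ f γ', Function.update col e (some γ) f = some γ' →
        (f = e ∧ γ' = γ) ∨ (f ≠ e ∧ col f = some γ') := by
      intro f γ' h
      by_cases hf : f = e
      · subst hf; rw [Function.update_self] at h; exact Or.inl ⟨rfl, (Option.some.inj h).symm⟩
      · rw [Function.update_of_ne hf] at h; exact Or.inr ⟨hf, h⟩
    have hun : ∀ f, Function.update col e (some γ) f = none → f ≠ e ∧ col f = none := by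
      intro f h
      by_cases hf : f = e
      · subst hf; rw [Function.update_self] at h; cases h
      · rw [Function.update_of_ne hf] at h; exact ⟨hf, h⟩
    refine ih (Function.update col e (some γ)) ?_ (fun f hf => hU f (hun f hf).2) ?_ ?_ ?_ ?_
    · have : (univ.filter fun f => Function.update col e (some γ) f = none) =
          (univ.filter fun f => col f = none).erase e := by
        ext f
        rw [mem_erase, mem_filter, mem_filter]
        constructor
        · rintro ⟨_, h⟩; exact ⟨(hun f h).1, mem_univ _, (hun f h).2⟩
        · rintro ⟨hf, _, h⟩; exact ⟨mem_univ _, by rwa [Function.update_of_ne hf]⟩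
      rw [this, card_erase_of_mem he, hN]; rfl
    · intro f γ' h
      rcases hup f γ' h with ⟨rfl, rfl⟩ | ⟨_, h⟩
      · exact hAL f hγA
      · exact h1 f γ' h
    · intro f g v γ' hf hg hcf hcg
      rcases hup f γ' hcf with ⟨rfl, rfl⟩ | ⟨_, h⟩ <;> rcases hup g γ' hcg with ⟨hge, hγ⟩ | ⟨_, h'⟩
      · exact hge.symm
      · exact absurd h' (hadj g v hf hg)
      · subst hge; subst hγ; exact absurd h (hadj f v hg hf)
      · exact h2 f g v γ' hf hg h h'
    · intro f g γ₁ γ₂ hcf hcg hc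
      rcases hup f γ₁ hcf with ⟨rfl, rfl⟩ | ⟨_, h⟩ <;> rcases hup g γ₂ hcg with ⟨hge, hγ⟩ | ⟨_, h'⟩
      · rw [hge] at hc; exact hsys.irr _ _ _ hc
      · exact hb ⟨g, γ₂, h', hc⟩
      · subst hge; subst hγ; exact hb ⟨f, γ₁, h, hsys.symm _ _ hc⟩
      · exact h3 f g γ₁ γ₂ h h' hc
    · intro f g v γ' hf hfv hgv hγ' hcg
      rcases hup g γ' hcg with ⟨rfl, rfl⟩ | ⟨_, h⟩
      · exact hU _ hen
      · exact h5 f g v γ' (hun f hf).2 hfv hgv hγ' h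

theorem card_avail_ge (hst : H.State D C δ col l) (hC : 0 < C) (hD : 0 < D) (hδ : δ ≤ 1 / 2) {e : E}
    (he : col e = none) : (D : ℝ) / (2 * C) ≤ (univ.filter fun γ => l γ e ≠ 0).card := by
  have hD0 : (0 : ℝ) < D := by exact_mod_cast hD
  have h1 := (abs_le.1 (hst.S e he)).1
  have h2 : H.S l e ≤ (univ.filter fun γ => l γ e ≠ 0).card * (C / D) := by
    calc H.S l e ≤ ∑ γ, l γ e := sum_le_sum fun γ _ => marg_le (hst.nonneg γ) e
      _ = ∑ γ ∈ univ.filter (fun γ => l γ e ≠ 0), l γ e := (sum_filter_ne_zero _).symm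
      _ ≤ (univ.filter fun γ => l γ e ≠ 0).card • (C / D) :=
        sum_le_card_nsmul _ _ _ fun γ _ => hst.le γ e
      _ = _ := nsmul_eq_mul _ _
  rw [div_le_iff₀ (by positivity)]
  have h3 : (1 : ℝ) / 2 ≤ (univ.filter fun γ => l γ e ≠ 0).card * (C / D) := by linarith
  rw [← mul_div_assoc, le_div_iff₀ hD0] at h3
  linarith

theorem greedy {Lst : E → Finset Γ} (hsys : H.System D B w conf) (hst : H.State D C δ col l)
    (hg : H.Good Lst conf col l) (hC : 0 < C) (hD : 0 < D) (hδ : δ ≤ 1 / 2) {d : ℝ} (hd0 : 0 ≤ d)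
    (hd : ∀ v, (((H.star v).filter fun f => col f = none).card : ℝ) ≤ d * D)
    (hdB : 2 * (d * D) + B < D / (2 * C)) :
    ∃ c : E → Γ, (∀ e, c e ∈ Lst e) ∧ (∀ e f v, H.inc e v → H.inc f v → c e = c f → e = f) ∧
      ∀ e f, ¬ conf (e, c e) (f, c f) := by
  refine greedy_aux hsys (univ.filter fun e => col e = none) (fun e => univ.filter fun γ => l γ e ≠ 0)
    (d := ⌊d * D⌋₊) (fun v => ?_) (fun e he => ?_) (fun e γ hγ => hg.supp e γ (mem_filter.1 hγ).2) _ col rfl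
    (fun e he => mem_filter.2 ⟨mem_univ _, he⟩) hg.mem hg.proper hg.noconf ?_
  · refine Nat.le_floor ?_
    simpa using hd v
  · have h1 := card_avail_ge hst hC hD hδ (mem_filter.1 he).2
    have h2 := Nat.floor_le (by positivity : 0 ≤ d * (D : ℝ))
    have h3 : ((2 * ⌊d * D⌋₊ + B : ℕ) : ℝ) < (univ.filter fun γ => l γ e ≠ 0).card := by
      push_cast; linarith
    exact_mod_cast h3
  · intro e f v γ _ hev hfv hγ hcf
    exact absurd hcf (hg.avail e f v γ hev hfv (mem_filter.1 hγ).2)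

end Multi

namespace Multi

/-- The bound on the deviation after `i` rounds. -/
def devSeq (a θ : ℝ) (i : ℕ) : ℝ := 8 * θ * ((1 + a * θ) ^ i - 1)

theorem devSeq_nonneg {a θ : ℝ} (ha : 0 ≤ a) (hθ : 0 ≤ θ) (i : ℕ) : 0 ≤ devSeq a θ i := by
  have : 1 ≤ (1 + a * θ) ^ i := one_le_pow₀ (by nlinarith [mul_nonneg ha hθ])
  unfold devSeq
  exact mul_nonneg (by positivity) (by linarith)

theorem devSeq_succ (a θ : ℝ) (i : ℕ) :
    devSeq a θ (i + 1) = (1 + a * θ) * devSeq a θ i + 8 * a * θ ^ 2 := by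
  unfold devSeq; rw [pow_succ]; ring

theorem dev_le {C θ δ : ℝ} (hC : 1 ≤ C) (hθ0 : 0 ≤ θ) (hθ1 : θ ≤ 1) :
    dev C θ δ (θ ^ 2) ≤ C * (θ * δ + 6 * θ ^ 2) := by
  have h1 : θ ^ 3 ≤ θ ^ 2 := pow_le_pow_of_le_one hθ0 hθ1 (by norm_num)
  have h2 : C * θ ^ 3 ≤ C * θ ^ 2 := mul_le_mul_of_nonneg_left h1 (by linarith)
  have h3 : 1 * θ ^ 2 ≤ C * θ ^ 2 := mul_le_mul_of_nonneg_right hC (by positivity)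
  unfold dev
  nlinarith

theorem roundErr_le {C θ δ : ℝ} (hC : 1 ≤ C) (hθ0 : 0 ≤ θ) (hθ1 : θ ≤ 1) (hδ : 0 ≤ δ) :
    roundErr C θ δ (θ ^ 2) ≤ C ^ 2 * (4 * (θ * δ) + 29 * θ ^ 2) := by
  have h1 := dev_le (δ := δ) hC hθ0 hθ1
  have h2 : dev C θ δ (θ ^ 2) + C * θ ^ 2 ≤ C * (θ * δ + 7 * θ ^ 2) := by linarith
  have h3 : 2 * (dev C θ δ (θ ^ 2) + C * θ ^ 2) * (1 + C) ≤ 2 * (C * (θ * δ + 7 * θ ^ 2)) * (1 + C) := by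
    have := mul_le_mul_of_nonneg_right h2 (by linarith : 0 ≤ 1 + C)
    linarith
  have h4 : 0 ≤ θ * δ + 7 * θ ^ 2 := by positivity
  have h5 : 2 * (C * (θ * δ + 7 * θ ^ 2)) * (1 + C) ≤ C ^ 2 * (4 * (θ * δ + 7 * θ ^ 2)) := by
    have : C * 1 ≤ C * C := mul_le_mul_of_nonneg_left hC (by linarith)
    nlinarith
  have h6 : θ ^ 2 ≤ C ^ 2 * θ ^ 2 := by
    have : 1 ≤ C ^ 2 := one_le_pow₀ hC
    nlinarith [sq_nonneg θ]
  unfold roundErr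
  linarith

/-- The parameters of the rounds: all of the `K` rounds are admissible. -/
structure Sched (C θ : ℝ) (K : ℕ) : Prop where
  C1 : 1 ≤ C
  θ0 : 0 < θ
  θ1 : θ ≤ 1 / 2
  small : 33 * C ^ 2 * θ ≤ 1
  last : ∀ i ≤ K, devSeq (48 * C ^ 2) θ i ≤ 1 / 4
  deg : (1 - θ) ^ K + C * (devSeq (48 * C ^ 2) θ K + 7 * θ) ≤ 1 / (16 * C)

theorem devSeq_mono {a θ : ℝ} (ha : 0 ≤ a) (hθ : 0 ≤ θ) {i j : ℕ} (h : i ≤ j) :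
    devSeq a θ i ≤ devSeq a θ j := by
  unfold devSeq
  have : (1 + a * θ) ^ i ≤ (1 + a * θ) ^ j :=
    pow_le_pow_right₀ (by nlinarith [mul_nonneg ha hθ]) h
  exact mul_le_mul_of_nonneg_left (by linarith) (by positivity)

theorem exists_sched {C : ℝ} (hC : 1 ≤ C) : ∃ θ K, Sched C θ K := by
  have hC0 : 0 < C := by linarith
  obtain ⟨T, hT⟩ : ∃ T : ℕ, Real.exp (-(T : ℝ)) ≤ 1 / (32 * C) := by
    obtain ⟨T, hT⟩ := exists_nat_ge (32 * C)
    refine ⟨T, ?_⟩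
    rw [Real.exp_neg, one_div]
    refine inv_anti₀ (by positivity) (hT.trans ?_)
    have := Real.add_one_le_exp (T : ℝ)
    linarith
  set a := 48 * C ^ 2 with ha
  have ha0 : 0 ≤ a := by positivity
  set M := Real.exp (a * T) with hM
  have hM0 : 0 < M := Real.exp_pos _
  obtain ⟨N, hN⟩ := exists_nat_ge (max 2 (max (33 * C ^ 2) (max (32 * M) (32 * C ^ 2 * (8 * M + 7)))))
  have hN2 : (2 : ℝ) ≤ N := (le_max_left _ _).trans hN
  have hN3 : 33 * C ^ 2 ≤ N := ((le_max_left _ _).trans (le_max_right _ _)).trans hN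
  have hN4 : 32 * M ≤ N :=
    ((le_max_left _ _).trans ((le_max_right _ _).trans (le_max_right _ _))).trans hN
  have hN5 : 32 * C ^ 2 * (8 * M + 7) ≤ N :=
    ((le_max_right _ _).trans ((le_max_right _ _).trans (le_max_right _ _))).trans hN
  have hN0 : (0 : ℝ) < N := by linarith
  have hdev : devSeq a (1 / N) (T * N) ≤ 8 * (1 / N) * M := by
    unfold devSeq
    refine mul_le_mul_of_nonneg_left ?_ (by positivity)
    have h1 : (1 + a * (1 / N)) ^ (T * N) ≤ M := by
      have h2 : 1 + a * (1 / N) ≤ Real.exp (a / N) := by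
        have := Real.add_one_le_exp (a / N)
        rw [mul_one_div]; linarith
      refine (pow_le_pow_left₀ (by positivity) h2 _).trans (le_of_eq ?_)
      rw [← Real.exp_nat_mul, hM]
      congr 1
      push_cast
      field_simp
    linarith
  refine ⟨1 / N, T * N, hC, by positivity, ?_, ?_, fun i hi => ?_, ?_⟩
  · rw [div_le_div_iff₀ hN0 (by norm_num)]; linarith
  · rw [mul_one_div, div_le_one hN0]; exact hN3
  · refine (devSeq_mono ha0 (by positivity) hi).trans (hdev.trans ?_)
    rw [mul_one_div, div_mul_eq_mul_div, div_le_div_iff₀ hN0 (by norm_num)]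
    linarith
  · have h1 : (1 - 1 / (N : ℝ)) ^ (T * N) ≤ 1 / (32 * C) := by
      have h2 : 1 - 1 / (N : ℝ) ≤ Real.exp (-(1 / N)) := by
        have := Real.add_one_le_exp (-(1 / (N : ℝ)))
        linarith
      have h3 : 0 ≤ 1 - 1 / (N : ℝ) := by
        rw [sub_nonneg, div_le_one hN0]; linarith
      refine (pow_le_pow_left₀ h3 h2 _).trans (le_trans (le_of_eq ?_) hT)
      rw [← Real.exp_nat_mul]
      congr 1
      push_cast
      field_simp
    have h4 : C * (devSeq a (1 / N) (T * N) + 7 * (1 / N)) ≤ 1 / (32 * C) := by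
      calc C * (devSeq a (1 / N) (T * N) + 7 * (1 / N)) ≤ C * (8 * (1 / N) * M + 7 * (1 / N)) := by gcongr
        _ = C * (8 * M + 7) / N := by ring
        _ ≤ 1 / (32 * C) := by
          rw [div_le_div_iff₀ hN0 (by positivity)]
          nlinarith
    have h5 : 1 / (32 * C) + 1 / (32 * C) = 1 / (16 * C) := by field_simp; norm_num
    linarith

section
variable {V E : Type*} [Fintype V] [DecidableEq V] [Fintype E] [DecidableEq E] {H : Multi V E}
variable {Γ : Type*} [Fintype Γ] [DecidableEq Γ]
variable {θ C x : ℝ} {D B w k n K : ℕ} {conf : E × Γ → E × Γ → Prop} {l : Γ → E → ℝ}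

theorem exists_state {Lst : E → Finset Γ} (hs : Sched C θ K) (hsys : H.System D B w conf)
    (hp : ∀ δ, 0 ≤ δ → δ ≤ 1 / 4 → Params θ δ C (θ ^ 2) x D B k n)
    (hst : H.State D C 0 (fun _ => none) l) (hg : H.Good Lst conf (fun _ => none) l)
    (hnw : ((2 * n * (1 + w) : ℕ) : ℝ) ≤ θ ^ 2 * D) (i : ℕ) (hi : i ≤ K) :
    ∃ col l', H.State D C (devSeq (48 * C ^ 2) θ i) col l' ∧ H.Good Lst conf col l' ∧
      ∀ v, (((H.star v).filter fun f => col f = none).card : ℝ) ≤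
        ((1 - θ) ^ i + C * (devSeq (48 * C ^ 2) θ K + 7 * θ)) * D := by
  have hC := hs.C1
  have hθ0 := hs.θ0.le
  have hθ1 : θ ≤ 1 := by linarith [hs.θ1]
  have ha0 : 0 ≤ 48 * C ^ 2 := by positivity
  have hK0 := devSeq_nonneg ha0 hθ0 K
  induction i with
  | zero =>
    refine ⟨_, l, ?_, hg, fun v => ?_⟩
    · simpa [devSeq] using hst
    · have h1 : (((H.star v).filter fun f => (none : Option Γ) = none).card : ℝ) ≤ 1 * D := by
        rw [one_mul]
        exact_mod_cast (card_filter_le _ _).trans (hsys.deg v)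
      refine h1.trans (mul_le_mul_of_nonneg_right ?_ (Nat.cast_nonneg _))
      have : 0 ≤ C * (devSeq (48 * C ^ 2) θ K + 7 * θ) := by positivity
      rw [pow_zero]; linarith
  | succ i ih =>
    obtain ⟨col, l', hst', hg', hd⟩ := ih (by omega)
    have hδ0 := devSeq_nonneg ha0 hθ0 i
    have hδ1 := hs.last i (by omega)
    have hτ := roundErr_le hC hθ0 hθ1 hδ0
    have hθδ : θ * devSeq (48 * C ^ 2) θ i ≤ θ * 1 := mul_le_mul_of_nonneg_left (by linarith) hθ0
    have hC2 : 0 ≤ C ^ 2 := by positivity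
    have hτ1 : roundErr C θ (devSeq (48 * C ^ 2) θ i) (θ ^ 2) ≤ 1 := by
      refine hτ.trans (le_trans ?_ hs.small)
      have : 4 * (θ * devSeq (48 * C ^ 2) θ i) + 29 * θ ^ 2 ≤ 33 * θ := by nlinarith
      have := mul_le_mul_of_nonneg_left this hC2
      linarith
    obtain ⟨col', l'', h1, h2, h3⟩ := round (hp _ hδ0 hδ1) hsys hst' hg' hnw hτ1 hd
    refine ⟨col', l'', ⟨h1.nonneg, h1.le, h1.cols, h1.zero, fun e he => (h1.S e he).trans ?_⟩, h2,
      fun v => (h3 v).trans (mul_le_mul_of_nonneg_right ?_ (Nat.cast_nonneg _))⟩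
    · rw [devSeq_succ]
      have : 1 * θ ^ 2 ≤ C ^ 2 * θ ^ 2 := mul_le_mul_of_nonneg_right (one_le_pow₀ hC) (by positivity)
      have : 0 ≤ C ^ 2 * θ ^ 2 := by positivity
      nlinarith
    · have h4 := dev_le (δ := devSeq (48 * C ^ 2) θ i) hC hθ0 hθ1
      have h5 : devSeq (48 * C ^ 2) θ i ≤ devSeq (48 * C ^ 2) θ K := devSeq_mono ha0 hθ0 (by omega)
      have h6 : C * (θ * devSeq (48 * C ^ 2) θ i) ≤ C * (θ * devSeq (48 * C ^ 2) θ K) := by gcongr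
      have h7 : 1 * θ ^ 2 ≤ C * θ ^ 2 := mul_le_mul_of_nonneg_right hC (by positivity)
      rw [pow_succ (1 - θ) i]
      nlinarith

end

theorem exists_err_le {C ζ : ℝ} (hC : 1 ≤ C) (hζ : 0 < ζ) : ∃ k, 144 * err C k ≤ ζ := by
  have h1 : C / (1 + C) < 1 := by rw [div_lt_one (by linarith)]; linarith
  obtain ⟨k, hk⟩ := exists_pow_lt_of_lt_one (by positivity : 0 < ζ / (144 * C)) h1
  refine ⟨k, ?_⟩
  rw [lt_div_iff₀ (by positivity)] at hk
  unfold err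
  linarith

theorem exists_large (κ : ℝ) (hκ : 0 < κ) (A : ℕ) : ∃ D₀ : ℕ, ∀ D : ℕ, D₀ ≤ D →
    2 * Real.exp (-κ * D) ≤ Real.exp (-Real.sqrt D) ∧
      64 * (D + 1 : ℝ) ^ A * Real.exp (-Real.sqrt D) ≤ 1 := by
  have hsq : Filter.Tendsto (fun D : ℕ => Real.sqrt D) Filter.atTop Filter.atTop :=
    Real.tendsto_sqrt_atTop.comp tendsto_natCast_atTop_atTop
  have h1 := (Real.tendsto_pow_mul_exp_neg_atTop_nhds_zero (2 * A)).comp hsq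
  have h2 := h1.eventually (gt_mem_nhds (by positivity : (0 : ℝ) < 1 / (64 * 2 ^ A)))
  have h3 := hsq.eventually_ge_atTop (max 1 (2 / κ))
  obtain ⟨D₀, hD₀⟩ := Filter.eventually_atTop.1 (h2.and h3)
  refine ⟨D₀, fun D hD => ?_⟩
  obtain ⟨h4, h5⟩ := hD₀ D hD
  have h6 : 1 ≤ Real.sqrt D := (le_max_left _ _).trans h5
  have h7 : 2 / κ ≤ Real.sqrt D := (le_max_right _ _).trans h5
  have hss : Real.sqrt D * Real.sqrt D = D := Real.mul_self_sqrt (Nat.cast_nonneg _)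
  constructor
  · have h8 : (2 : ℝ) ≤ Real.exp 1 := by have := Real.add_one_le_exp (1 : ℝ); linarith
    rw [div_le_iff₀ hκ] at h7
    calc 2 * Real.exp (-κ * D) ≤ Real.exp 1 * Real.exp (-κ * D) := by gcongr
      _ = Real.exp (1 + -κ * D) := (Real.exp_add _ _).symm
      _ ≤ _ := by
        refine Real.exp_le_exp.2 ?_
        have h9 : Real.sqrt D * 2 ≤ Real.sqrt D * (Real.sqrt D * κ) :=
          mul_le_mul_of_nonneg_left h7 (by linarith)
        rw [← mul_assoc, hss] at h9
        linarith
  · have h9 : (D + 1 : ℝ) ^ A ≤ 2 ^ A * Real.sqrt D ^ (2 * A) := by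
      rw [pow_mul, ← mul_pow]
      refine pow_le_pow_left₀ (by positivity) ?_ _
      nlinarith
    have h10 : Real.sqrt D ^ (2 * A) * Real.exp (-Real.sqrt D) < 1 / (64 * 2 ^ A) := h4
    calc 64 * (D + 1 : ℝ) ^ A * Real.exp (-Real.sqrt D)
        ≤ 64 * (2 ^ A * Real.sqrt D ^ (2 * A)) * Real.exp (-Real.sqrt D) := by gcongr
      _ = 64 * 2 ^ A * (Real.sqrt D ^ (2 * A) * Real.exp (-Real.sqrt D)) := by ring
      _ ≤ 64 * 2 ^ A * (1 / (64 * 2 ^ A)) := by gcongr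
      _ = 1 := by field_simp

theorem exists_witness_bound {C ζ : ℝ} (hC : 1 ≤ C) (hζ : 0 < ζ) {D B w : ℕ} (hD : 1 ≤ D)
    (hB : (B : ℝ) * (1 + w) ≤ ζ / (16 * C ^ 3 + 16) * D)
    (hw : Real.sqrt D * (1 + w) ≤ ζ / (16 * C ^ 3 + 16) * D) :
    ∃ n : ℕ, ((2 * n * (1 + w) : ℕ) : ℝ) ≤ ζ * D ∧
      (1 / 2) ^ n * Real.exp (2 * (2 * C ^ 3 * B)) ≤ Real.exp (-Real.sqrt D) := by
  have hw0 : (0 : ℝ) < 1 + w := by positivity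
  have hD0 : (1 : ℝ) ≤ D := by exact_mod_cast hD
  set y := ζ * D / (2 * (1 + w)) with hy
  have hy0 : 0 ≤ y := by positivity
  have hyw : y * (2 * (1 + w)) = ζ * D := by rw [hy]; field_simp
  refine ⟨⌊y⌋₊, ?_, ?_⟩
  · push_cast
    have h1 := Nat.floor_le hy0
    calc 2 * (⌊y⌋₊ : ℝ) * (1 + w) ≤ 2 * y * (1 + w) := by gcongr
      _ = ζ * D := by rw [← hyw]; ring
  · have h1 := Nat.lt_floor_add_one y
    have h2 : (1 / 2 : ℝ) ^ ⌊y⌋₊ ≤ Real.exp (-(⌊y⌋₊ / 2)) := by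
      have h3 : (1 / 2 : ℝ) ≤ Real.exp (-(1 / 2)) := by
        have := Real.add_one_le_exp (-(1 / 2) : ℝ); linarith
      refine (pow_le_pow_left₀ (by norm_num) h3 _).trans (le_of_eq ?_)
      rw [← Real.exp_nat_mul]; congr 1; ring
    refine (mul_le_mul_of_nonneg_right h2 (Real.exp_pos _).le).trans ?_
    rw [← Real.exp_add]
    refine Real.exp_le_exp.2 ?_
    have hs1 : 1 ≤ Real.sqrt D := by rw [Real.one_le_sqrt]; exact hD0
    have hC3 : 0 < 16 * C ^ 3 + 16 := by positivity
    rw [div_mul_eq_mul_div, le_div_iff₀ hC3] at hB hw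
    have key : 8 * (4 * C ^ 3 * B + 2 * Real.sqrt D) * (1 + w) ≤ 4 * (y * (1 + w)) := by
      have h4 : (B : ℝ) * (1 + w) * (16 * C ^ 3) ≤ B * (1 + w) * (16 * C ^ 3 + 16) := by
        refine mul_le_mul_of_nonneg_left (by linarith) (by positivity)
      have h5 : Real.sqrt D * (1 + w) * 16 ≤ Real.sqrt D * (1 + w) * (16 * C ^ 3 + 16) := by
        refine mul_le_mul_of_nonneg_left ?_ (by positivity)
        have : 0 ≤ C ^ 3 := by positivity
        linarith
      nlinarith
    have key2 : 8 * (4 * C ^ 3 * B + 2 * Real.sqrt D) ≤ 4 * y := by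
      have : 8 * (4 * C ^ 3 * B + 2 * Real.sqrt D) * (1 + w) ≤ (4 * y) * (1 + w) := by linarith
      exact le_of_mul_le_mul_right this hw0
    linarith

/-- Edge colourings from lists, avoiding a sparse set of conflicts, for multigraphs on which
suitable activities exist. -/
theorem exists_colouring_of_activity {C : ℝ} (hC : 1 ≤ C) : ∃ η : ℝ, 0 < η ∧ ∃ D₀ : ℕ, ∀ D : ℕ, D₀ ≤ D →
    ∀ (V E Γ : Type) [Fintype V] [DecidableEq V] [Fintype E] [DecidableEq E] [Fintype Γ] [DecidableEq Γ]
      (H : Multi V E) (B w : ℕ) (conf : E × Γ → E × Γ → Prop) (Lst : E → Finset Γ) (l : Γ → E → ℝ),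
      (B : ℝ) * (1 + w) ≤ η * D → Real.sqrt D * (1 + w) ≤ η * D →
      H.System D B w conf → H.State D C 0 (fun _ => none) l → H.Good Lst conf (fun _ => none) l →
      ∃ c : E → Γ, (∀ e, c e ∈ Lst e) ∧ (∀ e f v, H.inc e v → H.inc f v → c e = c f → e = f) ∧
        ∀ e f, ¬ conf (e, c e) (f, c f) := by
  obtain ⟨θ, K, hs⟩ := exists_sched hC
  have hθ0 := hs.θ0
  have hθ1 := hs.θ1
  have hζ0 : 0 < θ ^ 2 := by positivity
  have hζ1 : θ ^ 2 ≤ 1 / 4 := by nlinarith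
  obtain ⟨k, hk⟩ := exists_err_le hC hζ0
  obtain ⟨D₁, hD₁⟩ := exists_large ((θ ^ 2) ^ 2 / (32 * C ^ 3)) (by positivity)
    (5 + (2 * (k + 1) + 1) * (k + 1) + (2 * (k + 3) + 4))
  obtain ⟨D₂, hD₂⟩ := exists_nat_ge (2 * C / θ ^ 2)
  have hη0 : 0 < θ ^ 2 / (16 * C ^ 3 + 16) := by positivity
  refine ⟨min (θ ^ 2 / (16 * C ^ 3 + 16)) (1 / (8 * C)), lt_min hη0 (by positivity),
    max D₁ (max D₂ (k + 1)), ?_⟩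
  intro D hD V E Γ _ _ _ _ _ _ H B w conf Lst l hB hw hsys hst hg
  have hDD₁ : D₁ ≤ D := (le_max_left _ _).trans hD
  have hDD₂ : D₂ ≤ D := ((le_max_left _ _).trans (le_max_right _ _)).trans hD
  have hDk : k + 1 ≤ D := ((le_max_right _ _).trans (le_max_right _ _)).trans hD
  have hDn : 0 < D := by omega
  have hD0 : (0 : ℝ) < D := by exact_mod_cast hDn
  have hB2 : (B : ℝ) * (1 + w) ≤ θ ^ 2 / (16 * C ^ 3 + 16) * D :=
    hB.trans (mul_le_mul_of_nonneg_right (min_le_left _ _) hD0.le)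
  have hw2 : Real.sqrt D * (1 + w) ≤ θ ^ 2 / (16 * C ^ 3 + 16) * D :=
    hw.trans (mul_le_mul_of_nonneg_right (min_le_left _ _) hD0.le)
  have hBs : (B : ℝ) ≤ 1 / (8 * C) * D := by
    refine le_trans ?_ (hB.trans (mul_le_mul_of_nonneg_right (min_le_right _ _) hD0.le))
    have : (0 : ℝ) ≤ B * w := by positivity
    linarith
  have hBD : (B : ℝ) ≤ D := by
    refine hBs.trans (mul_le_of_le_one_left hD0.le ?_)
    rw [div_le_one (by positivity)]; linarith
  obtain ⟨n, hn1, hn2⟩ := exists_witness_bound hC hζ0 hDn hB2 hw2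
  obtain ⟨hx1, hx3⟩ := hD₁ D hDD₁
  have hCD : C / D ≤ θ ^ 2 / 2 := by
    have h1 : 2 * C / θ ^ 2 ≤ D := hD₂.trans (by exact_mod_cast hDD₂)
    rw [div_le_iff₀ hζ0] at h1
    rw [div_le_div_iff₀ hD0 (by norm_num)]
    linarith
  have hp : ∀ δ, 0 ≤ δ → δ ≤ 1 / 4 → Params θ δ C (θ ^ 2) (Real.exp (-Real.sqrt D)) D B k n :=
    fun δ hδ0 hδ1 => ⟨hθ0.le, hθ1, hδ0, by linarith, hC, hζ0, by linarith, by exact_mod_cast hBD, hDk,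
      hCD, hk, hx1, hn2, hx3⟩
  obtain ⟨col, l', h1, h2, h3⟩ := exists_state hs hsys hp hst hg hn1 K le_rfl
  have hdeg := hs.deg
  have hd0 : 0 ≤ (1 - θ) ^ K + C * (devSeq (48 * C ^ 2) θ K + 7 * θ) := by
    have := devSeq_nonneg (by positivity : 0 ≤ 48 * C ^ 2) hθ0.le K
    have : 0 ≤ 1 - θ := by linarith
    positivity
  refine greedy hsys h1 h2 (by linarith) hDn (by linarith [hs.last K le_rfl]) hd0 h3 ?_
  have h4 : ((1 - θ) ^ K + C * (devSeq (48 * C ^ 2) θ K + 7 * θ)) * D ≤ 1 / (16 * C) * D :=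
    mul_le_mul_of_nonneg_right hdeg hD0.le
  have e1 : 1 / (16 * C) * (D : ℝ) = D / (2 * C) / 8 := by field_simp; norm_num
  have e2 : 1 / (8 * C) * (D : ℝ) = D / (2 * C) / 4 := by field_simp; norm_num
  have : 0 < (D : ℝ) / (2 * C) := by positivity
  linarith

end Multi

namespace Multi

/-- Edge colourings from lists whose fractional relaxation is well inside the matching polytope. -/
theorem exists_list_colouring_of_fractional {δ κ : ℝ} (hδ : 0 < δ) (hδ1 : δ ≤ 1) (hκ : 1 ≤ κ) :
    ∃ η : ℝ, 0 < η ∧ ∃ D₀ : ℕ, ∀ D : ℕ, D₀ ≤ D →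
    ∀ (V E Γ : Type) [Fintype V] [DecidableEq V] [Fintype E] [DecidableEq E] [Fintype Γ] [DecidableEq Γ]
      (H : Multi V E) (B w : ℕ) (conf : E × Γ → E × Γ → Prop) (Lst : E → Finset Γ),
      (B : ℝ) * (1 + w) ≤ η * D → Real.sqrt D * (1 + w) ≤ η * D →
      H.System D B w conf → (∀ e, (D : ℝ) ≤ κ * (Lst e).card) → (∀ e, ((Lst e).card : ℝ) ≤ κ * D) →
      (∀ v, ∑ e ∈ H.star v, 1 / ((Lst e).card : ℝ) ≤ 1 - δ) →
      (∀ X : Finset V, ∑ e ∈ H.inside X, 1 / ((Lst e).card : ℝ) ≤ (1 - δ) * X.card / 3) →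
      ∃ c : E → Γ, (∀ e, c e ∈ Lst e) ∧ (∀ e f v, H.inc e v → H.inc f v → c e = c f → e = f) ∧
        ∀ e f, ¬ conf (e, c e) (f, c f) := by
  set A := 2 / scale δ (clsSize δ) with hA
  have hA0 : 0 < A := div_pos two_pos (scale_pos hδ _)
  have hC : 1 ≤ max κ (A * κ) := hκ.trans (le_max_left _ _)
  obtain ⟨η, hη, D₀, h⟩ := exists_colouring_of_activity hC
  refine ⟨η, hη, max D₀ 1, ?_⟩
  intro D hD V E Γ _ _ _ _ _ _ H B w conf Lst hB hw hsys hl1 hl2 hv hX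
  have hD0 : (0 : ℝ) < D := by exact_mod_cast (le_max_right _ _).trans hD
  have hcard : ∀ e, (0 : ℝ) < (Lst e).card := fun e => by
    by_contra hcon
    have := hl1 e
    nlinarith
  have key : ∀ γ, ∃ l : E → ℝ, (∀ e, 0 ≤ l e) ∧
      (∀ e, l e ≤ A * (if γ ∈ Lst e then 1 / ((Lst e).card : ℝ) else 0)) ∧
      ∀ e, H.marg l e = if γ ∈ Lst e then 1 / ((Lst e).card : ℝ) else 0 := by
    intro γ
    have hle : ∀ e, (if γ ∈ Lst e then 1 / ((Lst e).card : ℝ) else 0) ≤ 1 / ((Lst e).card : ℝ) := by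
      intro e
      split_ifs
      · exact le_rfl
      · have := hcard e; positivity
    refine exists_activity hδ hδ1 _ (fun e => ?_) (fun v => (sum_le_sum fun e _ => hle e).trans (hv v))
      (fun X => (sum_le_sum fun e _ => hle e).trans (hX X))
    have := hcard e
    split_ifs <;> positivity
  choose l hl0 hlA hlm using key
  have hsupp : ∀ e γ, l γ e ≠ 0 → γ ∈ Lst e := by
    intro e γ hne
    by_contra hcon
    have h1 := hlA γ e
    rw [if_neg hcon, mul_zero] at h1
    exact hne (le_antisymm h1 (hl0 γ e))
  refine h D ((le_max_left _ _).trans hD) V E Γ H B w conf Lst l hB hw hsys ⟨hl0, ?_, ?_, ?_, ?_⟩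
    ⟨?_, hsupp, ?_, ?_, ?_⟩
  · intro γ e
    refine (hlA γ e).trans ?_
    have h1 : (if γ ∈ Lst e then 1 / ((Lst e).card : ℝ) else 0) ≤ κ / D := by
      split_ifs
      · rw [div_le_div_iff₀ (hcard e) hD0]; linarith [hl1 e]
      · positivity
    calc A * (if γ ∈ Lst e then 1 / ((Lst e).card : ℝ) else 0) ≤ A * (κ / D) := by gcongr
      _ = A * κ / D := by ring
      _ ≤ _ := by gcongr; exact le_max_right _ _
  · intro e
    refine le_trans (Nat.cast_le.2 (card_le_card fun γ hγ => hsupp e γ (mem_filter.1 hγ).2)) ((hl2 e).trans ?_)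
    gcongr; exact le_max_left _ _
  · intro γ e hne; exact absurd rfl hne
  · intro e _
    have : H.S l e = 1 := by
      unfold Multi.S
      simp only [hlm]
      rw [← sum_filter, sum_const, nsmul_eq_mul, filter_mem_eq_inter, univ_inter]
      have := hcard e
      field_simp
    rw [this]; simp
  · intro e γ h; cases h
  · intro e f v γ _ _ h; cases h
  · intro e f γ γ' h; cases h
  · intro e f v γ _ _ _ h; cases h

end Multi

namespace Multi

section
variable {V E : Type*} [Fintype V] [DecidableEq V] [Fintype E] [DecidableEq E] {H : Multi V E}

/-- The edges with exactly one end in `X`. -/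
def boundary (H : Multi V E) (X : Finset V) : Finset E :=
  univ.filter fun e => (H.s e ∈ X ∧ H.t e ∉ X) ∨ (H.s e ∉ X ∧ H.t e ∈ X)

theorem sum_sum_star (X : Finset V) (φ : E → V → ℝ) :
    ∑ a ∈ X, ∑ e ∈ H.star a, φ e a =
      ∑ e, ((if H.s e ∈ X then φ e (H.s e) else 0) + (if H.t e ∈ X then φ e (H.t e) else 0)) := by
  have h1 : ∀ a ∈ X, ∑ e ∈ H.star a, φ e a =
      ∑ e, ((if H.s e = a then φ e (H.s e) else 0) + (if H.t e = a then φ e (H.t e) else 0)) := by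
    intro a _
    rw [star, sum_filter]
    refine sum_congr rfl fun e _ => ?_
    have hne := H.ne e
    unfold inc
    by_cases hs : H.s e = a
    · have ht : H.t e ≠ a := fun ht => hne (hs.trans ht.symm)
      simp [hs, ht]
    · by_cases ht : H.t e = a
      · simp [hs, ht]
      · simp [hs, ht]
  rw [sum_congr rfl h1, sum_comm]
  refine sum_congr rfl fun e _ => ?_
  rw [sum_add_distrib, sum_ite_eq, sum_ite_eq]

theorem sum_inside_ends (X : Finset V) (g : V → ℝ) :
    ∑ e ∈ H.inside X, (g (H.s e) + g (H.t e)) =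
      ∑ v ∈ X, (((H.star v).filter fun e => e ∈ H.inside X).card : ℝ) * g v := by
  have h1 := sum_sum_star (H := H) X fun e v => if e ∈ H.inside X then g v else 0
  have h2 : ∀ v ∈ X, ∑ e ∈ H.star v, (if e ∈ H.inside X then g v else 0) =
      (((H.star v).filter fun e => e ∈ H.inside X).card : ℝ) * g v := by
    intro v _
    rw [← sum_filter, sum_const, nsmul_eq_mul]
  rw [← sum_congr rfl h2, h1]
  conv_lhs => rw [← filter_univ_mem (H.inside X), sum_filter]
  refine sum_congr rfl fun e _ => ?_
  by_cases he : e ∈ H.inside X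
  · have := (mem_filter.1 he).2
    simp [he, this.1, this.2]
  · simp [he]

theorem sum_card_boundary (X : Finset V) :
    ∑ v ∈ X, (((H.star v).filter fun e => e ∈ H.boundary X).card : ℝ) = (H.boundary X).card := by
  have h1 := sum_sum_star (H := H) X fun e _ => if e ∈ H.boundary X then (1 : ℝ) else 0
  have h2 : ∀ v ∈ X, ∑ e ∈ H.star v, (if e ∈ H.boundary X then (1 : ℝ) else 0) =
      (((H.star v).filter fun e => e ∈ H.boundary X).card : ℝ) := by
    intro v _
    rw [← sum_filter, sum_const, nsmul_eq_mul, mul_one]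
  rw [← sum_congr rfl h2, h1]
  have h3 : ((H.boundary X).card : ℝ) = ∑ e, if e ∈ H.boundary X then (1 : ℝ) else 0 := by
    simp
  rw [h3]
  refine sum_congr rfl fun e _ => ?_
  by_cases he : e ∈ H.boundary X
  · rcases (mem_filter.1 he).2 with h | h <;> simp [he, h.1, h.2]
  · simp [he]

theorem card_inside_add_boundary (X : Finset V) {v : V} (hv : v ∈ X) :
    ((H.star v).filter fun e => e ∈ H.inside X).card +
      ((H.star v).filter fun e => e ∈ H.boundary X).card = (H.star v).card := by
  rw [← card_union_of_disjoint]
  · congr 1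
    ext e
    rw [mem_union, mem_filter, mem_filter, inside, boundary, mem_filter, mem_filter]
    constructor
    · rintro (h | h) <;> exact h.1
    · intro he
      have := mem_star.1 he
      unfold inc at this
      by_cases h1 : H.s e ∈ X <;> by_cases h2 : H.t e ∈ X
      · simp [he, h1, h2]
      · simp [he, h1, h2]
      · simp [he, h1, h2]
      · rcases this with rfl | rfl
        · exact absurd hv h1
        · exact absurd hv h2
  · rw [disjoint_left]
    intro e h1 h2
    have h3 := (mem_filter.1 (mem_filter.1 h1).2).2
    rcases (mem_filter.1 (mem_filter.1 h2).2).2 with h | h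
    · exact h.2 h3.2
    · exact h.1 h3.1

theorem boundary_singleton (v : V) : H.boundary {v} = H.star v := by
  ext e
  rw [mem_star, boundary, mem_filter]
  have := H.ne e
  unfold inc
  simp only [mem_singleton, mem_univ, true_and]
  constructor
  · rintro (h | h)
    · exact Or.inl h.1
    · exact Or.inr h.2
  · rintro (rfl | rfl)
    · exact Or.inl ⟨rfl, this.symm⟩
    · exact Or.inr ⟨this, rfl⟩

/-- The degrees, and the numbers `s v` of colours lost at the vertices, satisfy the conditions of
the colouring theorem. -/
structure Excess (H : Multi V E) (D : ℕ) (ε : ℝ) (s : V → ℝ) : Prop where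
  nonneg : ∀ v, 0 ≤ s v
  deg : ∀ v, (H.star v).card + s v ≤ D
  excess : ∀ X : Finset V, (∀ v ∈ X, (H.star v).Nonempty) →
    ∑ v ∈ X, s v - (H.boundary X).card ≤ ε * D * X.card / 10

variable {D : ℕ} {ε : ℝ} {s : V → ℝ}

theorem Excess.le (h : H.Excess D ε s) {v : V} (hv : (H.star v).Nonempty) :
    s v ≤ (1 / 2 + ε / 20) * D := by
  have h1 := h.excess {v} (fun u hu => by rw [mem_singleton.1 hu]; exact hv)
  rw [sum_singleton, boundary_singleton, card_singleton] at h1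
  have h2 := h.deg v
  push_cast at h1
  linarith

/-- Half of the length of the lists, reduced by the number of colours lost. -/
def half (D : ℕ) (ε : ℝ) (s : V → ℝ) (v : V) : ℝ := (3 / 4 + 9 * ε / 20) * D - s v

theorem Excess.half_ge (h : H.Excess D ε s) {v : V} (hv : (H.star v).Nonempty) :
    (1 / 4 + 2 * ε / 5) * D ≤ half D ε s v := by
  have := h.le hv
  unfold half
  linarith

theorem star_nonempty_s (e : E) : (H.star (H.s e)).Nonempty := ⟨e, mem_star.2 (inc_s e)⟩
theorem star_nonempty_t (e : E) : (H.star (H.t e)).Nonempty := ⟨e, mem_star.2 (inc_t e)⟩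

theorem Excess.sum_star_le (h : H.Excess D ε s) (hε : 0 < ε) (hD : 0 < D) (v : V) :
    ∑ e ∈ H.star v, 1 / (half D ε s (H.s e) + half D ε s (H.t e)) ≤
      (1 + ε / 10) / (1 + 3 * ε / 5) := by
  have hD0 : (0 : ℝ) < D := by exact_mod_cast hD
  have hs0 := h.nonneg v
  have hdeg := h.deg v
  have hc0 : (0 : ℝ) ≤ (H.star v).card := Nat.cast_nonneg _
  have hpos : 0 < (1 + 17 * ε / 20) * D - s v := by
    have : 0 < ε * D := by positivity
    linarith
  have h1 : ∀ e ∈ H.star v, 1 / (half D ε s (H.s e) + half D ε s (H.t e)) ≤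
      1 / ((1 + 17 * ε / 20) * D - s v) := by
    intro e he
    refine one_div_le_one_div_of_le hpos ?_
    have hs := h.half_ge (star_nonempty_s e)
    have ht := h.half_ge (star_nonempty_t e)
    rcases mem_star.1 he with rfl | rfl <;> unfold half at * <;> linarith
  refine (sum_le_sum h1).trans ?_
  rw [sum_const, nsmul_eq_mul, mul_one_div, div_le_div_iff₀ hpos (by positivity)]
  have h2 : (H.star v).card * (1 + 3 * ε / 5) ≤ (D - s v) * (1 + 3 * ε / 5) :=
    mul_le_mul_of_nonneg_right (by linarith) (by positivity)
  have h3 : 0 ≤ s v * ε := by positivity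
  have h4 : s v * ε ≤ D * ε := mul_le_mul_of_nonneg_right (by linarith) hε.le
  have h5 : s v * ε ^ 2 ≤ D * ε ^ 2 := mul_le_mul_of_nonneg_right (by linarith) (by positivity)
  nlinarith [mul_pos hD0 (pow_pos hε 2)]

theorem Excess.sum_inside_le (h : H.Excess D ε s) (hε : 0 < ε) (hD : 0 < D) (X : Finset V) :
    ∑ e ∈ H.inside X, 1 / (half D ε s (H.s e) + half D ε s (H.t e)) ≤
      (1 + ε / 10) / (1 + 3 * ε / 5) * X.card / 3 := by
  have hD0 : (0 : ℝ) < D := by exact_mod_cast hD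
  set Y := X.filter fun v => (H.star v).Nonempty with hY
  have hXY : H.inside X = H.inside Y := by
    ext e
    simp only [inside, mem_filter, mem_univ, true_and, hY, star_nonempty_s, star_nonempty_t, and_true]
  have hYX : (Y.card : ℝ) ≤ X.card := by exact_mod_cast card_filter_le _ _
  have hne : ∀ v ∈ Y, (H.star v).Nonempty := fun v hv => (mem_filter.1 hv).2
  have hT : ∀ v, (H.star v).Nonempty → 0 < half D ε s v := fun v hv =>
    lt_of_lt_of_le (by positivity) (h.half_ge hv)
  set c : ℝ := 3 / 4 + 9 * ε / 20 with hc
  have hc0 : 0 < c := by positivity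
  have h1 : ∑ e ∈ H.inside Y, 1 / (half D ε s (H.s e) + half D ε s (H.t e)) ≤
      ∑ e ∈ H.inside Y, (1 / (4 * half D ε s (H.s e)) + 1 / (4 * half D ε s (H.t e))) := by
    refine sum_le_sum fun e _ => ?_
    have ha := hT _ (star_nonempty_s e)
    have hb := hT _ (star_nonempty_t e)
    rw [div_add_div _ _ (by positivity) (by positivity), div_le_div_iff₀ (by positivity) (by positivity)]
    nlinarith [sq_nonneg (half D ε s (H.s e) - half D ε s (H.t e))]
  rw [hXY]
  refine h1.trans ?_
  rw [sum_inside_ends Y fun v => 1 / (4 * half D ε s v)]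
  have h2 : ∀ v ∈ Y, (((H.star v).filter fun e => e ∈ H.inside Y).card : ℝ) * (1 / (4 * half D ε s v)) ≤
      ((1 + ε / 10) / c + (s v - ((H.star v).filter fun e => e ∈ H.boundary Y).card - ε * D / 10) / (c * D)) / 4 := by
    intro v hv
    have hTv := hT v (hne v hv)
    have h3 := card_inside_add_boundary (H := H) Y hv
    have h4 : (((H.star v).filter fun e => e ∈ H.inside Y).card : ℝ) +
      ((H.star v).filter fun e => e ∈ H.boundary Y).card = (H.star v).card := by exact_mod_cast h3
    set p : ℝ := (((H.star v).filter fun e => e ∈ H.inside Y).card : ℝ)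
    set z : ℝ := (((H.star v).filter fun e => e ∈ H.boundary Y).card : ℝ) with hz
    have hz0 : 0 ≤ z := by rw [hz]; positivity
    have hdeg := h.deg v
    have hs0 := h.nonneg v
    have hs1 := h.le (hne v hv)
    have e1 : half D ε s v = c * D - s v := rfl
    have h5 : p / half D ε s v ≤ (1 + ε / 10) / c + (s v - z - ε * D / 10) / (c * D) := by
      have e2 : (1 + ε / 10) / c + (s v - z - ε * D / 10) / (c * D) = (D + s v - z) / (c * D) := by
        field_simp; ring
      rw [e2, div_le_div_iff₀ hTv (by positivity), e1]
      have h6 : p * (c * D) ≤ (D - s v - z) * (c * D) :=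
        mul_le_mul_of_nonneg_right (by linarith) (by positivity)
      have h7 : 0 ≤ s v * (2 * (c * D) - D - s v + z) := by
        refine mul_nonneg hs0 ?_
        have : 0 < ε * D := by positivity
        rw [hc]
        linarith
      nlinarith
    calc p * (1 / (4 * half D ε s v)) = p / half D ε s v / 4 := by field_simp
      _ ≤ _ := by linarith
  refine (sum_le_sum h2).trans ?_
  rw [← sum_div, sum_add_distrib, ← sum_div Y _ (c * D), sum_sub_distrib, sum_sub_distrib,
    sum_card_boundary, sum_const, sum_const, nsmul_eq_mul, nsmul_eq_mul]
  have h8 := h.excess Y hne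
  have h9 : (∑ v ∈ Y, s v - (H.boundary Y).card - Y.card * (ε * D / 10)) / (c * D) ≤ 0 :=
    div_nonpos_of_nonpos_of_nonneg (by linarith) (by positivity)
  have e3 : (Y.card : ℝ) * ((1 + ε / 10) / c) / 4 = (1 + ε / 10) / (1 + 3 * ε / 5) * Y.card / 3 := by
    have : c = 3 / 4 * (1 + 3 * ε / 5) := by rw [hc]; ring
    rw [this]; field_simp
  have h10 : (1 + ε / 10) / (1 + 3 * ε / 5) * Y.card / 3 ≤ (1 + ε / 10) / (1 + 3 * ε / 5) * X.card / 3 := by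
    gcongr
  linarith

end

/-- Edge colourings of multigraphs from lists whose lengths are reduced at the vertices. -/
theorem exists_list_colouring {ε : ℝ} (hε : 0 < ε) : ∃ η : ℝ, 0 < η ∧ ∃ D₀ : ℕ, ∀ D : ℕ, D₀ ≤ D →
    ∀ (V E Γ : Type) [Fintype V] [DecidableEq V] [Fintype E] [DecidableEq E] [Fintype Γ] [DecidableEq Γ]
      (H : Multi V E) (B w : ℕ) (conf : E × Γ → E × Γ → Prop) (Lst : E → Finset Γ) (s : V → ℝ),
      (B : ℝ) * (1 + w) ≤ η * D → Real.sqrt D * (1 + w) ≤ η * D →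
      H.System D B w conf → H.Excess D ε s →
      (∀ e, (3 / 2 + 9 * ε / 10) * D - s (H.s e) - s (H.t e) ≤ (Lst e).card) →
      ∃ c : E → Γ, (∀ e, c e ∈ Lst e) ∧ (∀ e f v, H.inc e v → H.inc f v → c e = c f → e = f) ∧
        ∀ e f, ¬ conf (e, c e) (f, c f) := by
  set δ := 1 - (1 + ε / 10) / (1 + 3 * ε / 5) with hδ
  have hδ0 : 0 < δ := by
    rw [hδ, sub_pos, div_lt_one (by positivity)]; linarith
  have hδ1 : δ ≤ 1 := by
    have : 0 ≤ (1 + ε / 10) / (1 + 3 * ε / 5) := by positivity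
    linarith
  obtain ⟨η, hη, D₀, h⟩ := exists_list_colouring_of_fractional (κ := 3 + ε) hδ0 hδ1 (by linarith)
  refine ⟨η, hη, max D₀ 1, ?_⟩
  intro D hD V E Γ _ _ _ _ _ _ H B w conf Lst s hB hw hsys hex hL
  have hDn : 0 < D := (le_max_right _ _).trans hD
  have hD1 : (1 : ℝ) ≤ D := by exact_mod_cast hDn
  have hsum : ∀ e, half D ε s (H.s e) + half D ε s (H.t e) =
      (3 / 2 + 9 * ε / 10) * D - s (H.s e) - s (H.t e) := fun e => by unfold half; ring
  have hlow : ∀ e, (1 / 2 + 4 * ε / 5) * D ≤ half D ε s (H.s e) + half D ε s (H.t e) := fun e => by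
    have := hex.half_ge (star_nonempty_s e)
    have := hex.half_ge (star_nonempty_t e)
    linarith
  have hpos : ∀ e, 0 < half D ε s (H.s e) + half D ε s (H.t e) := fun e =>
    lt_of_lt_of_le (by positivity) (hlow e)
  have hsub : ∀ e, ∃ L' ⊆ Lst e, L'.card = ⌈half D ε s (H.s e) + half D ε s (H.t e)⌉₊ := fun e =>
    exists_subset_card_eq (Nat.ceil_le.2 (by rw [hsum]; exact hL e))
  choose L' hL' hcard using hsub
  have hge : ∀ e, half D ε s (H.s e) + half D ε s (H.t e) ≤ (L' e).card := fun e => by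
    rw [hcard]; exact Nat.le_ceil _
  have hinv : ∀ e, 1 / ((L' e).card : ℝ) ≤ 1 / (half D ε s (H.s e) + half D ε s (H.t e)) := fun e =>
    one_div_le_one_div_of_le (hpos e) (hge e)
  suffices hcol : ∃ c : E → Γ, (∀ e, c e ∈ L' e) ∧
      (∀ e f v, H.inc e v → H.inc f v → c e = c f → e = f) ∧ ∀ e f, ¬ conf (e, c e) (f, c f) by
    obtain ⟨c, h1, h2⟩ := hcol
    exact ⟨c, fun e => hL' e (h1 e), h2⟩
  refine h D ((le_max_left _ _).trans hD) V E Γ H B w conf L' hB hw hsys ?_ ?_ ?_ ?_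
  · intro e
    have h1 := hlow e
    have h2 := hge e
    have h3 : (1 / 2 : ℝ) * D ≤ (L' e).card := by
      have : 0 < ε * D := by positivity
      linarith
    have h4 : (0 : ℝ) ≤ (L' e).card := by positivity
    nlinarith
  · intro e
    rw [hcard]
    have h1 := (Nat.ceil_lt_add_one (hpos e).le).le
    rw [hsum] at h1 ⊢
    have := hex.nonneg (H.s e)
    have := hex.nonneg (H.t e)
    have : 0 < ε * D := by positivity
    linarith
  · intro v
    refine (sum_le_sum fun e _ => hinv e).trans ((hex.sum_star_le hε hDn v).trans ?_)
    rw [hδ]; linarith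
  · intro X
    refine (sum_le_sum fun e _ => hinv e).trans ((hex.sum_inside_le hε hDn X).trans ?_)
    rw [hδ, sub_sub_cancel]

end Multi

theorem mem_Icc_of_abs_sub_lt {q : ℝ} {x y : ℤ} (h : |(x : ℝ) - y| < q) :
    x ∈ Finset.Icc (y - ⌊q⌋₊) (y + ⌊q⌋₊) := by
  have h1 : (x - y).natAbs ≤ ⌊q⌋₊ := by
    refine Nat.le_floor ?_
    rw [Nat.cast_natAbs]
    push_cast
    exact h.le
  rw [mem_Icc]
  omega

theorem card_window (y : ℤ) (k : ℕ) : (Finset.Icc (y - k) (y + k)).card = 2 * k + 1 := by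
  rw [Int.card_Icc]; omega

/-- `R` is the core of a removable subdivided multigraph with branch maps `a` and `b`;
vertices of degree at least `q` are large. -/
structure Core {V : Type} [Fintype V] [DecidableEq V] (G : SimpleGraph V) [DecidableRel G.Adj]
    (R : Finset V) (a b : V → V) (q : ℝ) : Prop where
  ne : ∀ r ∈ R, a r ≠ b r
  aR : ∀ r ∈ R, a r ∉ R
  bR : ∀ r ∈ R, b r ∉ R
  adja : ∀ r ∈ R, G.Adj r (a r)
  adjb : ∀ r ∈ R, G.Adj r (b r)
  dega : ∀ r ∈ R, q ≤ (G.degree (a r) : ℝ)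
  degb : ∀ r ∈ R, q ≤ (G.degree (b r) : ℝ)
  degr : ∀ r ∈ R, (G.degree r : ℝ) ≤ q
  low : ∀ r ∈ R, ∀ u, G.Adj r u → u ≠ a r → u ≠ b r → (G.degree u : ℝ) < q

namespace Core
variable {V : Type} [Fintype V] [DecidableEq V] {G : SimpleGraph V} [DecidableRel G.Adj]
  {R : Finset V} {a b : V → V} {q : ℝ}

/-- The multigraph of which `R` is the set of subdivision vertices. -/
def multi (h : Core G R a b q) : Multi V {r // r ∈ R} := ⟨fun r => a r.1, fun r => b r.1, fun r => h.ne r.1 r.2⟩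

/-- The vertices joined to `e` by a path of length two through a small vertex. -/
def second (G : SimpleGraph V) [DecidableRel G.Adj] (q : ℝ) (e : V) : Finset V :=
  ((G.neighborFinset e).filter fun w => (G.degree w : ℝ) < q).biUnion fun w => G.neighborFinset w

theorem mem_second {e f : V} :
    f ∈ second G q e ↔ ∃ w, G.Adj e w ∧ (G.degree w : ℝ) < q ∧ G.Adj w f := by
  simp [second, and_assoc]

theorem card_first (h : Core G R a b q) {e : V} (he : e ∈ R) : (G.neighborFinset e).card ≤ ⌊q⌋₊ := by
  rw [G.card_neighborFinset_eq_degree]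
  exact Nat.le_floor (h.degr e he)

theorem card_second (h : Core G R a b q) {e : V} (he : e ∈ R) : (second G q e).card ≤ ⌊q⌋₊ * ⌊q⌋₊ := by
  refine card_biUnion_le.trans ((sum_le_card_nsmul _ _ ⌊q⌋₊ fun w hw => ?_).trans ?_)
  · rw [G.card_neighborFinset_eq_degree]
    exact Nat.le_floor (mem_filter.1 hw).2.le
  · rw [smul_eq_mul]
    exact Nat.mul_le_mul_right _ ((card_filter_le _ _).trans (h.card_first he))

variable {S : Finset ℤ}

/-- Two coloured core vertices conflict because of a path that avoids the large vertices. -/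
def conf (G : SimpleGraph V) [DecidableRel G.Adj] (R : Finset V) (q : ℝ) (S : Finset ℤ)
    (x y : {r // r ∈ R} × {z // z ∈ S}) : Prop :=
  x.1 ≠ y.1 ∧ ((G.Adj x.1.1 y.1.1 ∧ |(x.2.1 : ℝ) - y.2.1| < q) ∨
    (x.2 = y.2 ∧ ∃ w, G.Adj x.1.1 w ∧ (G.degree w : ℝ) < q ∧ G.Adj w y.1.1))

theorem conf_cases {x y : {r // r ∈ R} × {z // z ∈ S}} (h : conf G R q S x y) :
    (y.1.1 ∈ G.neighborFinset x.1.1 ∧ y.2.1 ∈ Finset.Icc (x.2.1 - ⌊q⌋₊) (x.2.1 + ⌊q⌋₊) ∧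
      x.2.1 ∈ Finset.Icc (y.2.1 - ⌊q⌋₊) (y.2.1 + ⌊q⌋₊)) ∨
      (y.1.1 ∈ second G q x.1.1 ∧ x.2.1 = y.2.1) := by
  rcases h.2 with ⟨h1, h2⟩ | ⟨h1, h2⟩
  · refine Or.inl ⟨by simpa using h1, mem_Icc_of_abs_sub_lt ?_, mem_Icc_of_abs_sub_lt h2⟩
    rwa [abs_sub_comm]
  · exact Or.inr ⟨mem_second.2 h2, by rw [h1]⟩

theorem conf_symm {x y : {r // r ∈ R} × {z // z ∈ S}} (h : conf G R q S x y) : conf G R q S y x := by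
  refine ⟨h.1.symm, ?_⟩
  rcases h.2 with ⟨h1, h2⟩ | ⟨h1, w, h2, h3, h4⟩
  · exact Or.inl ⟨h1.symm, by rwa [abs_sub_comm]⟩
  · exact Or.inr ⟨h1.symm, w, h4.symm, h3, h2.symm⟩

theorem star_card_le (h : Core G R a b q) (v : V) :
    (h.multi.star v).card ≤ ((G.neighborFinset v).filter fun u => u ∈ R).card := by
  refine card_le_card_of_injOn Subtype.val (fun r hr => ?_) Subtype.val_injective.injOn
  have hr' : a r.1 = v ∨ b r.1 = v := Multi.mem_star.1 hr
  rw [mem_coe, mem_filter, SimpleGraph.mem_neighborFinset]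
  refine ⟨?_, r.2⟩
  rcases hr' with rfl | rfl
  · exact (h.adja _ r.2).symm
  · exact (h.adjb _ r.2).symm

theorem star_card_add_le (h : Core G R a b q) {D : ℕ} (hD : ∀ v, G.degree v ≤ D) (v : V) :
    (h.multi.star v).card + ((G.neighborFinset v).filter fun u => u ∉ R).card ≤ D := by
  have h1 := h.star_card_le v
  have h2 := card_filter_add_card_filter_not (s := G.neighborFinset v) (fun u => u ∈ R)
  have h3 := hD v
  rw [← G.card_neighborFinset_eq_degree] at h3
  omega

theorem system (h : Core G R a b q) {D : ℕ} (hD : ∀ v, G.degree v ≤ D) (S : Finset ℤ) :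
    h.multi.System D (4 * ⌊q⌋₊ ^ 2) (2 * ⌊q⌋₊ + 1) (conf G R q S) := by
  set k := ⌊q⌋₊ with hk
  have hk2 : k * (2 * k + 1) + k * k ≤ 4 * k ^ 2 := by
    rcases Nat.eq_zero_or_pos k with h0 | h0
    · simp [h0]
    · nlinarith
  have hk3 : k + k * k ≤ 4 * k ^ 2 := le_trans (by nlinarith) hk2
  refine ⟨fun v => (Nat.le_add_right _ _).trans (h.star_card_add_le hD v), fun p r => conf_symm, ?_, ?_, ?_, ?_, ?_⟩
  · intro e γ γ' hc
    exact hc.1 rfl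
  · intro p
    refine le_trans (card_le_card_of_injOn (fun r => (r.1.1, r.2.1))
      (t := G.neighborFinset p.1.1 ×ˢ Finset.Icc (p.2.1 - k) (p.2.1 + k) ∪ second G q p.1.1 ×ˢ {p.2.1})
      (fun r hr => ?_) ?_) ?_
    · rw [mem_coe, mem_union, mem_product, mem_product]
      rcases conf_cases (mem_filter.1 hr).2 with h1 | h1
      · exact Or.inl ⟨h1.1, h1.2.1⟩
      · exact Or.inr ⟨h1.1, mem_singleton.2 h1.2.symm⟩
    · rintro ⟨⟨x, _⟩, ⟨y, _⟩⟩ _ ⟨⟨x', _⟩, ⟨y', _⟩⟩ _ hxy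
      simp only [Prod.mk.injEq] at hxy
      obtain ⟨rfl, rfl⟩ := hxy
      rfl
    · refine (card_union_le _ _).trans (le_trans (add_le_add ?_ ?_) hk2)
      · rw [card_product, card_window]
        exact Nat.mul_le_mul_right _ (h.card_first p.1.2)
      · rw [card_product, card_singleton, mul_one]
        exact h.card_second p.1.2
  · intro f
    refine le_trans (card_le_card_of_injOn Subtype.val (t := G.neighborFinset f.1 ∪ second G q f.1)
      (fun r hr => ?_) Subtype.val_injective.injOn) ?_
    · obtain ⟨_, γ, γ', hc⟩ := mem_filter.1 hr
      rw [mem_coe, mem_union]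
      rcases conf_cases hc with h1 | h1
      · exact Or.inl h1.1
      · exact Or.inr h1.1
    · exact (card_union_le _ _).trans (le_trans (add_le_add (h.card_first f.2) (h.card_second f.2)) hk3)
  · intro col f
    set val : V → ℤ := fun x => if hx : x ∈ R then ((col ⟨x, hx⟩).map Subtype.val).getD 0 else 0 with hval
    have hv : ∀ e γ, col e = some γ → val e.1 = γ.1 := by
      intro e γ he
      simp only [hval, e.2, dif_pos, he, Option.map_some, Option.getD_some]
    refine le_trans (card_le_card_of_injOn Subtype.val
      (t := (G.neighborFinset f.1).biUnion (fun x => Finset.Icc (val x - k) (val x + k)) ∪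
        (second G q f.1).image val) (fun γ hγ => ?_) Subtype.val_injective.injOn) ?_
    · obtain ⟨_, e, γ', he, hc⟩ := mem_filter.1 hγ
      rw [mem_coe, mem_union, mem_biUnion, mem_image]
      rcases conf_cases hc with h1 | h1
      · exact Or.inl ⟨e.1, h1.1, by rw [hv e γ' he]; exact h1.2.2⟩
      · exact Or.inr ⟨e.1, h1.1, by rw [hv e γ' he]; exact h1.2.symm⟩
    · refine (card_union_le _ _).trans (le_trans (add_le_add ?_ ?_) hk2)
      · refine card_biUnion_le.trans ((sum_le_card_nsmul _ _ (2 * k + 1) fun x _ => (card_window _ _).le).trans ?_)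
        rw [smul_eq_mul]
        exact Nat.mul_le_mul_right _ (h.card_first f.2)
      · exact card_image_le.trans (h.card_second f.2)
  · intro p
    refine le_trans (card_le_card_of_injOn Subtype.val (t := Finset.Icc (p.2.1 - k) (p.2.1 + k))
      (fun γ hγ => ?_) Subtype.val_injective.injOn) (card_window _ _).le
    obtain ⟨_, f, hc⟩ := mem_filter.1 hγ
    rcases conf_cases hc with h1 | h1
    · exact h1.2.2
    · have h2 : γ.1 = p.2.1 := h1.2
      rw [mem_coe, mem_Icc, h2]
      omega

theorem excess (h : Core G R a b q) {D : ℕ} {ε : ℝ} (hD : ∀ v, G.degree v ≤ D)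
    (hX : ∀ X : Finset V, X ⊆ R.image a ∪ R.image b →
      (∑ v ∈ X, (((G.neighborFinset v).filter (fun u => u ∉ R)).card : ℝ)) -
        ((R.filter (fun r => (a r ∈ X ∧ b r ∉ X) ∨ (a r ∉ X ∧ b r ∈ X))).card : ℝ)
        ≤ ε * (D : ℝ) * (X.card : ℝ) / 10) :
    h.multi.Excess D ε fun v => (((G.neighborFinset v).filter (fun u => u ∉ R)).card : ℝ) := by
  refine ⟨fun v => Nat.cast_nonneg _, fun v => by exact_mod_cast h.star_card_add_le hD v, fun X hne => ?_⟩
  have hXW : X ⊆ R.image a ∪ R.image b := by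
    intro v hv
    obtain ⟨r, hr⟩ := hne v hv
    have hr' : a r.1 = v ∨ b r.1 = v := Multi.mem_star.1 hr
    rw [mem_union, mem_image, mem_image]
    rcases hr' with hr' | hr'
    · exact Or.inl ⟨r.1, r.2, hr'⟩
    · exact Or.inr ⟨r.1, r.2, hr'⟩
  have hb : (h.multi.boundary X).card =
      (R.filter (fun r => (a r ∈ X ∧ b r ∉ X) ∨ (a r ∉ X ∧ b r ∈ X))).card := by
    refine card_bij (fun r _ => r.1) (fun r hr => ?_) (fun r _ r' _ hrr => Subtype.ext hrr) (fun r hr => ?_)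
    · exact mem_filter.2 ⟨r.2, (mem_filter.1 hr).2⟩
    · obtain ⟨h1, h2⟩ := mem_filter.1 hr
      exact ⟨⟨r, h1⟩, mem_filter.2 ⟨mem_univ _, h2⟩, rfl⟩
  rw [hb]
  exact hX X hXW

/-- The colour `z` is compatible at `e` with the colours of the vertices outside the core. -/
def Compat (G : SimpleGraph V) (R : Finset V) (q : ℝ) (c : V → ℤ) (e : V) (z : ℤ) : Prop :=
  (∀ u, u ∉ R → G.Adj e u → q ≤ |(z : ℝ) - c u|) ∧
    ∀ u w, u ∉ R → G.Adj e w → G.Adj w u → z ≠ c u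

theorem card_not_compat_le (h : Core G R a b q) (c : V → ℤ) {e : V} (he : e ∈ R) (L : Finset ℤ) :
    (L.filter fun z => ¬ Compat G R q c e z).card ≤ 4 * ⌊q⌋₊ ^ 2 +
      ((G.neighborFinset (a e)).filter (fun u => u ∉ R)).card +
      ((G.neighborFinset (b e)).filter (fun u => u ∉ R)).card := by
  set k := ⌊q⌋₊ with hk
  have hk2 : k * (2 * k + 1) + k * k ≤ 4 * k ^ 2 := by
    rcases Nat.eq_zero_or_pos k with h0 | h0
    · simp [h0]
    · nlinarith
  have hsub : (L.filter fun z => ¬ Compat G R q c e z) ⊆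
      ((G.neighborFinset e).biUnion (fun x => Finset.Icc (c x - k) (c x + k)) ∪ (second G q e).image c) ∪
      ((G.neighborFinset (a e)).filter (fun u => u ∉ R)).image c ∪
      ((G.neighborFinset (b e)).filter (fun u => u ∉ R)).image c := by
    intro z hz
    have hz2 := (mem_filter.1 hz).2
    rw [mem_union, mem_union, mem_union]
    by_contra hcon
    push Not at hcon
    obtain ⟨⟨⟨h1, h2⟩, h3⟩, h4⟩ := hcon
    refine hz2 ⟨fun u hu hadj => ?_, fun u w hu hew hwu hzu => ?_⟩
    · by_contra hlt
      exact h1 (mem_biUnion.2 ⟨u, by simpa using hadj, mem_Icc_of_abs_sub_lt (not_le.1 hlt)⟩)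
    · by_cases hwa : w = a e
      · exact h3 (mem_image.2 ⟨u, mem_filter.2 ⟨by simpa [← hwa] using hwu, hu⟩, hzu.symm⟩)
      · by_cases hwb : w = b e
        · exact h4 (mem_image.2 ⟨u, mem_filter.2 ⟨by simpa [← hwb] using hwu, hu⟩, hzu.symm⟩)
        · exact h2 (mem_image.2 ⟨u, mem_second.2 ⟨w, hew, h.low e he w hew hwa hwb, hwu⟩, hzu.symm⟩)
  refine (card_le_card hsub).trans ?_
  refine (card_union_le _ _).trans (add_le_add ((card_union_le _ _).trans (add_le_add
    ((card_union_le _ _).trans (le_trans (add_le_add ?_ ?_) hk2)) card_image_le)) card_image_le)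
  · refine card_biUnion_le.trans ((sum_le_card_nsmul _ _ (2 * k + 1) fun x _ => (card_window _ _).le).trans ?_)
    rw [smul_eq_mul]
    exact Nat.mul_le_mul_right _ (h.card_first he)
  · exact card_image_le.trans (h.card_second he)

end Core

namespace Core
variable {V : Type} [Fintype V] [DecidableEq V] {G : SimpleGraph V} [DecidableRel G.Adj]
  {R : Finset V} {a b : V → V} {q : ℝ}

/-- The extension of `c` by a colouring of the core. -/
def extend (R : Finset V) (c : V → ℤ) (d : {r // r ∈ R} → ℤ) (v : V) : ℤ :=
  if h : v ∈ R then d ⟨v, h⟩ else c v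

theorem extend_of_mem (c : V → ℤ) (d : {r // r ∈ R} → ℤ) {v : V} (h : v ∈ R) :
    extend R c d v = d ⟨v, h⟩ := dif_pos h

theorem extend_of_notMem (c : V → ℤ) (d : {r // r ∈ R} → ℤ) {v : V} (h : v ∉ R) :
    extend R c d v = c v := dif_neg h

theorem extend_spec (h : Core G R a b q) (hq : 0 < q) {L : V → Finset ℤ} {c : V → ℤ} {S : Finset ℤ}
    (hcL : ∀ v, v ∉ R → c v ∈ L v)
    (hc1 : ∀ u v, u ∉ R → v ∉ R → u ≠ v → (G.Adj u v ∨ ∃ w, G.Adj u w ∧ G.Adj w v) → c u ≠ c v)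
    (hc2 : ∀ u v, u ∉ R → v ∉ R → G.Adj u v → q ≤ |(c u : ℝ) - (c v : ℝ)|)
    (d : {r // r ∈ R} → {z // z ∈ S}) (hdL : ∀ e, (d e).1 ∈ L e.1)
    (hdc : ∀ e, Compat G R q c e.1 (d e).1)
    (hd1 : ∀ e f v, h.multi.inc e v → h.multi.inc f v → d e = d f → e = f)
    (hd2 : ∀ e f, ¬ conf G R q S (e, d e) (f, d f)) :
    ∃ c' : V → ℤ,
      (∀ v, v ∉ R → c' v = c v) ∧
      (∀ v, c' v ∈ L v) ∧
      (∀ u v, u ≠ v → (G.Adj u v ∨ ∃ w, G.Adj u w ∧ G.Adj w v) → c' u ≠ c' v) ∧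
      (∀ u v, G.Adj u v → q ≤ |(c' u : ℝ) - (c' v : ℝ)|) := by
  have hin : ∀ {v} (hv : v ∈ R), extend R c (fun e => (d e).1) v = (d ⟨v, hv⟩).1 := fun hv =>
    extend_of_mem _ _ hv
  have hout : ∀ {v}, v ∉ R → extend R c (fun e => (d e).1) v = c v := fun hv => extend_of_notMem _ _ hv
  have hadj : ∀ u v, G.Adj u v → q ≤ |(extend R c (fun e => (d e).1) u : ℝ) -
      (extend R c (fun e => (d e).1) v : ℝ)| := by
    intro u v huv
    by_cases hu : u ∈ R <;> by_cases hv : v ∈ R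
    · rw [hin hu, hin hv]
      by_contra hlt
      refine hd2 ⟨u, hu⟩ ⟨v, hv⟩ ⟨fun he => huv.ne (congrArg Subtype.val he), Or.inl ⟨huv, not_le.1 hlt⟩⟩
    · rw [hin hu, hout hv]
      exact (hdc ⟨u, hu⟩).1 v hv huv
    · rw [hout hu, hin hv, abs_sub_comm]
      exact (hdc ⟨v, hv⟩).1 u hu huv.symm
    · rw [hout hu, hout hv]
      exact hc2 u v hu hv huv
  refine ⟨extend R c fun e => (d e).1, fun v => hout, fun v => ?_, fun u v huv hdist => ?_, hadj⟩
  · by_cases hv : v ∈ R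
    · rw [hin hv]; exact hdL ⟨v, hv⟩
    · rw [hout hv]; exact hcL v hv
  rcases hdist with huv' | ⟨w, huw, hwv⟩
  · intro heq
    have h1 := hadj u v huv'
    rw [heq, sub_self, abs_zero] at h1
    linarith
  by_cases hu : u ∈ R <;> by_cases hv : v ∈ R
  · rw [hin hu, hin hv]
    intro heq
    have heq' : d ⟨u, hu⟩ = d ⟨v, hv⟩ := Subtype.ext heq
    have hne : (⟨u, hu⟩ : {r // r ∈ R}) ≠ ⟨v, hv⟩ := fun he => huv (congrArg Subtype.val he)
    by_cases hw : (G.degree w : ℝ) < q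
    · exact hd2 ⟨u, hu⟩ ⟨v, hv⟩ ⟨hne, Or.inr ⟨heq', w, huw, hw, hwv⟩⟩
    · have hend : ∀ x (hx : x ∈ R), G.Adj x w → h.multi.inc ⟨x, hx⟩ w := by
        intro x hx hxw
        by_contra hcon
        have hcon' : ¬ (a x = w ∨ b x = w) := hcon
        rw [not_or] at hcon'
        exact hw (h.low x hx w hxw (Ne.symm hcon'.1) (Ne.symm hcon'.2))
      exact hne (hd1 _ _ w (hend u hu huw) (hend v hv hwv.symm) heq')
  · rw [hin hu, hout hv]
    exact (hdc ⟨u, hu⟩).2 v w hv huw hwv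
  · rw [hout hu, hin hv]
    exact ((hdc ⟨v, hv⟩).2 u w hu hwv.symm huw.symm).symm
  · rw [hout hu, hout hv]
    exact hc1 u v hu hv huv (Or.inr ⟨w, huw, hwv⟩)

end Core

/-- A colouring of the complement of the core of a removable subdivided multigraph extends. -/
theorem exists_extension (ε : ℝ) (hε : 0 < ε) : ∃ Δ₀ : ℕ, ∀ Δ : ℕ, Δ₀ ≤ Δ →
    ∀ (V : Type) [Fintype V] [DecidableEq V] (G : SimpleGraph V) [DecidableRel G.Adj],
    (∀ v, G.degree v ≤ Δ) →
    ∀ L : V → Finset ℤ,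
    (∀ v, ⌊(3 / 2 + ε) * (Δ : ℝ)⌋ ≤ ((L v).card : ℤ)) →
    ∀ (R : Finset V) (a b : V → V), Core G R a b ((Δ : ℝ) ^ ((1 : ℝ) / 4)) →
    (∀ X : Finset V, X ⊆ R.image a ∪ R.image b →
      (∑ v ∈ X, (((G.neighborFinset v).filter (fun u => u ∉ R)).card : ℝ)) -
        ((R.filter (fun r => (a r ∈ X ∧ b r ∉ X) ∨ (a r ∉ X ∧ b r ∈ X))).card : ℝ)
        ≤ ε * (Δ : ℝ) * (X.card : ℝ) / 10) →
    ∀ c : V → ℤ,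
    (∀ v, v ∉ R → c v ∈ L v) →
    (∀ u v, u ∉ R → v ∉ R → u ≠ v →
      (G.Adj u v ∨ ∃ w, G.Adj u w ∧ G.Adj w v) → c u ≠ c v) →
    (∀ u v, u ∉ R → v ∉ R → G.Adj u v →
      (Δ : ℝ) ^ ((1 : ℝ) / 4) ≤ |(c u : ℝ) - (c v : ℝ)|) →
    ∃ c' : V → ℤ,
      (∀ v, v ∉ R → c' v = c v) ∧
      (∀ v, c' v ∈ L v) ∧
      (∀ u v, u ≠ v → (G.Adj u v ∨ ∃ w, G.Adj u w ∧ G.Adj w v) → c' u ≠ c' v) ∧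
      (∀ u v, G.Adj u v → (Δ : ℝ) ^ ((1 : ℝ) / 4) ≤ |(c' u : ℝ) - (c' v : ℝ)|) := by
  obtain ⟨η, hη, D₀, hcol⟩ := Multi.exists_list_colouring hε
  set M : ℝ := max 1 (max (16 / η) (50 / ε)) with hM
  have hM1 : 1 ≤ M := le_max_left _ _
  obtain ⟨D₁, hD₁⟩ := exists_nat_ge (M ^ 4)
  refine ⟨max D₀ D₁, ?_⟩
  intro Δ hΔ V _ _ G _ hdeg L hL R a b h hX c hcL hc1 hc2
  set q : ℝ := (Δ : ℝ) ^ ((1 : ℝ) / 4) with hq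
  have hΔM : M ^ 4 ≤ Δ := hD₁.trans (by exact_mod_cast (le_max_right _ _).trans hΔ)
  have hq4 : q ^ 4 = Δ := by
    rw [hq, ← Real.rpow_natCast, ← Real.rpow_mul (Nat.cast_nonneg _)]
    norm_num
  have hq0' : 0 ≤ q := Real.rpow_nonneg (Nat.cast_nonneg _) _
  have hMq : M ≤ q := by
    refine le_of_pow_le_pow_left₀ (n := 4) (by norm_num) hq0' ?_
    rw [hq4]; exact hΔM
  have hq1 : 1 ≤ q := hM1.trans hMq
  have hq0 : 0 < q := by linarith
  have hqη : 16 ≤ η * q := by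
    have h1 : 16 / η ≤ q := ((le_max_left _ _).trans (le_max_right _ _)).trans hMq
    rw [div_le_iff₀ hη] at h1
    linarith
  have hqε : 50 ≤ ε * q := by
    have h1 : 50 / ε ≤ q := ((le_max_right _ _).trans (le_max_right _ _)).trans hMq
    rw [div_le_iff₀ hε] at h1
    linarith
  have hk : (⌊q⌋₊ : ℝ) ≤ q := Nat.floor_le hq0'
  have hk0 : (0 : ℝ) ≤ ⌊q⌋₊ := Nat.cast_nonneg _
  have hk2 : (⌊q⌋₊ : ℝ) ^ 2 ≤ q ^ 2 := pow_le_pow_left₀ hk0 hk 2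
  have hsqrt : Real.sqrt Δ = q ^ 2 := by
    rw [← hq4, show q ^ 4 = (q ^ 2) ^ 2 by ring, Real.sqrt_sq (by positivity)]
  have hηΔ : 16 * q ^ 3 ≤ η * Δ := by
    rw [← hq4]
    have : 16 * q ^ 3 ≤ η * q * q ^ 3 := mul_le_mul_of_nonneg_right hqη (by positivity)
    linarith
  have hw : (1 : ℝ) + ((2 * ⌊q⌋₊ + 1 : ℕ) : ℝ) ≤ 4 * q := by
    push_cast; linarith
  set S : Finset ℤ := univ.biUnion L with hS
  set Lst : {r // r ∈ R} → Finset {z // z ∈ S} := fun e =>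
    univ.filter fun z => z.1 ∈ L e.1 ∧ Core.Compat G R q c e.1 z.1 with hLst
  have hcardL : ∀ e, (Lst e).card = ((L e.1).filter fun z => Core.Compat G R q c e.1 z).card := by
    intro e
    refine card_bij (fun z _ => z.1) (fun z hz => mem_filter.2 (mem_filter.1 hz).2)
      (fun z _ z' _ hzz => Subtype.ext hzz) (fun z hz => ?_)
    have hz' := mem_filter.1 hz
    exact ⟨⟨z, mem_biUnion.2 ⟨e.1, mem_univ _, hz'.1⟩⟩, mem_filter.2 ⟨mem_univ _, hz'⟩, rfl⟩
  obtain ⟨d, hd, hd1, hd2⟩ := hcol Δ ((le_max_left _ _).trans hΔ) V {r // r ∈ R} {z // z ∈ S} h.multi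
    (4 * ⌊q⌋₊ ^ 2) (2 * ⌊q⌋₊ + 1) (Core.conf G R q S) Lst
    (fun v => (((G.neighborFinset v).filter (fun u => u ∉ R)).card : ℝ))
    (by
      refine le_trans ?_ hηΔ
      push_cast at hw ⊢
      calc 4 * (⌊q⌋₊ : ℝ) ^ 2 * (1 + (2 * ⌊q⌋₊ + 1)) ≤ 4 * q ^ 2 * (4 * q) := by gcongr
        _ = 16 * q ^ 3 := by ring)
    (by
      refine le_trans ?_ hηΔ
      rw [hsqrt]
      calc q ^ 2 * (1 + ((2 * ⌊q⌋₊ + 1 : ℕ) : ℝ)) ≤ q ^ 2 * (4 * q) := by gcongr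
        _ ≤ 16 * q ^ 3 := by nlinarith [pow_pos hq0 3])
    (h.system hdeg S) (h.excess hdeg hX)
    (by
      intro e
      have h1 := h.card_not_compat_le c e.2 (L e.1)
      have h2 := card_filter_add_card_filter_not (s := L e.1) (fun z => Core.Compat G R q c e.1 z)
      have h3 : (3 / 2 + ε) * (Δ : ℝ) - 1 ≤ (L e.1).card := by
        have h4 : ((⌊(3 / 2 + ε) * (Δ : ℝ)⌋ : ℤ) : ℝ) ≤ (L e.1).card := by exact_mod_cast hL e.1
        have := Int.sub_one_lt_floor ((3 / 2 + ε) * (Δ : ℝ))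
        linarith
      rw [← hcardL] at h2
      have h5 : ((L e.1).card : ℝ) ≤ (Lst e).card + (4 * (⌊q⌋₊ : ℝ) ^ 2 +
          ((G.neighborFinset (a e.1)).filter (fun u => u ∉ R)).card +
          ((G.neighborFinset (b e.1)).filter (fun u => u ∉ R)).card) := by
        exact_mod_cast h2 ▸ Nat.add_le_add_left h1 _
      have h6 : 5 * q ^ 2 ≤ ε / 10 * Δ := by
        rw [← hq4]
        have h7 : 50 * q ^ 2 ≤ ε * q * (q * q ^ 2) := by
          refine mul_le_mul hqε ?_ (by positivity) (by positivity)
          nlinarith [pow_pos hq0 2]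
        linarith
      have h8 : 1 ≤ q ^ 2 := one_le_pow₀ hq1
      show (3 / 2 + 9 * ε / 10) * (Δ : ℝ) - (((G.neighborFinset (a e.1)).filter (fun u => u ∉ R)).card : ℝ) -
        (((G.neighborFinset (b e.1)).filter (fun u => u ∉ R)).card : ℝ) ≤ (Lst e).card
      linarith)
  exact h.extend_spec hq0 hcL hc1 hc2 d (fun e => (mem_filter.1 (hd e)).2.1)
    (fun e => (mem_filter.1 (hd e)).2.2) hd1 hd2

end

/-- Lemma: if `R` is the core of a removable copy of `H*` in `G` (with branch
maps `a`, `b`) satisfying the degree-excess condition, then every proper list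
colouring of `G² - R` with colours on `G`-adjacent vertices differing by at
least `Δ^{1/4}` extends to all of `G²`. -/
theorem stmt_1 (ε : ℝ) (hε : 0 < ε) :
    ∃ Δ₀ : ℕ, ∀ Δ : ℕ, Δ₀ ≤ Δ →
    ∀ (V : Type) [Fintype V] [DecidableEq V] (G : SimpleGraph V) [DecidableRel G.Adj],
    (∀ v, G.degree v ≤ Δ) →
    ∀ L : V → Finset ℤ,
    (∀ v, ⌊(3 / 2 + ε) * (Δ : ℝ)⌋ ≤ ((L v).card : ℤ)) →
    ∀ (R : Finset V) (a b : V → V),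
    (∀ r ∈ R, a r ≠ b r) →
    (∀ r ∈ R, a r ∉ R) →
    (∀ r ∈ R, b r ∉ R) →
    (∀ r ∈ R, G.Adj r (a r)) →
    (∀ r ∈ R, G.Adj r (b r)) →
    (∀ r ∈ R, (Δ : ℝ) ^ ((1 : ℝ) / 4) ≤ (G.degree (a r) : ℝ)) →
    (∀ r ∈ R, (Δ : ℝ) ^ ((1 : ℝ) / 4) ≤ (G.degree (b r) : ℝ)) →
    (∀ r ∈ R, (G.degree r : ℝ) ≤ (Δ : ℝ) ^ ((1 : ℝ) / 4)) →
    (∀ r ∈ R, ∀ u, G.Adj r u → u ≠ a r → u ≠ b r →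
      (G.degree u : ℝ) < (Δ : ℝ) ^ ((1 : ℝ) / 4)) →
    (∀ X : Finset V, X ⊆ R.image a ∪ R.image b →
      (∑ v ∈ X, (((G.neighborFinset v).filter (fun u => u ∉ R)).card : ℝ)) -
        ((R.filter (fun r => (a r ∈ X ∧ b r ∉ X) ∨ (a r ∉ X ∧ b r ∈ X))).card : ℝ)
        ≤ ε * (Δ : ℝ) * (X.card : ℝ) / 10) →
    ∀ c : V → ℤ,
    (∀ v, v ∉ R → c v ∈ L v) →
    (∀ u v, u ∉ R → v ∉ R → u ≠ v →
      (G.Adj u v ∨ ∃ w, G.Adj u w ∧ G.Adj w v) → c u ≠ c v) →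
    (∀ u v, u ∉ R → v ∉ R → G.Adj u v →
      (Δ : ℝ) ^ ((1 : ℝ) / 4) ≤ |(c u : ℝ) - (c v : ℝ)|) →
    ∃ c' : V → ℤ,
      (∀ v, v ∉ R → c' v = c v) ∧
      (∀ v, c' v ∈ L v) ∧
      (∀ u v, u ≠ v → (G.Adj u v ∨ ∃ w, G.Adj u w ∧ G.Adj w v) → c' u ≠ c' v) ∧
      (∀ u v, G.Adj u v → (Δ : ℝ) ^ ((1 : ℝ) / 4) ≤ |(c' u : ℝ) - (c' v : ℝ)|) := by
  obtain ⟨Δ₀, h⟩ := exists_extension ε hε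
  refine ⟨Δ₀, fun Δ hΔ V _ _ G _ hdeg L hL R a b h1 h2 h3 h4 h5 h6 h7 h8 h9 hX c hc1 hc2 hc3 => ?_⟩
  exact h Δ hΔ V G hdeg L hL R a b ⟨h1, h2, h3, h4, h5, h6, h7, h8, h9⟩
    (fun X hXW => by convert hX X hXW) c hc1 hc2 hc3
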